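/- Let σ be a non-zero cone satisfying the vanishing condition V(σ), and let Λ_σ be the flattened boundary fan of σ. Then P_σ(t) = τ_{<dim σ}((1−t²)·P_{Λ_σ}(t)), where τ_{<r} truncates a polynomial to its terms of degree < r. -/

import Mathlib

open Module Function

set_option synthInstance.maxHeartbeats 1000000
set_option maxHeartbeats 1000000
set_option maxSynthPendingDepth 3

noncomputable section

/-! ## Cones and fans -/

/-- The convex cone generated by a finite set of vectors. -/
def coneGen {V : Type} [AddCommGroup V] [Module ℝ V] (s : Finset V) : Set V :=
  { x | ∃ c : V → ℝ, (∀ v ∈ s, 0 ≤ c v) ∧ x = ∑ v ∈ s, c v • v }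

/-- A (strictly convex, i.e. pointed) polyhedral cone in a real vector space. -/
structure Cone (V : Type) [AddCommGroup V] [Module ℝ V] where
  carrier : Set V
  isPoly : ∃ s : Finset V, carrier = coneGen s
  pointed : ∀ x ∈ carrier, -x ∈ carrier → x = 0

namespace Cone

variable {V : Type} [AddCommGroup V] [Module ℝ V]

/-- The linear span `V_σ` of a cone. -/
def spanC (σ : Cone V) : Submodule ℝ V := Submodule.span ℝ σ.carrier

/-- The dimension of a cone. -/
def dim (σ : Cone V) : ℕ := Module.finrank ℝ σ.spanC

/-- `τ` is a face of `σ` (cut out by a supporting linear form); `σ` is a face of itself. -/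
def IsFaceOf (τ σ : Cone V) : Prop :=
  ∃ f : V →ₗ[ℝ] ℝ, (∀ x ∈ σ.carrier, 0 ≤ f x) ∧
    τ.carrier = σ.carrier ∩ {x | f x = 0}

def IsProperFaceOf (τ σ : Cone V) : Prop := τ.IsFaceOf σ ∧ τ ≠ σ

/-- A cone is simplicial if it is generated by linearly independent vectors. -/
def IsSimplicial (σ : Cone V) : Prop :=
  ∃ s : Finset V, (LinearIndependent ℝ (fun v : s => (v : V))) ∧ σ.carrier = coneGen s

end Cone

/-- The zero cone `o`. -/
def zeroCone (V : Type) [AddCommGroup V] [Module ℝ V] : Cone V where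
  carrier := {0}
  isPoly := ⟨∅, by ext x; simp [coneGen]⟩
  pointed := by intro x hx _; simpa using hx

/-- A fan in `V`: a finite collection of pointed polyhedral cones, closed under taking
faces, such that the intersection of any two cones is a common face of both. -/
structure Fan (V : Type) [AddCommGroup V] [Module ℝ V] where
  cones : Set (Cone V)
  finite : cones.Finite
  zero_mem : zeroCone V ∈ cones
  face_mem : ∀ σ ∈ cones, ∀ τ : Cone V, τ.IsFaceOf σ → τ ∈ cones
  inter_mem : ∀ σ ∈ cones, ∀ σ' ∈ cones, ∃ τ ∈ cones,
    τ.IsFaceOf σ ∧ τ.IsFaceOf σ' ∧ τ.carrier = σ.carrier ∩ σ'.carrier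

namespace Fan

variable {V : Type} [AddCommGroup V] [Module ℝ V]

/-- A subfan of `Δ`: a subset of the cones closed under taking faces.  The subfans are
exactly the open subsets of the fan topology. -/
def IsSubfan (Δ : Fan V) (Λ : Set (Cone V)) : Prop :=
  Λ ⊆ Δ.cones ∧ ∀ σ ∈ Λ, ∀ τ : Cone V, τ.IsFaceOf σ → τ ∈ Λ

/-- The support `|Δ|` of a fan. -/
def support (Δ : Fan V) : Set V := ⋃ σ ∈ Δ.cones, σ.carrier

/-- A fan is complete if its support is the whole space. -/
def IsComplete (Δ : Fan V) : Prop := Δ.support = Set.univ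

/-- A fan is simplicial if all its cones are. -/
def IsSimplicial (Δ : Fan V) : Prop := ∀ σ ∈ Δ.cones, σ.IsSimplicial

/-- A fan is purely `n`-dimensional if every cone is a face of an `n`-dimensional cone. -/
def IsPurely (Δ : Fan V) (n : ℕ) : Prop :=
  ∀ σ ∈ Δ.cones, ∃ σ' ∈ Δ.cones, σ.IsFaceOf σ' ∧ σ'.dim = n

/-- The boundary subfan `∂Δ`: the cones supported in the topological boundary of `|Δ|`. -/
def boundary [TopologicalSpace V] (Δ : Fan V) : Set (Cone V) :=
  {τ ∈ Δ.cones | τ.carrier ⊆ frontier Δ.support}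

end Fan

/-! ## The graded algebra `A•` of polynomial functions (linear forms in degree 2) -/

/-- The algebra of polynomial functions on `V`, i.e. the subalgebra of `V → ℝ`
generated by the linear forms. -/
def polyAlg (V : Type) [AddCommGroup V] [Module ℝ V] : Subalgebra ℝ (V → ℝ) :=
  Algebra.adjoin ℝ {f : V → ℝ | IsLinearMap ℝ f}

/-- `A• = S•(V*)` as a commutative ring. -/
abbrev PolyRing (V : Type) [AddCommGroup V] [Module ℝ V] : Type := polyAlg V

variable (V : Type) [AddCommGroup V] [Module ℝ V]

/-- Polynomial functions homogeneous of (topological) degree `2k`. -/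
def AdegN (k : ℕ) : Submodule ℝ (PolyRing V) where
  carrier := {f | ∀ (t : ℝ) (x : V), (f : V → ℝ) (t • x) = t ^ k * (f : V → ℝ) x}
  add_mem' := by intro f g hf hg t x; simp [hf t x, hg t x]; ring
  zero_mem' := by intro t x; simp
  smul_mem' := by intro c f hf t x; simp [hf t x]; ring

/-- The degree-`q` part `A^q` of `A•`, with linear forms in degree `2`
(so `A^q = 0` for odd `q`). -/
def Adeg (q : ℤ) : Submodule ℝ (PolyRing V) :=
  ⨆ (k : ℕ) (_ : q = 2 * k), AdegN V k

/-- Evaluation of a polynomial function at a point, as a ring homomorphism. -/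
def evalRH (x : V) : PolyRing V →+* ℝ :=
  (Pi.evalRingHom (fun _ : V => ℝ) x).comp (polyAlg V).val.toRingHom

/-- The maximal graded ideal `m = A^{>0}` of polynomial functions vanishing at the origin. -/
def mId : Ideal (PolyRing V) := RingHom.ker (evalRH V 0)

/-- The ideal of polynomial functions vanishing on a subset `s ⊆ V`;
for `s = σ` a cone, `A•/I(σ) = A•_σ = S•(V_σ*)`. -/
def vanishingIdeal (s : Set V) : Ideal (PolyRing V) :=
  RingHom.ker (Pi.ringHom (fun x : s => evalRH V x.1))

/-- `A•_σ`, realized as the quotient of `A•` by the functions vanishing on `σ`. -/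
abbrev coneRing (σ : Cone V) : Type := PolyRing V ⧸ vanishingIdeal V σ.carrier

/-! ## Graded `A•`-modules -/

/-- A graded `A•`-module (with real structure): an `A•`-module with an internal
`ℤ`-grading by real subspaces, compatible with the grading of `A•`. -/
structure GAMod where
  M : Type
  [acg : AddCommGroup M]
  [modA : Module (PolyRing V) M]
  [modR : Module ℝ M]
  [tower : IsScalarTower ℝ (PolyRing V) M]
  deg : ℤ → Submodule ℝ M
  internal : DirectSum.IsInternal deg
  smul_deg : ∀ (p q : ℤ), ∀ a ∈ Adeg V p, ∀ x ∈ deg q, a • x ∈ deg (p + q)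

attribute [instance] GAMod.acg GAMod.modA GAMod.modR GAMod.tower

variable {V}

/-- A homomorphism of graded `A•`-modules, homogeneous of degree 0. -/
structure GHom (M N : GAMod V) where
  toLin : M.M →ₗ[PolyRing V] N.M
  deg_mem : ∀ q : ℤ, ∀ x ∈ M.deg q, toLin x ∈ N.deg q

def GHom.id (M : GAMod V) : GHom M M := ⟨LinearMap.id, fun _ _ h => h⟩

def GHom.comp {M N P : GAMod V} (g : GHom N P) (f : GHom M N) : GHom M P :=
  ⟨g.toLin ∘ₗ f.toLin, fun q x hx => g.deg_mem q _ (f.deg_mem q x hx)⟩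

variable (V)

/-- `M` is (the `A•`-module underlying) a free `A•_σ`-module. -/
def FreeOverCone (σ : Cone V) (M : Type) [AddCommGroup M] [Module (PolyRing V) M] : Prop :=
  ∃ h : Module.IsTorsionBySet (PolyRing V) M (vanishingIdeal V σ.carrier),
    letI := h.module
    Module.Free (coneRing V σ) M

/-! ## Reduction modulo the maximal graded ideal -/

/-- The submodule `m·M`. -/
def mSub (M : Type) [AddCommGroup M] [Module (PolyRing V) M] :
    Submodule (PolyRing V) M := (mId V) • (⊤ : Submodule (PolyRing V) M)

/-- The reduction `M̄ = M/mM`. -/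
abbrev mRed (M : Type) [AddCommGroup M] [Module (PolyRing V) M] : Type := M ⧸ mSub V M

lemma mSub_le_comap {M N : Type} [AddCommGroup M] [Module (PolyRing V) M]
    [AddCommGroup N] [Module (PolyRing V) N] (f : M →ₗ[PolyRing V] N) :
    mSub V M ≤ (mSub V N).comap f := by
  rw [mSub, Submodule.smul_le]
  intro r hr x _
  simp only [Submodule.mem_comap, map_smul]
  exact Submodule.smul_mem_smul hr trivial

/-- The reduced map `M̄ → N̄` induced by an `A•`-linear map. -/
def mRedMap {M N : Type} [AddCommGroup M] [Module (PolyRing V) M]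
    [AddCommGroup N] [Module (PolyRing V) N] (f : M →ₗ[PolyRing V] N) :
    mRed V M →ₗ[PolyRing V] mRed V N :=
  Submodule.mapQ _ _ f (mSub_le_comap V f)

/-- The image in `M̄` of an `ℝ`-subspace of `M` (e.g. of a graded piece). -/
def mRedPiece {M : Type} [AddCommGroup M] [Module (PolyRing V) M] [Module ℝ M]
    [IsScalarTower ℝ (PolyRing V) M] (p : Submodule ℝ M) : Submodule ℝ (mRed V M) :=
  p.map ((mSub V M).mkQ.restrictScalars ℝ)

/-! ## Sheaves of graded `A•`-modules on a fan -/

open scoped Classical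

/-- The zero cone as an element of a fan. -/
def Fan.ozero {V : Type} [AddCommGroup V] [Module ℝ V] (Δ : Fan V) : Δ.cones :=
  ⟨zeroCone V, Δ.zero_mem⟩


variable {V}

/-- A sheaf of graded `A•`-modules on the fan space `Δ`, given (as the fan topology
dictates) by its stalks on the cones together with compatible restriction maps. -/
structure FanSheaf (Δ : Fan V) where
  stalk : Δ.cones → GAMod V
  res : ∀ σ τ : Δ.cones, Cone.IsFaceOf τ.1 σ.1 → GHom (stalk σ) (stalk τ)
  res_self : ∀ (σ : Δ.cones) (h : Cone.IsFaceOf σ.1 σ.1), (res σ σ h).toLin = LinearMap.id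
  res_comp : ∀ (σ τ υ : Δ.cones) (h1 : Cone.IsFaceOf τ.1 σ.1) (h2 : Cone.IsFaceOf υ.1 τ.1)
      (h3 : Cone.IsFaceOf υ.1 σ.1),
      (res τ υ h2).toLin ∘ₗ (res σ τ h1).toLin = (res σ υ h3).toLin

namespace FanSheaf

variable {Δ : Fan V} (F : FanSheaf Δ)

/-- The sections of `F` over a collection `Λ` of cones of `Δ` (e.g. a subfan):
compatible families of elements of the stalks over `Λ`, extended by zero. -/
def secSub (Λ : Set (Cone V)) :
    Submodule (PolyRing V) (∀ σ : Δ.cones, (F.stalk σ).M) where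
  carrier := { s | (∀ σ : Δ.cones, σ.1 ∉ Λ → s σ = 0) ∧
    ∀ (σ τ : Δ.cones), σ.1 ∈ Λ → τ.1 ∈ Λ → ∀ h : Cone.IsFaceOf τ.1 σ.1,
      (F.res σ τ h).toLin (s σ) = s τ }
  add_mem' := by
    rintro a b ⟨ha0, ha⟩ ⟨hb0, hb⟩
    refine ⟨fun σ hσ => by simp [ha0 σ hσ, hb0 σ hσ], fun σ τ hσ hτ h => ?_⟩
    simp [map_add, ha σ τ hσ hτ h, hb σ τ hσ hτ h]
  zero_mem' := ⟨fun _ _ => rfl, fun σ τ _ _ h => by simp⟩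
  smul_mem' := by
    rintro c a ⟨ha0, ha⟩
    refine ⟨fun σ hσ => by simp [ha0 σ hσ], fun σ τ hσ hτ h => ?_⟩
    simp [map_smul, ha σ τ hσ hτ h]

/-- The `A•`-module of sections of `F` over `Λ`. -/
abbrev Sec (Λ : Set (Cone V)) : Type := F.secSub Λ

/-- The global sections `E•(Δ)`. -/
abbrev globalSec : Type := F.Sec Δ.cones

/-- The degree-`q` part of the module of sections. -/
def secDeg (Λ : Set (Cone V)) (q : ℤ) : Submodule ℝ (F.Sec Λ) where
  carrier := { s | ∀ σ : Δ.cones, s.1 σ ∈ (F.stalk σ).deg q }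
  add_mem' := by intro a b ha hb σ; exact add_mem (ha σ) (hb σ)
  zero_mem' := fun σ => zero_mem _
  smul_mem' := by intro c a ha σ; exact Submodule.smul_mem _ c (ha σ)

/-- Restriction of sections to a smaller collection of cones. -/
def resSec (Λ' Λ : Set (Cone V)) (hΛ : Λ ⊆ Λ') : F.Sec Λ' →ₗ[PolyRing V] F.Sec Λ where
  toFun s := ⟨fun σ => if σ.1 ∈ Λ then s.1 σ else 0, by
    classical
    refine ⟨fun σ hσ => by simp [hσ], fun σ τ hσ hτ h => ?_⟩
    simp only [hσ, hτ, if_pos]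
    exact s.2.2 σ τ (hΛ hσ) (hΛ hτ) h⟩
  map_add' a b := by
    apply Subtype.ext; funext σ; by_cases h : σ.1 ∈ Λ <;> simp [h]
  map_smul' c a := by
    apply Subtype.ext; funext σ; by_cases h : σ.1 ∈ Λ <;> simp [h]

/-- A sheaf is flabby if all restrictions from global sections to subfans are surjective. -/
def Flabby : Prop :=
  ∀ Λ : Set (Cone V), ∀ h : Δ.IsSubfan Λ, Function.Surjective (F.resSec Δ.cones Λ h.1)

/-- The boundary fan `∂σ` of a cone of `Δ`, as a set of cones. -/
def bdFan (σ : Δ.cones) : Set (Cone V) := {τ : Cone V | τ.IsProperFaceOf σ.1}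

/-- The restriction map `E•_σ → E•_{∂σ}` from the stalk to the sections over the
boundary fan of `σ`. -/
def bdRes (σ : Δ.cones) : (F.stalk σ).M →ₗ[PolyRing V] F.Sec (bdFan σ) where
  toFun x := ⟨fun τ => if h : Cone.IsProperFaceOf τ.1 σ.1 then (F.res σ τ h.1).toLin x else 0, by
    refine ⟨fun τ hτ => by simp [bdFan] at hτ; simp [hτ], ?_⟩
    intro τ υ hτ hυ h
    simp only [bdFan, Set.mem_setOf_eq] at hτ hυ
    simp only [dif_pos hτ, dif_pos hυ]
    rw [← F.res_comp σ τ υ hτ.1 h hυ.1]; rfl⟩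
  map_add' a b := by
    apply Subtype.ext; funext τ
    by_cases h : Cone.IsProperFaceOf τ.1 σ.1 <;> simp [h]
  map_smul' c a := by
    apply Subtype.ext; funext τ
    by_cases h : Cone.IsProperFaceOf τ.1 σ.1 <;> simp [h]

/-- The reduced restriction map `Ē•_σ → Ē•_{∂σ}` modulo `m`. -/
def bdResRed (σ : Δ.cones) :
    mRed V (F.stalk σ).M →ₗ[PolyRing V] mRed V (F.Sec (bdFan σ)) :=
  mRedMap V (F.bdRes σ)

/-- Condition (N): `E•_o ≅ A•_o = ℝ•`, i.e. the stalk at the zero cone is the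
trivial one-dimensional graded module concentrated in degree `0`. -/
def CondN : Prop :=
  Module.IsTorsionBySet (PolyRing V) (F.stalk Δ.ozero).M (mId V : Set (PolyRing V)) ∧
  Module.finrank ℝ (F.stalk Δ.ozero).M = 1 ∧
  ∀ q : ℤ, q ≠ 0 → (F.stalk Δ.ozero).deg q = ⊥

/-- Condition (PF): each stalk `E•_σ` is a free `A•_σ`-module. -/
def CondPF : Prop := ∀ σ : Δ.cones, FreeOverCone V σ.1 (F.stalk σ).M

/-- Condition (LME): for each nonzero cone `σ`, the restriction `E•_σ → E•_{∂σ}`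
induces, modulo `m`, an isomorphism of graded real vector spaces. -/
def CondLME : Prop :=
  ∀ σ : Δ.cones, σ.1 ≠ zeroCone V → ∀ q : ℤ,
    Set.BijOn (F.bdResRed σ)
      (mRedPiece V ((F.stalk σ).deg q) : Set (mRed V (F.stalk σ).M))
      (mRedPiece V (M := F.Sec (bdFan σ)) (F.secDeg (bdFan σ) q) : Set (mRed V (F.Sec (bdFan σ))))

/-- A minimal extension sheaf on the fan `Δ`. -/
def IsMES : Prop := F.CondN ∧ F.CondPF ∧ F.CondLME

end FanSheaf

/-! ## Quasi-convexity, boundary sections, and Poincaré polynomials -/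

section

variable {V : Type} [AddCommGroup V] [Module ℝ V]

/-- A fan is quasi-convex if the global sections of a minimal extension sheaf on it
form a free `A•`-module. -/
def Fan.QuasiConvex (Δ : Fan V) : Prop :=
  ∀ F : FanSheaf Δ, F.IsMES → Module.Free (PolyRing V) F.globalSec

lemma Fan.boundary_subset [TopologicalSpace V] (Δ : Fan V) : Δ.boundary ⊆ Δ.cones :=
  fun _ h => h.1

/-- The module `E•_{(Δ,∂Δ)}` of global sections vanishing on the boundary subfan. -/
def FanSheaf.relSec [TopologicalSpace V] {Δ : Fan V} (F : FanSheaf Δ) :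
    Submodule (PolyRing V) F.globalSec :=
  LinearMap.ker (F.resSec Δ.cones Δ.boundary (Fan.boundary_subset Δ))

/-- The degree-`q` part of `E•_{(Δ,∂Δ)}`. -/
def FanSheaf.relDeg [TopologicalSpace V] {Δ : Fan V} (F : FanSheaf Δ) (q : ℤ) :
    Submodule ℝ F.relSec :=
  (F.secDeg Δ.cones q).comap ((F.relSec.subtype).restrictScalars ℝ)

/-- The polynomial `Σ_q d(q)·t^q` associated with a (finitely supported) dimension
function. -/
def poincareOf (d : ℕ → ℕ) : Polynomial ℝ :=
  if h : (Function.support d).Finite then ∑ q ∈ h.toFinset, (d q : ℝ) • Polynomial.X ^ q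
  else 0

/-- The local Poincaré polynomial `P_σ(t) = Σ_q dim Ē^q_σ · t^q`. -/
def FanSheaf.localP {Δ : Fan V} (F : FanSheaf Δ) (σ : Δ.cones) : Polynomial ℝ :=
  poincareOf fun q => Module.finrank ℝ (mRedPiece V ((F.stalk σ).deg q))

/-- The global Poincaré polynomial `P_Δ(t) = Σ_q dim Ē^q_Δ · t^q`. -/
def FanSheaf.globalP {Δ : Fan V} (F : FanSheaf Δ) : Polynomial ℝ :=
  poincareOf fun q =>
    Module.finrank ℝ (mRedPiece V (M := F.globalSec) (F.secDeg Δ.cones q))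

/-- The relative Poincaré polynomial `P_{(Δ,∂Δ)}(t)`. -/
def FanSheaf.relP [TopologicalSpace V] {Δ : Fan V} (F : FanSheaf Δ) : Polynomial ℝ :=
  poincareOf fun q =>
    Module.finrank ℝ (mRedPiece V (M := F.relSec) (F.relDeg q))

end

/-- Truncation `τ_{<r}` of a polynomial to its terms of degree `< r`. -/
def truncBelow (r : ℕ) (p : Polynomial ℝ) : Polynomial ℝ :=
  ∑ q ∈ Finset.range r, Polynomial.C (p.coeff q) * Polynomial.X ^ q

set_option linter.unusedSectionVars false
namespace LRF

section
section PartA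
variable {V : Type} [AddCommGroup V] [Module ℝ V]

theorem poly_induction {P : PolyRing V → Prop}
    (hlin : ∀ (f : V →ₗ[ℝ] ℝ) (h : (f : V → ℝ) ∈ polyAlg V), P ⟨f, h⟩)
    (hc : ∀ r : ℝ, P (algebraMap ℝ (PolyRing V) r))
    (hadd : ∀ p q, P p → P q → P (p + q)) (hmul : ∀ p q, P p → P q → P (p * q))
    (p : PolyRing V) : P p := by
  have : ∀ (f : V → ℝ) (h : f ∈ polyAlg V), P ⟨f, h⟩ := by
    intro f h
    induction h using Algebra.adjoin_induction with
    | mem x hx => exact hlin (IsLinearMap.mk' x hx) _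
    | algebraMap r => exact hc r
    | add x y hx hy h1 h2 => exact hadd _ _ h1 h2
    | mul x y hx hy h1 h2 => exact hmul _ _ h1 h2
  exact this p.1 p.2

/-- linear form as polynomial function -/
def lin (f : V →ₗ[ℝ] ℝ) : PolyRing V :=
  ⟨f, Algebra.subset_adjoin ⟨f.map_add, f.map_smul⟩⟩

@[simp] theorem lin_apply (f : V →ₗ[ℝ] ℝ) (x : V) : (lin f).1 x = f x := rfl

theorem poly_ext {p q : PolyRing V} (h : ∀ x, p.1 x = q.1 x) : p = q := Subtype.ext (funext h)

theorem mul_ap (p q : PolyRing V) (x : V) : (p * q).1 x = p.1 x * q.1 x := rfl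
theorem add_ap (p q : PolyRing V) (x : V) : (p + q).1 x = p.1 x + q.1 x := rfl
theorem sub_ap (p q : PolyRing V) (x : V) : (p - q).1 x = p.1 x - q.1 x := rfl
theorem neg_ap (p : PolyRing V) (x : V) : (-p).1 x = -p.1 x := rfl
theorem zero_ap (x : V) : (0 : PolyRing V).1 x = 0 := rfl
theorem one_ap (x : V) : (1 : PolyRing V).1 x = 1 := rfl
theorem smul_ap (c : ℝ) (p : PolyRing V) (x : V) : (c • p).1 x = c * p.1 x := rfl
theorem alg_ap (c : ℝ) (x : V) : (algebraMap ℝ (PolyRing V) c).1 x = c := rfl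
theorem evalRH_ap (x : V) (p : PolyRing V) : evalRH V x p = p.1 x := rfl
theorem sum_ap {ι : Type*} (s : Finset ι) (f : ι → PolyRing V) (x : V) :
    (∑ i ∈ s, f i).1 x = ∑ i ∈ s, (f i).1 x := by
  simpa only [evalRH_ap] using map_sum (evalRH V x) f s
theorem prod_ap {ι : Type*} (s : Finset ι) (f : ι → PolyRing V) (x : V) :
    (∏ i ∈ s, f i).1 x = ∏ i ∈ s, (f i).1 x := by
  simpa only [evalRH_ap] using map_prod (evalRH V x) f s

theorem mem_mId {p : PolyRing V} : p ∈ mId V ↔ p.1 0 = 0 := Iff.rfl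

theorem mem_vI {s : Set V} {p : PolyRing V} : p ∈ vanishingIdeal V s ↔ ∀ x ∈ s, p.1 x = 0 := by
  unfold vanishingIdeal
  rw [RingHom.mem_ker]
  constructor
  · intro h x hx
    exact congrFun h ⟨x, hx⟩
  · intro h
    funext x
    exact h x.1 x.2

theorem lineP (p : PolyRing V) (a b : V) :
    ∃ P : Polynomial ℝ, ∀ c : ℝ, p.1 (a + c • b) = P.eval c := by
  induction p using poly_induction with
  | hlin f h => exact ⟨Polynomial.C (f a) + Polynomial.X * Polynomial.C (f b), fun c => by
      change f (a + c • b) = _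
      simp; ring⟩
  | hc r => exact ⟨Polynomial.C r, fun c => by simp [alg_ap]⟩
  | hadd p q h1 h2 =>
    obtain ⟨P, hP⟩ := h1
    obtain ⟨Q, hQ⟩ := h2
    exact ⟨P + Q, fun c => by rw [add_ap, hP, hQ, Polynomial.eval_add]⟩
  | hmul p q h1 h2 =>
    obtain ⟨P, hP⟩ := h1
    obtain ⟨Q, hQ⟩ := h2
    exact ⟨P * Q, fun c => by rw [mul_ap, hP, hQ, Polynomial.eval_mul]⟩

theorem common_nonzero (W : Submodule ℝ V) (p q : PolyRing V)
    (hp : ∃ x ∈ W, p.1 x ≠ 0) (hq : ∃ x ∈ W, q.1 x ≠ 0) :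
    ∃ x ∈ W, p.1 x ≠ 0 ∧ q.1 x ≠ 0 := by
  obtain ⟨a, ha, hpa⟩ := hp
  obtain ⟨b, hb, hqb⟩ := hq
  obtain ⟨P, hP⟩ := lineP p a (b - a)
  obtain ⟨Q, hQ⟩ := lineP q a (b - a)
  have hP0 : P ≠ 0 := by
    rintro rfl
    have := hP 0
    simp at this
    exact hpa this
  have hQ0 : Q ≠ 0 := by
    rintro rfl
    have := hQ 1
    simp at this
    exact hqb this
  obtain ⟨c, hc⟩ := Infinite.exists_notMem_finset (P * Q).roots.toFinset
  have hc' : (P * Q).eval c ≠ 0 := by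
    intro h
    exact hc (by simp [h, hP0, hQ0] at *)
  rw [Polynomial.eval_mul] at hc'
  refine ⟨a + c • (b - a), W.add_mem ha (W.smul_mem c (W.sub_mem hb ha)), ?_, ?_⟩
  · rw [hP]; exact left_ne_zero_of_mul hc'
  · rw [hQ]; exact right_ne_zero_of_mul hc'

theorem common_nonzero_prod {ι : Type*} (W : Submodule ℝ V) (s : Finset ι) (p : ι → PolyRing V)
    (hp : ∀ i ∈ s, ∃ x ∈ W, (p i).1 x ≠ 0) : ∃ x ∈ W, ∀ i ∈ s, (p i).1 x ≠ 0 := by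
  induction s using Finset.induction_on with
  | empty => exact ⟨0, W.zero_mem, by simp⟩
  | insert a s ha ih =>
    obtain ⟨x, hx, h⟩ := ih (fun i hi => hp i (Finset.mem_insert_of_mem hi))
    obtain ⟨y, hy, h1, h2⟩ := common_nonzero W (∏ i ∈ s, p i) (p a)
      ⟨x, hx, by rw [prod_ap]; exact Finset.prod_ne_zero_iff.2 h⟩ (hp a (Finset.mem_insert_self _ _))
    rw [prod_ap, Finset.prod_ne_zero_iff] at h1
    refine ⟨y, hy, fun i hi => ?_⟩
    rcases Finset.mem_insert.1 hi with rfl | hi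
    · exact h2
    · exact h1 i hi

/-- cancellation on a subspace -/
theorem cancel_on (W : Submodule ℝ V) (h p : PolyRing V) (hh : ∃ x ∈ W, h.1 x ≠ 0)
    (H : ∀ x ∈ W, h.1 x * p.1 x = 0) : ∀ x ∈ W, p.1 x = 0 := by
  by_contra hcon
  push Not at hcon
  obtain ⟨x, hx, h1, h2⟩ := common_nonzero W h p hh hcon
  exact mul_ne_zero h1 h2 (H x hx)

section pull
variable {U : Type} [AddCommGroup U] [Module ℝ U]

theorem pull_mem (g : V →ₗ[ℝ] U) (p : PolyRing U) : (fun x => p.1 (g x)) ∈ polyAlg V := by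
  induction p using poly_induction with
  | hlin f h => exact (lin (f ∘ₗ g)).2
  | hc r => exact (algebraMap ℝ (PolyRing V) r).2
  | hadd p q h1 h2 => exact (polyAlg V).add_mem h1 h2
  | hmul p q h1 h2 => exact (polyAlg V).mul_mem h1 h2

/-- pullback of polynomial functions -/
def pull (g : V →ₗ[ℝ] U) : PolyRing U →ₐ[ℝ] PolyRing V where
  toFun p := ⟨fun x => p.1 (g x), pull_mem g p⟩
  map_one' := rfl
  map_mul' _ _ := rfl
  map_zero' := rfl
  map_add' _ _ := rfl
  commutes' _ := rfl

theorem pull_ap (g : V →ₗ[ℝ] U) (p : PolyRing U) (x : V) : (pull g p).1 x = p.1 (g x) := rfl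

theorem pull_AdegN (g : V →ₗ[ℝ] U) {k : ℕ} {p : PolyRing U} (hp : p ∈ AdegN U k) :
    pull g p ∈ AdegN V k := by
  intro t x
  change (pull g p).1 (t • x) = t ^ k * (pull g p).1 x
  rw [pull_ap, pull_ap, map_smul]
  exact hp t (g x)
end pull

theorem sub_pull_mem (g : V →ₗ[ℝ] V) (p : PolyRing V) :
    p - pull g p ∈ Ideal.span (Set.range fun f : V →ₗ[ℝ] ℝ => lin (f - f ∘ₗ g)) := by
  induction p using poly_induction with
  | hlin f h => exact Ideal.subset_span ⟨f, rfl⟩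
  | hc r => rw [AlgHom.commutes, sub_self]; exact Ideal.zero_mem _
  | hadd p q h1 h2 =>
    have := Ideal.add_mem _ h1 h2
    rw [map_add]; convert this using 1; ring
  | hmul p q h1 h2 =>
    have := Ideal.add_mem _ (Ideal.mul_mem_left _ p h2) (Ideal.mul_mem_left _ (pull g q) h1)
    rw [map_mul]; convert this using 1; ring

/-- division by a linear form -/
theorem div_lin (f : V →ₗ[ℝ] ℝ) (u : V) (p : PolyRing V) :
    ∃ q : PolyRing V, ∀ x, p.1 x = p.1 (x - f x • u) + f x * q.1 x := by
  have h := sub_pull_mem (LinearMap.id - LinearMap.smulRight f u) p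
  have h2 : p - pull (LinearMap.id - LinearMap.smulRight f u) p ∈ Ideal.span {lin f} := by
    refine (Ideal.span_le.2 ?_) h
    rintro _ ⟨f', rfl⟩
    refine Ideal.mem_span_singleton.2 ⟨algebraMap ℝ _ (f' u), poly_ext fun x => ?_⟩
    rw [mul_ap, lin_apply, lin_apply, alg_ap]
    simp
  obtain ⟨q, hq⟩ := Ideal.mem_span_singleton.1 h2
  refine ⟨q, fun x => ?_⟩
  have := congrArg (fun r : PolyRing V => r.1 x) hq
  simp only [sub_ap, mul_ap, pull_ap, lin_apply, LinearMap.sub_apply, LinearMap.id_apply,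
    LinearMap.smulRight_apply] at this
  linarith

theorem div_lin_on (W : Submodule ℝ V) (f : V →ₗ[ℝ] ℝ) (hf : ∃ x ∈ W, f x ≠ 0) (p : PolyRing V)
    (hp : ∀ x ∈ W, f x = 0 → p.1 x = 0) : ∃ q : PolyRing V, ∀ x ∈ W, p.1 x = f x * q.1 x := by
  obtain ⟨u, hu, hfu⟩ := hf
  obtain ⟨q, hq⟩ := div_lin f ((f u)⁻¹ • u) p
  refine ⟨q, fun x hx => ?_⟩
  rw [hq x, hp, zero_add]
  · exact W.sub_mem hx (W.smul_mem _ (W.smul_mem _ hu))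
  · simp [hfu]

theorem mId_eq : mId V = Ideal.span (Set.range fun f : V →ₗ[ℝ] ℝ => lin f) := by
  apply le_antisymm
  · intro p hp
    have h := sub_pull_mem (0 : V →ₗ[ℝ] V) p
    have h0 : pull (0 : V →ₗ[ℝ] V) p = 0 := poly_ext fun x => hp
    rw [h0, sub_zero] at h
    simpa using h
  · rw [Ideal.span_le]
    rintro _ ⟨f, rfl⟩
    exact f.map_zero

theorem mem_coneGen_self (s : Finset V) {v : V} (hv : v ∈ s) : v ∈ coneGen s := by
  refine ⟨fun w => if w = v then 1 else 0, fun w _ => by dsimp only; split_ifs <;> norm_num, ?_⟩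
  simp [hv]

theorem cone_add (σ : Cone V) {x y : V} (hx : x ∈ σ.carrier) (hy : y ∈ σ.carrier) :
    x + y ∈ σ.carrier := by
  obtain ⟨s, hs⟩ := σ.isPoly
  rw [hs] at hx hy ⊢
  obtain ⟨c, hc, rfl⟩ := hx
  obtain ⟨d, hd, rfl⟩ := hy
  exact ⟨c + d, fun v hv => add_nonneg (hc v hv) (hd v hv), by
    simp [add_smul, Finset.sum_add_distrib]⟩

theorem cone_smul (σ : Cone V) {x : V} (hx : x ∈ σ.carrier) {t : ℝ} (ht : 0 ≤ t) :
    t • x ∈ σ.carrier := by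
  obtain ⟨s, hs⟩ := σ.isPoly
  rw [hs] at hx ⊢
  obtain ⟨c, hc, rfl⟩ := hx
  exact ⟨fun v => t * c v, fun v hv => mul_nonneg ht (hc v hv), by
    simp [Finset.smul_sum, smul_smul]⟩

theorem cone_zero (σ : Cone V) : (0 : V) ∈ σ.carrier := by
  obtain ⟨s, hs⟩ := σ.isPoly
  rw [hs]
  exact ⟨fun _ => 0, fun _ _ => le_rfl, by simp⟩

theorem span_sub (σ : Cone V) {x : V} (hx : x ∈ σ.spanC) :
    ∃ a ∈ σ.carrier, ∃ b ∈ σ.carrier, x = a - b := by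
  unfold Cone.spanC at hx
  induction hx using Submodule.span_induction with
  | mem x h => exact ⟨x, h, 0, cone_zero σ, by simp⟩
  | zero => exact ⟨0, cone_zero σ, 0, cone_zero σ, by simp⟩
  | add x y _ _ h1 h2 =>
    obtain ⟨a, ha, b, hb, rfl⟩ := h1
    obtain ⟨c, hc, d, hd, rfl⟩ := h2
    exact ⟨a + c, cone_add σ ha hc, b + d, cone_add σ hb hd, by abel⟩
  | smul t x _ h =>
    obtain ⟨a, ha, b, hb, rfl⟩ := h
    rcases le_total 0 t with ht | ht
    · exact ⟨t • a, cone_smul σ ha ht, t • b, cone_smul σ hb ht, by rw [smul_sub]⟩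
    · exact ⟨(-t) • b, cone_smul σ hb (by linarith), (-t) • a, cone_smul σ ha (by linarith), by
        rw [smul_sub, neg_smul, neg_smul]; abel⟩

theorem vanish_span (σ : Cone V) {p : PolyRing V} (hp : ∀ x ∈ σ.carrier, p.1 x = 0) :
    ∀ x ∈ σ.spanC, p.1 x = 0 := by
  intro x hx
  obtain ⟨a, ha, b, hb, rfl⟩ := span_sub σ hx
  obtain ⟨P, hP⟩ := lineP p a b
  have hz : P = 0 := by
    apply Polynomial.eq_zero_of_infinite_isRoot
    refine Set.Infinite.mono (s := Set.Ici (0 : ℝ)) (fun c hc => ?_) (Set.Ici_infinite 0)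
    change P.eval c = 0
    rw [← hP]
    exact hp _ (cone_add σ ha (cone_smul σ hb hc))
  have := hP (-1)
  rw [hz] at this
  simpa [sub_eq_add_neg] using this

theorem carrier_sub_span (σ : Cone V) : σ.carrier ⊆ σ.spanC := Submodule.subset_span

theorem mem_vI_cone {σ : Cone V} {p : PolyRing V} :
    p ∈ vanishingIdeal V σ.carrier ↔ ∀ x ∈ σ.spanC, p.1 x = 0 := by
  rw [mem_vI]
  exact ⟨vanish_span σ, fun h x hx => h x (carrier_sub_span σ hx)⟩

theorem AdegN_mul {k l : ℕ} {p q : PolyRing V} (hp : p ∈ AdegN V k) (hq : q ∈ AdegN V l) :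
    p * q ∈ AdegN V (k + l) := by
  intro t x
  change (p * q).1 (t • x) = t ^ (k + l) * (p * q).1 x
  rw [mul_ap, mul_ap]
  have h1 : p.1 (t • x) = t ^ k * p.1 x := hp t x
  have h2 : q.1 (t • x) = t ^ l * q.1 x := hq t x
  rw [h1, h2, pow_add]; ring

theorem lin_AdegN (f : V →ₗ[ℝ] ℝ) : lin f ∈ AdegN V 1 := by
  intro t x
  change f (t • x) = t ^ 1 * f x
  simp

theorem alg_AdegN (c : ℝ) : algebraMap ℝ (PolyRing V) c ∈ AdegN V 0 := by
  intro t x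
  change c = t ^ 0 * c
  simp

theorem one_AdegN : (1 : PolyRing V) ∈ AdegN V 0 := by
  simpa using alg_AdegN (V := V) 1

theorem AdegN_zero_const {p : PolyRing V} (hp : p ∈ AdegN V 0) :
    p = algebraMap ℝ (PolyRing V) (p.1 0) := by
  apply poly_ext
  intro x
  have : p.1 ((0 : ℝ) • x) = (0 : ℝ) ^ 0 * p.1 x := hp 0 x
  simp at this
  rw [alg_ap, this]

theorem AdegN_prod {ι : Type*} (s : Finset ι) (f : ι → PolyRing V) (k : ι → ℕ)
    (h : ∀ i ∈ s, f i ∈ AdegN V (k i)) : ∏ i ∈ s, f i ∈ AdegN V (∑ i ∈ s, k i) := by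
  induction s using Finset.induction_on with
  | empty => simpa using one_AdegN
  | insert a s ha ih =>
    rw [Finset.prod_insert ha, Finset.sum_insert ha]
    exact AdegN_mul (h a (Finset.mem_insert_self _ _))
      (ih fun i hi => h i (Finset.mem_insert_of_mem hi))

theorem mem_Adeg {p : PolyRing V} {k : ℕ} (hp : p ∈ AdegN V k) : p ∈ Adeg V (2 * k) :=
  Submodule.mem_iSup_of_mem k (Submodule.mem_iSup_of_mem rfl hp)

theorem hom_decomp (p : PolyRing V) : ∃ (n : ℕ) (c : ℕ → PolyRing V),
    (∀ k, c k ∈ AdegN V k) ∧ p = ∑ k ∈ Finset.range n, c k := by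
  have key : p ∈ ⨆ k, AdegN V k := by
    induction p using poly_induction with
    | hlin f h => exact Submodule.mem_iSup_of_mem 1 (lin_AdegN f)
    | hc r => exact Submodule.mem_iSup_of_mem 0 (alg_AdegN r)
    | hadd p q h1 h2 => exact Submodule.add_mem _ h1 h2
    | hmul p q h1 h2 =>
      induction h1 using Submodule.iSup_induction' with
      | mem i x hx =>
        induction h2 using Submodule.iSup_induction' with
        | mem j y hy => exact Submodule.mem_iSup_of_mem (i + j) (AdegN_mul hx hy)
        | zero => rw [mul_zero]; exact Submodule.zero_mem _
        | add a b _ _ ha hb => rw [mul_add]; exact Submodule.add_mem _ ha hb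
      | zero => rw [zero_mul]; exact Submodule.zero_mem _
      | add a b _ _ ha hb => rw [add_mul]; exact Submodule.add_mem _ ha hb
  induction key using Submodule.iSup_induction' with
  | mem i x hx =>
    refine ⟨i + 1, fun k => if k = i then x else 0, fun k => ?_, by simp⟩
    dsimp only
    split_ifs with h
    · rw [h]; exact hx
    · exact Submodule.zero_mem _
  | zero => exact ⟨0, fun _ => 0, fun _ => Submodule.zero_mem _, by simp⟩
  | add a b _ _ ha hb =>
    obtain ⟨n, c, hc, rfl⟩ := ha
    obtain ⟨m, d, hd, rfl⟩ := hb
    refine ⟨max n m, fun k => (if k < n then c k else 0) + (if k < m then d k else 0),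
      fun k => ?_, ?_⟩
    · refine Submodule.add_mem _ ?_ ?_
      · split_ifs; exacts [hc k, Submodule.zero_mem _]
      · split_ifs; exacts [hd k, Submodule.zero_mem _]
    · rw [Finset.sum_add_distrib, ← Finset.sum_filter, ← Finset.sum_filter]
      congr 2 <;> (ext k; simp; omega)

instance polyNoeth [FiniteDimensional ℝ V] : IsNoetherianRing (PolyRing V) := by
  let b := Module.finBasis ℝ V
  have hft : (polyAlg V).FG := by
    refine ⟨Finset.univ.image fun i => ((b.coord i : V →ₗ[ℝ] ℝ) : V → ℝ), ?_⟩
    apply le_antisymm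
    · rw [Algebra.adjoin_le_iff]
      intro f hf
      simp at hf
      obtain ⟨i, rfl⟩ := hf
      exact (lin (b.coord i)).2
    · unfold polyAlg
      rw [Algebra.adjoin_le_iff]
      intro f hf
      have hf' : f = ∑ i, (f (b i)) • ((b.coord i : V →ₗ[ℝ] ℝ) : V → ℝ) := by
        funext x
        have h1 : IsLinearMap.mk' f hf x = IsLinearMap.mk' f hf (∑ i, b.repr x i • b i) := by
          rw [b.sum_repr]
        rw [map_sum] at h1
        simp only [map_smul, IsLinearMap.mk'_apply, smul_eq_mul] at h1
        rw [h1]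
        simp [mul_comm]
      rw [hf']
      refine Subalgebra.sum_mem _ fun i _ => Subalgebra.smul_mem _ (Algebra.subset_adjoin ?_) _
      simp
  have : Algebra.FiniteType ℝ (PolyRing V) := (Subalgebra.fg_iff_finiteType _).1 hft
  exact Algebra.FiniteType.isNoetherianRing ℝ _

end PartA

end

section
section PartB1
variable {V : Type} [AddCommGroup V] [Module ℝ V]

theorem cone_ext {σ τ : Cone V} (h : σ.carrier = τ.carrier) : σ = τ := by
  cases σ; cases τ; cases h; rfl

theorem face_mem_iff {τ σ : Cone V} {f : V →ₗ[ℝ] ℝ}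
    (h : τ.carrier = σ.carrier ∩ {x | f x = 0}) {x : V} :
    x ∈ τ.carrier ↔ x ∈ σ.carrier ∧ f x = 0 := by rw [h]; rfl

theorem face_sub {τ σ : Cone V} (h : τ.IsFaceOf σ) : τ.carrier ⊆ σ.carrier := by
  obtain ⟨f, _, h⟩ := h
  exact fun x hx => ((face_mem_iff h).1 hx).1

theorem face_refl (σ : Cone V) : σ.IsFaceOf σ :=
  ⟨0, fun _ _ => le_rfl, by ext x; simp⟩

theorem coneGen_nonneg {s : Finset V} {f : V →ₗ[ℝ] ℝ} (hf : ∀ v ∈ s, 0 ≤ f v) :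
    ∀ x ∈ coneGen s, 0 ≤ f x := by
  rintro x ⟨c, hc, rfl⟩
  rw [map_sum]
  exact Finset.sum_nonneg fun v hv => by
    rw [map_smul]; exact mul_nonneg (hc v hv) (hf v hv)

theorem coneGen_face {s : Finset V} {f : V →ₗ[ℝ] ℝ} (hf : ∀ v ∈ s, 0 ≤ f v) :
    coneGen s ∩ {x | f x = 0} = coneGen (s.filter fun v => f v = 0) := by
  ext x
  constructor
  · rintro ⟨⟨c, hc, rfl⟩, hx⟩
    refine ⟨c, fun v hv => hc v (Finset.mem_filter.1 hv).1, ?_⟩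
    have hx' : f (∑ v ∈ s, c v • v) = 0 := hx
    rw [map_sum, Finset.sum_eq_zero_iff_of_nonneg] at hx'
    · rw [Finset.sum_filter]
      refine Finset.sum_congr rfl fun v hv => ?_
      split_ifs with h
      · rfl
      · have := hx' v hv
        rw [map_smul, smul_eq_mul] at this
        rcases mul_eq_zero.1 this with h' | h'
        · rw [h', zero_smul]
        · exact absurd h' h
    · intro v hv
      rw [map_smul]; exact mul_nonneg (hc v hv) (hf v hv)
  · rintro ⟨c, hc, rfl⟩
    refine ⟨⟨fun v => if f v = 0 then c v else 0, fun v hv => ?_, ?_⟩, ?_⟩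
    · dsimp only
      split_ifs with h
      · exact hc v (Finset.mem_filter.2 ⟨hv, h⟩)
      · exact le_rfl
    · rw [Finset.sum_filter]
      refine Finset.sum_congr rfl fun v hv => ?_
      dsimp only
      split_ifs <;> simp
    · change f _ = 0
      rw [map_sum]
      refine Finset.sum_eq_zero fun v hv => ?_
      rw [map_smul, (Finset.mem_filter.1 hv).2, smul_zero]

theorem gen_sub {σ : Cone V} {s : Finset V} (hs : σ.carrier = coneGen s) {v : V} (hv : v ∈ s) :
    v ∈ σ.carrier := by rw [hs]; exact mem_coneGen_self s hv

theorem spanC_gen {σ : Cone V} {s : Finset V} (hs : σ.carrier = coneGen s) :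
    σ.spanC = Submodule.span ℝ (s : Set V) := by
  apply le_antisymm
  · unfold Cone.spanC
    rw [Submodule.span_le, hs]
    rintro x ⟨c, _, rfl⟩
    exact Submodule.sum_mem _ fun v hv => Submodule.smul_mem _ _ (Submodule.subset_span hv)
  · rw [Submodule.span_le]
    intro v hv
    exact Submodule.subset_span (gen_sub hs hv)

/-- the face cut out by a supporting form -/
def faceCone (σ : Cone V) (f : V →ₗ[ℝ] ℝ) (hf : ∀ x ∈ σ.carrier, 0 ≤ f x) : Cone V where
  carrier := σ.carrier ∩ {x | f x = 0}
  isPoly := by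
    obtain ⟨s, hs⟩ := σ.isPoly
    refine ⟨s.filter fun v => f v = 0, ?_⟩
    rw [hs, coneGen_face]
    exact fun v hv => hf v (gen_sub hs hv)
  pointed := fun x hx hx' => σ.pointed x hx.1 hx'.1

theorem faceCone_face (σ : Cone V) (f : V →ₗ[ℝ] ℝ) (hf : ∀ x ∈ σ.carrier, 0 ≤ f x) :
    (faceCone σ f hf).IsFaceOf σ := ⟨f, hf, rfl⟩

theorem span_vanish {σ : Cone V} {f : V →ₗ[ℝ] ℝ} (h : ∀ x ∈ σ.carrier, f x = 0) :
    ∀ x ∈ σ.spanC, f x = 0 := by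
  have : σ.spanC ≤ LinearMap.ker f := Submodule.span_le.2 h
  exact fun x hx => this hx

theorem span_mono {τ σ : Cone V} (h : τ.carrier ⊆ σ.carrier) : τ.spanC ≤ σ.spanC :=
  Submodule.span_mono h

theorem face_inter_span {τ σ : Cone V} (h : τ.IsFaceOf σ) {x : V} (hx : x ∈ σ.carrier)
    (hx' : x ∈ τ.spanC) : x ∈ τ.carrier := by
  obtain ⟨f, hf, h⟩ := h
  rw [face_mem_iff h]
  exact ⟨hx, span_vanish (fun y hy => ((face_mem_iff h).1 hy).2) x hx'⟩

theorem face_of_sub {δ δ' σ : Cone V} (h : δ.IsFaceOf σ) (h' : δ'.IsFaceOf σ)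
    (hs : δ.carrier ⊆ δ'.carrier) : δ.IsFaceOf δ' := by
  obtain ⟨f, hf, h⟩ := h
  refine ⟨f, fun x hx => hf x (face_sub h' hx), ?_⟩
  ext x
  rw [face_mem_iff h]
  exact ⟨fun hx => ⟨hs ((face_mem_iff h).2 hx), hx.2⟩, fun hx => ⟨face_sub h' hx.1, hx.2⟩⟩

theorem face_eq_of_sub {δ σ : Cone V} (h : δ.IsFaceOf σ) (hs : σ.carrier ⊆ δ.carrier) : δ = σ :=
  cone_ext (Set.Subset.antisymm (face_sub h) hs)

theorem face_antisymm {δ σ : Cone V} (h : δ.IsFaceOf σ) (h' : σ.IsFaceOf δ) : δ = σ :=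
  face_eq_of_sub h (face_sub h')

theorem face_trans {δ τ σ : Cone V} (h : δ.IsFaceOf τ) (h' : τ.IsFaceOf σ) : δ.IsFaceOf σ := by
  obtain ⟨g, hg, h⟩ := h
  obtain ⟨f, hf, h'⟩ := h'
  obtain ⟨s, hs⟩ := σ.isPoly
  set N : ℝ := ∑ v ∈ s, |g v| / f v + 1 with hN
  have hfs : ∀ v ∈ s, 0 ≤ f v := fun v hv => hf v (gen_sub hs hv)
  have key : ∀ v ∈ s, f v ≠ 0 → 0 < g v + N * f v := by
    intro v hv hv0
    have hpos : 0 < f v := lt_of_le_of_ne (hfs v hv) (Ne.symm hv0)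
    have h1 : |g v| / f v ≤ ∑ v ∈ s, |g v| / f v :=
      Finset.single_le_sum (f := fun v => |g v| / f v)
        (fun w hw => div_nonneg (abs_nonneg _) (hfs w hw)) hv
    have h2 : |g v| / f v * f v = |g v| := by field_simp
    have h3 := neg_abs_le (g v)
    nlinarith
  have hnn : ∀ v ∈ s, 0 ≤ (g + N • f) v := by
    intro v hv
    rw [LinearMap.add_apply, LinearMap.smul_apply, smul_eq_mul]
    by_cases hv0 : f v = 0
    · rw [hv0, mul_zero, add_zero]
      exact hg v ((face_mem_iff h').2 ⟨gen_sub hs hv, hv0⟩)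
    · exact (key v hv hv0).le
  refine ⟨g + N • f, by rw [hs]; exact coneGen_nonneg hnn, ?_⟩
  ext x
  rw [face_mem_iff h, face_mem_iff h']
  constructor
  · rintro ⟨⟨h1, h2⟩, h3⟩
    exact ⟨h1, by change (g + N • f) x = 0; simp [h2, h3]⟩
  · rintro ⟨h1, h2⟩
    have hx : x ∈ coneGen s ∩ {x | (g + N • f) x = 0} := ⟨hs ▸ h1, h2⟩
    rw [coneGen_face hnn] at hx
    obtain ⟨c, hc, rfl⟩ := hx
    have hfv : ∀ v ∈ s.filter (fun v => (g + N • f) v = 0), f v = 0 ∧ g v = 0 := by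
      intro v hv
      obtain ⟨hv, hv0⟩ := Finset.mem_filter.1 hv
      have : f v = 0 := by
        by_contra hne
        have := key v hv hne
        rw [LinearMap.add_apply, LinearMap.smul_apply, smul_eq_mul] at hv0
        linarith
      refine ⟨this, ?_⟩
      rw [LinearMap.add_apply, LinearMap.smul_apply, this] at hv0
      simpa using hv0
    refine ⟨⟨h1, ?_⟩, ?_⟩
    · rw [map_sum]
      exact Finset.sum_eq_zero fun v hv => by rw [map_smul, (hfv v hv).1, smul_zero]
    · rw [map_sum]
      exact Finset.sum_eq_zero fun v hv => by rw [map_smul, (hfv v hv).2, smul_zero]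

theorem faces_finite (σ : Cone V) : {τ : Cone V | τ.IsFaceOf σ}.Finite := by
  obtain ⟨s, hs⟩ := σ.isPoly
  apply Set.Finite.of_finite_image (f := fun τ : Cone V => s.filter fun v => v ∈ τ.carrier)
  · exact (s.powerset.finite_toSet).subset (by
      rintro _ ⟨τ, _, rfl⟩
      exact Finset.mem_coe.2 (Finset.mem_powerset.2 (Finset.filter_subset _ _)))
  · have key : ∀ τ : Cone V, τ.IsFaceOf σ → τ.carrier = coneGen (s.filter fun v => v ∈ τ.carrier) := by
      intro τ hτ
      obtain ⟨f, hf, h⟩ := hτ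
      have : (s.filter fun v => v ∈ τ.carrier) = s.filter fun v => f v = 0 := by
        apply Finset.filter_congr
        intro v hv
        rw [face_mem_iff h]
        simp [gen_sub hs hv]
      rw [this, h, hs, coneGen_face]
      exact fun v hv => hf v (gen_sub hs hv)
    intro τ hτ τ' hτ' he
    apply cone_ext
    rw [key τ hτ, key τ' hτ']
    dsimp only at he
    rw [he]

theorem face_span_lt {τ σ : Cone V} (h : τ.IsFaceOf σ) (hne : τ ≠ σ) : τ.spanC < σ.spanC := by
  refine lt_of_le_of_ne (span_mono (face_sub h)) fun he => hne (face_eq_of_sub h fun x hx => ?_)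
  exact face_inter_span h hx (he ▸ carrier_sub_span σ hx)

theorem zeroCone_span : (zeroCone V).spanC = ⊥ := by
  unfold Cone.spanC zeroCone
  simp

theorem zeroCone_dim : (zeroCone V).dim = 0 := by
  unfold Cone.dim
  rw [zeroCone_span]
  simp

variable [FiniteDimensional ℝ V]

theorem face_dim_lt {τ σ : Cone V} (h : τ.IsFaceOf σ) (hne : τ ≠ σ) : τ.dim < σ.dim :=
  Submodule.finrank_lt_finrank_of_lt (face_span_lt h hne)

theorem face_dim_le {τ σ : Cone V} (h : τ.IsFaceOf σ) : τ.dim ≤ σ.dim :=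
  Submodule.finrank_mono (span_mono (face_sub h))

theorem face_eq_of_dim {τ σ : Cone V} (h : τ.IsFaceOf σ) (hd : σ.dim ≤ τ.dim) : τ = σ := by
  by_contra hne
  have := face_dim_lt h hne
  omega

theorem dim_pos {σ : Cone V} (h : σ ≠ zeroCone V) : 0 < σ.dim := by
  by_contra h0
  apply h
  have h1 : σ.spanC = ⊥ := Submodule.finrank_eq_zero.1 (by unfold Cone.dim at h0; omega)
  apply cone_ext
  ext x
  constructor
  · intro hx
    have := carrier_sub_span σ hx
    rw [h1] at this
    exact this
  · intro hx
    have : x = 0 := hx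
    rw [this]
    exact cone_zero σ

/-- facets -/
def facets (σ : Cone V) : Finset (Cone V) :=
  ((faces_finite σ).subset (t := {τ | τ.IsFaceOf σ ∧ τ.dim + 1 = σ.dim}) (fun _ h => h.1)).toFinset

theorem mem_facets {τ σ : Cone V} : τ ∈ facets σ ↔ τ.IsFaceOf σ ∧ τ.dim + 1 = σ.dim := by
  unfold facets
  rw [Set.Finite.mem_toFinset]
  rfl

/-- a positive definite form -/
def bform (V : Type) [AddCommGroup V] [Module ℝ V] [FiniteDimensional ℝ V] :
    V →ₗ[ℝ] V →ₗ[ℝ] ℝ :=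
  ∑ i, (LinearMap.mul ℝ ℝ).compl₁₂ ((Module.finBasis ℝ V).coord i) ((Module.finBasis ℝ V).coord i)

theorem bform_ap (x y : V) : bform V x y =
    ∑ i, (Module.finBasis ℝ V).repr x i * (Module.finBasis ℝ V).repr y i := by
  unfold bform
  simp [LinearMap.sum_apply]

theorem bform_symm (x y : V) : bform V x y = bform V y x := by
  rw [bform_ap, bform_ap]
  simp [mul_comm]

theorem bform_nonneg (x : V) : 0 ≤ bform V x x := by
  rw [bform_ap]
  exact Finset.sum_nonneg fun i _ => mul_self_nonneg _

theorem bform_self {x : V} (h : bform V x x = 0) : x = 0 := by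
  rw [bform_ap, Finset.sum_eq_zero_iff_of_nonneg (fun i _ => mul_self_nonneg _)] at h
  apply (Module.finBasis ℝ V).repr.injective
  ext i
  simpa using h i (Finset.mem_univ i)

theorem exists_normal {U W : Submodule ℝ V} (h : U < W) :
    ∃ u ∈ W, bform V u u = 1 ∧ ∀ x ∈ U, bform V u x = 0 := by
  obtain ⟨t, htW, htU⟩ := SetLike.exists_of_lt h
  -- orthogonal projection via Riesz on `U`
  have inj : Function.Injective (fun x : U => ((bform V x.1).domRestrict U : U →ₗ[ℝ] ℝ)) := by
    intro x y hxy
    have h1 : bform V (x.1 - y.1) (x - y : U).1 = 0 := by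
      have := LinearMap.congr_fun hxy (x - y)
      simp only [LinearMap.domRestrict_apply] at this
      rw [map_sub, LinearMap.sub_apply, this, sub_self]
    exact Subtype.ext (sub_eq_zero.1 (bform_self h1))
  let φ : U →ₗ[ℝ] (U →ₗ[ℝ] ℝ) :=
    { toFun := fun x => (bform V x.1).domRestrict U
      map_add' := fun x y => by ext z; simp
      map_smul' := fun c x => by ext z; simp }
  have hsurj : Function.Surjective φ := by
    have hd : finrank ℝ U = finrank ℝ (U →ₗ[ℝ] ℝ) := (Subspace.dual_finrank_eq (K := ℝ)).symm
    exact (LinearMap.injective_iff_surjective_of_finrank_eq_finrank hd).1 inj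
  obtain ⟨p, hp⟩ := hsurj ((bform V t).domRestrict U)
  set u := t - p.1 with hu
  have hu0 : u ≠ 0 := fun h0 => htU (by rw [sub_eq_zero.1 h0]; exact p.2)
  have hpos : 0 < bform V u u := lt_of_le_of_ne (bform_nonneg u) fun h => hu0 (bform_self h.symm)
  refine ⟨(Real.sqrt (bform V u u))⁻¹ • u, W.smul_mem _ (W.sub_mem htW (h.le p.2)), ?_, ?_⟩
  · simp only [map_smul, LinearMap.smul_apply, smul_eq_mul]
    have := Real.mul_self_sqrt hpos.le
    have h2 : Real.sqrt (bform V u u) ≠ 0 := (Real.sqrt_pos.2 hpos).ne'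
    field_simp
    rw [pow_two, this]
  · intro x hx
    have := LinearMap.congr_fun hp ⟨x, hx⟩
    change bform V p.1 x = bform V t x at this
    simp only [map_smul, LinearMap.smul_apply, hu, map_sub, LinearMap.sub_apply, this]
    simp

theorem hyper {U W : Submodule ℝ V} (hUW : U ≤ W) (hd : finrank ℝ U + 1 = finrank ℝ W)
    (f : V →ₗ[ℝ] ℝ) (hf : ∀ x ∈ U, f x = 0) (hw : ∃ w ∈ W, f w ≠ 0) :
    ∀ x ∈ W, f x = 0 → x ∈ U := by
  intro x hxW hx
  have h1 : U ≤ W ⊓ LinearMap.ker f := le_inf hUW hf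
  have h2 : W ⊓ LinearMap.ker f < W := by
    refine lt_of_le_of_ne inf_le_left fun he => ?_
    obtain ⟨w, hw, hfw⟩ := hw
    rw [← he] at hw
    exact hfw hw.2
  have h3 := Submodule.finrank_lt_finrank_of_lt h2
  have h4 : U = W ⊓ LinearMap.ker f :=
    Submodule.eq_of_le_of_finrank_le h1 (by omega)
  rw [h4]
  exact ⟨hxW, hx⟩

theorem normal_vec {γ τ : Cone V} (h : γ ∈ facets τ) :
    ∃ u ∈ τ.spanC, bform V u u = 1 ∧ (∀ x ∈ γ.spanC, bform V u x = 0) ∧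
      ∀ x ∈ τ.carrier, 0 ≤ bform V u x := by
  obtain ⟨hf, hd⟩ := mem_facets.1 h
  have hne : γ ≠ τ := by rintro rfl; omega
  obtain ⟨u, huW, hu1, hu⟩ := exists_normal (face_span_lt hf hne)
  have hmem : ∀ x ∈ τ.spanC, bform V u x = 0 → x ∈ γ.spanC :=
    hyper (span_mono (face_sub hf)) hd _ hu ⟨u, huW, by rw [hu1]; exact one_ne_zero⟩
  obtain ⟨f, hfn, hfe⟩ := hf
  have hfγ : ∀ x ∈ γ.spanC, f x = 0 := span_vanish fun y hy => ((face_mem_iff hfe).1 hy).2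
  have hprop : ∀ x ∈ τ.spanC, f x = bform V u x * f u := by
    intro x hx
    have h1 : x - bform V u x • u ∈ γ.spanC := by
      apply hmem _ (Submodule.sub_mem _ hx (Submodule.smul_mem _ _ huW))
      simp [hu1]
    have := hfγ _ h1
    rw [map_sub, map_smul, smul_eq_mul] at this
    linarith
  have hfu : f u ≠ 0 := by
    intro h0
    apply hne
    refine face_eq_of_sub (mem_facets.1 h).1 fun x hx => ?_
    rw [face_mem_iff hfe]
    exact ⟨hx, by rw [hprop x (carrier_sub_span _ hx), h0, mul_zero]⟩
  rcases lt_or_gt_of_ne hfu with hneg | hpos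
  · refine ⟨-u, Submodule.neg_mem _ huW, by simp [hu1], fun x hx => by simp [hu x hx], fun x hx => ?_⟩
    have h1 := hfn x hx
    rw [hprop x (carrier_sub_span _ hx)] at h1
    rw [map_neg, LinearMap.neg_apply]
    nlinarith
  · refine ⟨u, huW, hu1, hu, fun x hx => ?_⟩
    have h1 := hfn x hx
    rw [hprop x (carrier_sub_span _ hx)] at h1
    by_contra hc
    push Not at hc
    nlinarith

/-- inner unit normal vector -/
def nvec (τ γ : Cone V) : V := if h : γ ∈ facets τ then (normal_vec h).choose else 0

/-- inner unit normal form -/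
def nrm (τ γ : Cone V) : V →ₗ[ℝ] ℝ := bform V (nvec τ γ)

theorem nvec_spec {γ τ : Cone V} (h : γ ∈ facets τ) :
    nvec τ γ ∈ τ.spanC ∧ bform V (nvec τ γ) (nvec τ γ) = 1 ∧ (∀ x ∈ γ.spanC, nrm τ γ x = 0) ∧
      ∀ x ∈ τ.carrier, 0 ≤ nrm τ γ x := by
  unfold nrm nvec
  rw [dif_pos h]
  exact (normal_vec h).choose_spec

theorem nvec_mem {γ τ : Cone V} (h : γ ∈ facets τ) : nvec τ γ ∈ τ.spanC := (nvec_spec h).1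
theorem nrm_nvec {γ τ : Cone V} (h : γ ∈ facets τ) : nrm τ γ (nvec τ γ) = 1 := (nvec_spec h).2.1
theorem nrm_zero {γ τ : Cone V} (h : γ ∈ facets τ) : ∀ x ∈ γ.spanC, nrm τ γ x = 0 :=
  (nvec_spec h).2.2.1
theorem nrm_nonneg {γ τ : Cone V} (h : γ ∈ facets τ) : ∀ x ∈ τ.carrier, 0 ≤ nrm τ γ x :=
  (nvec_spec h).2.2.2

theorem facet_face {γ τ : Cone V} (h : γ ∈ facets τ) : γ.IsFaceOf τ := (mem_facets.1 h).1
theorem facet_dim {γ τ : Cone V} (h : γ ∈ facets τ) : γ.dim + 1 = τ.dim := (mem_facets.1 h).2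
theorem facet_ne {γ τ : Cone V} (h : γ ∈ facets τ) : γ ≠ τ := by
  rintro rfl
  have := facet_dim h
  omega
theorem facet_span_le {γ τ : Cone V} (h : γ ∈ facets τ) : γ.spanC ≤ τ.spanC :=
  span_mono (face_sub (facet_face h))
theorem facet_proper {γ τ : Cone V} (h : γ ∈ facets τ) : γ.IsProperFaceOf τ :=
  ⟨facet_face h, facet_ne h⟩

theorem nrm_ne {γ τ : Cone V} (h : γ ∈ facets τ) : ∃ x ∈ τ.spanC, nrm τ γ x ≠ 0 :=
  ⟨_, nvec_mem h, by rw [nrm_nvec h]; exact one_ne_zero⟩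

theorem mem_facet_span {γ τ : Cone V} (h : γ ∈ facets τ) {x : V} (hx : x ∈ τ.spanC)
    (h0 : nrm τ γ x = 0) : x ∈ γ.spanC :=
  hyper (facet_span_le h) (facet_dim h) _ (nrm_zero h) (nrm_ne h) x hx h0

theorem mem_facet {γ τ : Cone V} (h : γ ∈ facets τ) {x : V} (hx : x ∈ τ.carrier)
    (h0 : nrm τ γ x = 0) : x ∈ γ.carrier :=
  face_inter_span (facet_face h) hx (mem_facet_span h (carrier_sub_span _ hx) h0)

/-- forms vanishing on a facet span are multiples of the normal -/
theorem nrm_prop {γ τ : Cone V} (h : γ ∈ facets τ) (f : V →ₗ[ℝ] ℝ)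
    (hf : ∀ x ∈ γ.spanC, f x = 0) : ∀ x ∈ τ.spanC, f x = f (nvec τ γ) * nrm τ γ x := by
  intro x hx
  have h1 : x - nrm τ γ x • nvec τ γ ∈ γ.spanC := by
    apply mem_facet_span h (Submodule.sub_mem _ hx (Submodule.smul_mem _ _ (nvec_mem h)))
    rw [map_sub, map_smul, nrm_nvec h]; simp
  have := hf _ h1
  rw [map_sub, map_smul, smul_eq_mul] at this
  linarith

theorem nrm_prop_nonneg {γ τ : Cone V} (h : γ ∈ facets τ) (f : V →ₗ[ℝ] ℝ)
    (hf : ∀ x ∈ γ.spanC, f x = 0) (hp : ∀ x ∈ τ.carrier, 0 ≤ f x) : 0 ≤ f (nvec τ γ) := by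
  by_contra hc
  push Not at hc
  apply facet_ne h
  refine face_eq_of_sub (facet_face h) fun x hx => mem_facet h hx ?_
  have h1 := nrm_prop h f hf x (carrier_sub_span _ hx)
  have h2 := hp x hx
  have h3 := nrm_nonneg h x hx
  nlinarith

end PartB1

end

section
section PartB2
variable {V : Type} [AddCommGroup V] [Module ℝ V] [FiniteDimensional ℝ V]

theorem exists_form_of_notMem {U : Submodule ℝ V} {y : V} (hy : y ∉ U) :
    ∃ f : V →ₗ[ℝ] ℝ, (∀ x ∈ U, f x = 0) ∧ f y ≠ 0 := by
  obtain ⟨f, hf, hU⟩ := Submodule.exists_le_ker_of_notMem hy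
  exact ⟨f, fun x hx => hU hx, hf⟩

theorem farkas_aux (τ : Cone V) (s : Finset V) (hs : τ.carrier = coneGen s) (n : ℕ) :
    ∀ g : V →ₗ[ℝ] ℝ, (∀ v ∈ s, 0 ≤ g v) →
      τ.dim ≤ n + finrank ℝ (Submodule.span ℝ ((s.filter fun v => g v = 0 : Finset V) : Set V)) →
      ∃ c : Cone V → ℝ, (∀ γ, 0 ≤ c γ) ∧
        ∀ x ∈ τ.spanC, g x = ∑ γ ∈ facets τ, c γ * nrm τ γ x := by
  induction n with
  | zero =>
    intro g hg hn
    refine ⟨0, fun _ => le_rfl, fun x hx => ?_⟩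
    have hle : Submodule.span ℝ ((s.filter fun v => g v = 0 : Finset V) : Set V) ≤ τ.spanC := by
      rw [spanC_gen hs]
      exact Submodule.span_mono (by intro v hv; exact (Finset.mem_filter.1 hv).1)
    have he := Submodule.eq_of_le_of_finrank_le hle (by unfold Cone.dim at hn; omega)
    rw [← he] at hx
    have : Submodule.span ℝ ((s.filter fun v => g v = 0 : Finset V) : Set V) ≤ LinearMap.ker g :=
      Submodule.span_le.2 fun v hv => (Finset.mem_filter.1 hv).2
    have h0 : g x = 0 := this hx
    simp [h0]
  | succ n ih =>
    intro g hg hn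
    set U := Submodule.span ℝ ((s.filter fun v => g v = 0 : Finset V) : Set V) with hU
    have hgU : U ≤ LinearMap.ker g :=
      Submodule.span_le.2 fun v hv => (Finset.mem_filter.1 hv).2
    have hUW : U ≤ τ.spanC := by
      rw [spanC_gen hs]
      exact Submodule.span_mono (by intro v hv; exact (Finset.mem_filter.1 hv).1)
    by_cases hlt : τ.dim ≤ n + finrank ℝ U
    · exact ih g hg hlt
    by_cases hzero : ∀ v ∈ s, g v = 0
    · refine ⟨0, fun _ => le_rfl, fun x hx => ?_⟩
      rw [spanC_gen hs] at hx
      have : Submodule.span ℝ (s : Set V) ≤ LinearMap.ker g := Submodule.span_le.2 hzero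
      have h0 : g x = 0 := this hx
      simp [h0]
    push Not at hzero
    obtain ⟨v0, hv0, hgv0⟩ := hzero
    have hgc : ∀ x ∈ τ.carrier, 0 ≤ g x := by rw [hs]; exact coneGen_nonneg hg
    have hFs : (faceCone τ g hgc).spanC = U := by
      apply spanC_gen
      change τ.carrier ∩ _ = _
      rw [hs, coneGen_face hg]
    by_cases hn0 : τ.dim = finrank ℝ U + 1
    · -- facet case
      have hfac : faceCone τ g hgc ∈ facets τ :=
        mem_facets.2 ⟨faceCone_face _ _ _, by
          have : (faceCone τ g hgc).dim = finrank ℝ U := by unfold Cone.dim; rw [hFs]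
          omega⟩
      have hgz : ∀ x ∈ (faceCone τ g hgc).spanC, g x = 0 := by
        rw [hFs]; exact fun x hx => hgU hx
      refine ⟨fun γ => if γ = faceCone τ g hgc then g (nvec τ γ) else 0, fun γ => ?_, fun x hx => ?_⟩
      · dsimp only
        split_ifs with h
        · rw [h]; exact nrm_prop_nonneg hfac g hgz hgc
        · exact le_rfl
      · rw [nrm_prop hfac g hgz x hx]
        simp [hfac]
    · have hv0U : v0 ∉ U := fun h => hgv0 (hgU h)
      have h2 : ∃ y ∈ τ.spanC, y ∉ U ⊔ Submodule.span ℝ {v0} := by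
        by_contra hcon
        push Not at hcon
        have h3 : τ.spanC ≤ U ⊔ Submodule.span ℝ {v0} := hcon
        have h4 := Submodule.finrank_mono h3
        have h5 := Submodule.finrank_add_le_finrank_add_finrank U (Submodule.span ℝ {v0})
        have h6 : finrank ℝ (Submodule.span ℝ {v0}) ≤ 1 :=
          (finrank_span_singleton (K := ℝ) (v := v0) (by rintro rfl; exact hgv0 (map_zero g))).le
        have h7 := Submodule.finrank_mono hUW
        unfold Cone.dim at hn0 hlt
        have h8 : finrank ℝ τ.spanC ≠ finrank ℝ U := by
          intro he
          have := Submodule.eq_of_le_of_finrank_eq hUW he.symm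
          apply hv0U
          rw [this]
          exact carrier_sub_span _ (gen_sub hs hv0)
        omega
      obtain ⟨y, hyW, hy⟩ := h2
      obtain ⟨h0, hh0, hh0y⟩ := exists_form_of_notMem hy
      have hU0 : ∀ x ∈ U, h0 x = 0 := fun x hx => hh0 x (Submodule.mem_sup_left hx)
      have hv00 : h0 v0 = 0 :=
        hh0 v0 (Submodule.mem_sup_right (Submodule.mem_span_singleton_self v0))
      obtain ⟨v1, hv1, hhv1⟩ : ∃ v1 ∈ s, h0 v1 ≠ 0 := by
        by_contra hcon
        push Not at hcon
        rw [spanC_gen hs] at hyW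
        have : Submodule.span ℝ (s : Set V) ≤ LinearMap.ker h0 := Submodule.span_le.2 hcon
        exact hh0y (this hyW)
      have hz : ∀ v ∈ s, g v = 0 → h0 v = 0 := fun v hv h =>
        hU0 v (Submodule.subset_span (Finset.mem_coe.2 (Finset.mem_filter.2 ⟨hv, h⟩)))
      have hgv1 : g v1 ≠ 0 := fun h => hhv1 (hz v1 hv1 h)
      set S := s.filter fun v => g v ≠ 0 with hS
      have hv0S : v0 ∈ S := Finset.mem_filter.2 ⟨hv0, hgv0⟩
      have hv1S : v1 ∈ S := Finset.mem_filter.2 ⟨hv1, hgv1⟩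
      obtain ⟨a, haS, ha⟩ := S.exists_min_image (fun v => h0 v / g v) ⟨v0, hv0S⟩
      obtain ⟨b, hbS, hb⟩ := S.exists_max_image (fun v => h0 v / g v) ⟨v0, hv0S⟩
      have hpos : ∀ v ∈ S, 0 < g v := fun v hv =>
        lt_of_le_of_ne (hg v (Finset.mem_filter.1 hv).1) (Ne.symm (Finset.mem_filter.1 hv).2)
      set m := h0 a / g a with hm
      set M := h0 b / g b with hM
      have hmM : m < M := by
        have h1 := ha v0 hv0S
        have h2 := ha v1 hv1S
        have h3 := hb v0 hv0S
        have h4 := hb v1 hv1S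
        simp only [hv00, zero_div] at h1 h3
        have h5 : h0 v1 / g v1 ≠ 0 := div_ne_zero hhv1 hgv1
        rcases lt_or_gt_of_ne h5 with h | h
        · linarith
        · linarith
      have step : ∀ (g' : V →ₗ[ℝ] ℝ) (w : V), w ∈ S → (∀ v ∈ s, 0 ≤ g' v) →
          (∀ v ∈ s, g v = 0 → g' v = 0) → g' w = 0 →
          ∃ c : Cone V → ℝ, (∀ γ, 0 ≤ c γ) ∧
            ∀ x ∈ τ.spanC, g' x = ∑ γ ∈ facets τ, c γ * nrm τ γ x := by
        intro g' w hw hnn hz' hw0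
        refine ih g' hnn ?_
        have hlt' : U < Submodule.span ℝ ((s.filter fun v => g' v = 0 : Finset V) : Set V) := by
          refine lt_of_le_of_ne (Submodule.span_mono ?_) ?_
          · intro v hv
            obtain ⟨h1, h2⟩ := Finset.mem_filter.1 hv
            exact Finset.mem_coe.2 (Finset.mem_filter.2 ⟨h1, hz' v h1 h2⟩)
          · intro he
            have h1 : w ∈ U := by
              rw [he]
              exact Submodule.subset_span (Finset.mem_coe.2 (Finset.mem_filter.2
                ⟨(Finset.mem_filter.1 hw).1, hw0⟩))
            exact (Finset.mem_filter.1 hw).2 (hgU h1)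
        have := Submodule.finrank_lt_finrank_of_lt hlt'
        omega
      obtain ⟨c1, hc1, he1⟩ := step (h0 - m • g) a haS (by
          intro v hv
          simp only [LinearMap.sub_apply, LinearMap.smul_apply, smul_eq_mul]
          by_cases hv0 : g v = 0
          · rw [hz v hv hv0, hv0]; simp
          · have hvS : v ∈ S := Finset.mem_filter.2 ⟨hv, hv0⟩
            have h1 := ha v hvS
            have h2 := (le_div_iff₀ (hpos v hvS)).1 h1
            linarith)
        (by intro v hv h; simp [hz v hv h, h])
        (by
          have := (hpos a haS).ne'
          simp only [LinearMap.sub_apply, LinearMap.smul_apply, smul_eq_mul, hm]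
          field_simp; ring)
      obtain ⟨c2, hc2, he2⟩ := step (M • g - h0) b hbS (by
          intro v hv
          simp only [LinearMap.sub_apply, LinearMap.smul_apply, smul_eq_mul]
          by_cases hv0 : g v = 0
          · rw [hz v hv hv0, hv0]; simp
          · have hvS : v ∈ S := Finset.mem_filter.2 ⟨hv, hv0⟩
            have h1 := hb v hvS
            have h2 := (div_le_iff₀ (hpos v hvS)).1 h1
            linarith)
        (by intro v hv h; simp [hz v hv h, h])
        (by
          have := (hpos b hbS).ne'
          simp only [LinearMap.sub_apply, LinearMap.smul_apply, smul_eq_mul, hM]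
          field_simp; ring)
      have hMm : 0 < M - m := by linarith
      refine ⟨fun γ => (M - m)⁻¹ * (c1 γ + c2 γ), fun γ =>
        mul_nonneg (inv_nonneg.2 hMm.le) (add_nonneg (hc1 γ) (hc2 γ)), fun x hx => ?_⟩
      have e1 := he1 x hx
      have e2 := he2 x hx
      simp only [LinearMap.sub_apply, LinearMap.smul_apply, smul_eq_mul] at e1 e2
      simp only [mul_assoc]
      rw [← Finset.mul_sum]
      simp only [add_mul, Finset.sum_add_distrib]
      rw [← e1, ← e2]
      field_simp
      ring

/-- Farkas: supporting forms are nonnegative combinations of facet normals. -/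
theorem farkas (τ : Cone V) (g : V →ₗ[ℝ] ℝ) (hg : ∀ x ∈ τ.carrier, 0 ≤ g x) :
    ∃ c : Cone V → ℝ, (∀ γ, 0 ≤ c γ) ∧
      (∀ x ∈ τ.spanC, g x = ∑ γ ∈ facets τ, c γ * nrm τ γ x) ∧
      ∀ γ ∈ facets τ, c γ ≠ 0 → ∀ x ∈ τ.carrier, g x = 0 → x ∈ γ.carrier := by
  obtain ⟨s, hs⟩ := τ.isPoly
  obtain ⟨c, hc, he⟩ := farkas_aux τ s hs τ.dim g (fun v hv => hg v (gen_sub hs hv)) (by omega)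
  refine ⟨c, hc, he, fun γ hγ hcγ x hx hgx => ?_⟩
  have h1 := he x (carrier_sub_span _ hx)
  rw [hgx] at h1
  have h2 := (Finset.sum_eq_zero_iff_of_nonneg (fun γ' hγ' =>
    mul_nonneg (hc γ') (nrm_nonneg hγ' x hx))).1 h1.symm γ hγ
  exact mem_facet hγ hx ((mul_eq_zero.1 h2).resolve_left hcγ)

theorem proper_in_facet {δ τ : Cone V} (h : δ.IsProperFaceOf τ) :
    ∃ γ ∈ facets τ, δ.IsFaceOf γ := by
  obtain ⟨⟨g, hg, he⟩, hne⟩ := h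
  obtain ⟨c, hc, hsum, hface⟩ := farkas τ g hg
  obtain ⟨γ, hγ, hcγ⟩ : ∃ γ ∈ facets τ, c γ ≠ 0 := by
    by_contra hcon
    push Not at hcon
    apply hne
    refine face_eq_of_sub ⟨g, hg, he⟩ fun x hx => (face_mem_iff he).2 ⟨hx, ?_⟩
    rw [hsum x (carrier_sub_span _ hx)]
    exact Finset.sum_eq_zero fun γ hγ => by rw [hcon γ hγ, zero_mul]
  refine ⟨γ, hγ, face_of_sub ⟨g, hg, he⟩ (facet_face hγ) fun x hx => ?_⟩
  obtain ⟨h1, h2⟩ := (face_mem_iff he).1 hx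
  exact hface γ hγ hcγ x h1 h2

theorem facet_eq_of_span_le {τ τ' σ : Cone V} (h : τ ∈ facets σ) (h' : τ' ∈ facets σ)
    (hle : τ.spanC ≤ τ'.spanC) : τ = τ' := by
  have hs : τ.carrier ⊆ τ'.carrier := fun x hx =>
    face_inter_span (facet_face h') (face_sub (facet_face h) hx) (hle (carrier_sub_span _ hx))
  apply face_eq_of_dim (face_of_sub (facet_face h) (facet_face h') hs)
  have h1 := facet_dim h
  have h2 := facet_dim h'
  omega

/-- in the situation γ ⊂ τ ≠ ρ ⊂ σ -/
theorem adj_pos {γ τ ρ σ : Cone V} (hτ : τ ∈ facets σ) (hρ : ρ ∈ facets σ) (hne : ρ ≠ τ)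
    (hγ : γ ∈ facets τ) (hγρ : γ.IsFaceOf ρ) :
    0 < nrm σ ρ (nvec τ γ) ∧ ∀ x ∈ τ.spanC, nrm σ ρ x = nrm σ ρ (nvec τ γ) * nrm τ γ x := by
  have hz : ∀ x ∈ γ.spanC, nrm σ ρ x = 0 := fun x hx =>
    nrm_zero hρ x (span_mono (face_sub hγρ) hx)
  have h1 := nrm_prop hγ (nrm σ ρ) hz
  refine ⟨lt_of_le_of_ne (nrm_prop_nonneg hγ _ hz
    fun x hx => nrm_nonneg hρ x (face_sub (facet_face hτ) hx)) fun h0 => hne ?_, h1⟩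
  refine (facet_eq_of_span_le hτ hρ fun x hx => mem_facet_span hρ (facet_span_le hτ hx) ?_).symm
  rw [h1 x hx, ← h0, zero_mul]

theorem diamond_unique_aux {γ τ ρ ρ' σ : Cone V} (hτ : τ ∈ facets σ) (hρ : ρ ∈ facets σ)
    (hρ' : ρ' ∈ facets σ) (hne : ρ ≠ τ) (hne' : ρ' ≠ τ)
    (hγ : γ ∈ facets τ) (hγρ : γ.IsFaceOf ρ) (hγρ' : γ.IsFaceOf ρ')
    (hle : nrm σ ρ' (nvec σ τ) * nrm σ ρ (nvec τ γ) ≤ nrm σ ρ (nvec σ τ) * nrm σ ρ' (nvec τ γ)) :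
    ρ = ρ' := by
  obtain ⟨p1, e1⟩ := adj_pos hτ hρ hne hγ hγρ
  obtain ⟨p2, e2⟩ := adj_pos hτ hρ' hne' hγ hγρ'
  set s := nrm σ ρ (nvec τ γ)
  set s' := nrm σ ρ' (nvec τ γ)
  have h1 := nrm_prop hτ (s' • nrm σ ρ - s • nrm σ ρ') (fun x hx => by
    simp only [LinearMap.sub_apply, LinearMap.smul_apply, smul_eq_mul]
    rw [e1 x hx, e2 x hx]; ring)
  apply facet_eq_of_span_le hρ hρ'
  refine Submodule.span_le.2 fun x hx => mem_facet_span hρ' (facet_span_le hρ (carrier_sub_span _ hx)) ?_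
  have hxσ := face_sub (facet_face hρ) hx
  have h2 := h1 x (carrier_sub_span _ hxσ)
  simp only [LinearMap.sub_apply, LinearMap.smul_apply, smul_eq_mul] at h2
  rw [nrm_zero hρ x (carrier_sub_span _ hx)] at h2
  have h3 := nrm_nonneg hρ' x hxσ
  have h4 := nrm_nonneg hτ x hxσ
  have h5 : 0 ≤ (s' * nrm σ ρ (nvec σ τ) - s * nrm σ ρ' (nvec σ τ)) * nrm σ τ x :=
    mul_nonneg (by linarith) h4
  nlinarith

theorem diamond_unique {γ τ ρ ρ' σ : Cone V} (hτ : τ ∈ facets σ) (hρ : ρ ∈ facets σ)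
    (hρ' : ρ' ∈ facets σ) (hne : ρ ≠ τ) (hne' : ρ' ≠ τ)
    (hγ : γ ∈ facets τ) (hγρ : γ.IsFaceOf ρ) (hγρ' : γ.IsFaceOf ρ') : ρ = ρ' := by
  rcases le_total (nrm σ ρ' (nvec σ τ) * nrm σ ρ (nvec τ γ))
    (nrm σ ρ (nvec σ τ) * nrm σ ρ' (nvec τ γ)) with h | h
  · exact diamond_unique_aux hτ hρ hρ' hne hne' hγ hγρ hγρ' h
  · exact (diamond_unique_aux hτ hρ' hρ hne' hne hγ hγρ' hγρ h).symm

theorem facet_of_face_dim {γ τ ρ σ : Cone V} (hτ : τ ∈ facets σ) (hρ : ρ ∈ facets σ)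
    (hγ : γ ∈ facets τ) (hγρ : γ.IsFaceOf ρ) : γ ∈ facets ρ := by
  refine mem_facets.2 ⟨hγρ, ?_⟩
  have h1 := facet_dim hτ
  have h2 := facet_dim hρ
  have h3 := facet_dim hγ
  omega

theorem diamond_exists {γ τ σ : Cone V} (hτ : τ ∈ facets σ) (hγ : γ ∈ facets τ) :
    ∃ ρ ∈ facets σ, ρ ≠ τ ∧ γ ∈ facets ρ := by
  obtain ⟨g, hg, he⟩ := face_trans (facet_face hγ) (facet_face hτ)
  obtain ⟨c, hc, hsum, hface⟩ := farkas σ g hg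
  obtain ⟨ρ, hρ, hne, hcρ⟩ : ∃ ρ ∈ facets σ, ρ ≠ τ ∧ c ρ ≠ 0 := by
    by_contra hcon
    push Not at hcon
    apply facet_ne hγ
    refine face_eq_of_sub (facet_face hγ) fun x hx => ?_
    have hxσ := face_sub (facet_face hτ) hx
    refine (face_mem_iff he).2 ⟨hxσ, ?_⟩
    rw [hsum x (carrier_sub_span _ hxσ)]
    refine Finset.sum_eq_zero fun ρ hρ => ?_
    by_cases h : ρ = τ
    · rw [h, nrm_zero hτ x (carrier_sub_span _ hx), mul_zero]
    · rw [hcon ρ hρ h, zero_mul]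
  refine ⟨ρ, hρ, hne, facet_of_face_dim hτ hρ hγ ?_⟩
  refine face_of_sub ⟨g, hg, he⟩ (facet_face hρ) fun x hx => ?_
  obtain ⟨h1, h2⟩ := (face_mem_iff he).1 hx
  exact hface ρ hρ hcρ x h1 h2

theorem diamond_const {γ τ ρ σ : Cone V} (hτ : τ ∈ facets σ) (hρ : ρ ∈ facets σ) (hne : ρ ≠ τ)
    (hγ : γ ∈ facets τ) (hγρ : γ ∈ facets ρ) :
    nrm σ ρ (nvec τ γ) = nrm σ τ (nvec ρ γ) := by
  obtain ⟨p1, -⟩ := adj_pos hτ hρ hne hγ (facet_face hγρ)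
  obtain ⟨p2, -⟩ := adj_pos hρ hτ hne.symm hγρ (facet_face hγ)
  set a := nvec τ γ with ha
  set u := nvec σ τ with hu
  set b := nvec ρ γ with hb
  set w := nvec σ ρ with hw
  have aa : bform V a a = 1 := nrm_nvec hγ
  have uu : bform V u u = 1 := nrm_nvec hτ
  have bb : bform V b b = 1 := nrm_nvec hγρ
  have ww : bform V w w = 1 := nrm_nvec hρ
  have ua : bform V u a = 0 := nrm_zero hτ a (nvec_mem hγ)
  have wb : bform V w b = 0 := nrm_zero hρ b (nvec_mem hγρ)
  have rep : ∀ y ∈ σ.spanC, (∀ x ∈ γ.spanC, bform V y x = 0) →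
      y = bform V y a • a + bform V y u • u := by
    intro y hy hyγ
    obtain ⟨z, hz⟩ : ∃ z, z = y - bform V y a • a - bform V y u • u := ⟨_, rfl⟩
    have haσ : a ∈ σ.spanC := facet_span_le hτ (nvec_mem hγ)
    have hzσ : z ∈ σ.spanC := hz ▸ Submodule.sub_mem _ (Submodule.sub_mem _ hy
      (Submodule.smul_mem _ _ haσ)) (Submodule.smul_mem _ _ (nvec_mem hτ))
    have h1 : bform V u z = 0 := by
      rw [hz, map_sub, map_sub, map_smul, map_smul, ua, uu, bform_symm u y]; simp
    have hzτ : z ∈ τ.spanC := mem_facet_span hτ hzσ h1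
    have h2 : bform V a z = 0 := by
      rw [hz, map_sub, map_sub, map_smul, map_smul, aa, bform_symm a u, ua, bform_symm a y]; simp
    have hzγ : z ∈ γ.spanC := mem_facet_span hγ hzτ h2
    have h3 : bform V z z = 0 := by
      have e : bform V z z = bform V z (y - bform V y a • a - bform V y u • u) :=
        congrArg (bform V z) hz
      rw [e, map_sub, map_sub, map_smul, map_smul, bform_symm z y, bform_symm z a, bform_symm z u,
        hyγ z hzγ, h2, h1]; simp
    have h4 := bform_self h3
    rw [hz] at h4
    have : y - (bform V y a • a + bform V y u • u) = 0 := by rw [← h4]; abel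
    exact sub_eq_zero.1 this
  have rb := rep b (facet_span_le hρ (nvec_mem hγρ)) (nrm_zero hγρ)
  have rw' := rep w (nvec_mem hρ) (fun x hx => nrm_zero hρ x (facet_span_le hγρ hx))
  change bform V w a = bform V u b
  change 0 < bform V w a at p1
  change 0 < bform V u b at p2
  set x := bform V b a
  set y := bform V b u
  set z := bform V w a
  set v := bform V w u
  have hy : bform V u b = y := bform_symm u b
  rw [hy] at p2 ⊢
  have au : bform V a u = 0 := by rw [bform_symm]; exact ua
  have e1 : x * x + y * y = 1 := by
    have := bb
    rw [rb] at this
    simp only [map_add, map_smul, LinearMap.add_apply, LinearMap.smul_apply, smul_eq_mul, aa, uu,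
      au, ua] at this
    linarith
  have e2 : z * z + v * v = 1 := by
    have := ww
    rw [rw'] at this
    simp only [map_add, map_smul, LinearMap.add_apply, LinearMap.smul_apply, smul_eq_mul, aa, uu,
      au, ua] at this
    linarith
  have e3 : z * x + v * y = 0 := by
    have := wb
    rw [rw', rb] at this
    simp only [map_add, map_smul, LinearMap.add_apply, LinearMap.smul_apply, smul_eq_mul, aa, uu,
      au, ua] at this
    linarith
  -- z² = y²
  have e4 : z * z = y * y := by
    have h1 : z * x * (z * x) = v * y * (v * y) := by
      have : z * x = -(v * y) := by linarith
      rw [this]; ring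
    have hx2 : x * x = 1 - y * y := by linarith
    have hv2 : v * v = 1 - z * z := by linarith
    have : z * z * (x * x) = v * v * (y * y) := by linarith [h1]
    rw [hx2, hv2] at this
    linarith
  nlinarith

theorem face_facet_span {δ τ σ : Cone V} (hτ : τ ∈ facets σ) (h : δ.IsFaceOf τ) (hd : δ.dim + 2 = σ.dim) :
    δ ∈ facets τ := mem_facets.2 ⟨h, by have := facet_dim hτ; omega⟩

/-- faces strictly above a ridge -/
theorem above_ridge {γ τ ρ σ δ : Cone V} (hτ : τ ∈ facets σ) (hρ : ρ ∈ facets σ) (hne : ρ ≠ τ)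
    (hγ : γ ∈ facets τ) (hγρ : γ ∈ facets ρ) (hδ : δ.IsFaceOf σ) (h : γ.IsFaceOf δ) :
    δ = γ ∨ δ = τ ∨ δ = ρ ∨ δ = σ := by
  by_cases h1 : δ = γ
  · exact Or.inl h1
  by_cases h2 : δ = σ
  · tauto
  have d1 := face_dim_lt h (Ne.symm h1)
  have d2 := face_dim_lt hδ h2
  have d3 := facet_dim hτ
  have d4 := facet_dim hγ
  have hf : δ ∈ facets σ := mem_facets.2 ⟨hδ, by omega⟩
  by_cases h3 : δ = τ
  · tauto
  exact Or.inr (Or.inr (Or.inl (diamond_unique hτ hf hρ h3 hne hγ h (facet_face hγρ))))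

theorem generic_interior {ι κ : Type*} (W : Submodule ℝ V) (F : Finset ι) (f : ι → V →ₗ[ℝ] ℝ)
    (hf : ∀ i ∈ F, ∃ x ∈ W, f i x ≠ 0) (P : Finset κ) (p : κ → V →ₗ[ℝ] ℝ) (l : V) (hl : l ∈ W)
    (hp : ∀ k ∈ P, 0 < p k l) :
    ∃ w ∈ W, (∀ i ∈ F, f i w ≠ 0) ∧ ∀ k ∈ P, 0 < p k w := by
  obtain ⟨u, hu, hfu⟩ := common_nonzero_prod W F (fun i => lin (f i)) hf
  obtain ⟨ε, hε, hpos⟩ : ∃ ε : ℝ, 0 < ε ∧ ∀ t : ℝ, 0 < t → t < ε → ∀ k ∈ P, 0 < p k (l + t • u) := by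
    clear hfu hf
    induction P using Finset.induction_on with
    | empty => exact ⟨1, one_pos, by simp⟩
    | insert a P ha ih =>
      obtain ⟨ε, hε, h⟩ := ih fun k hk => hp k (Finset.mem_insert_of_mem hk)
      have hpa := hp a (Finset.mem_insert_self _ _)
      refine ⟨min ε (p a l / (|p a u| + 1)), lt_min hε (by positivity), fun t ht htε k hk => ?_⟩
      rcases Finset.mem_insert.1 hk with rfl | hk
      · have h1 : t < p k l / (|p k u| + 1) := lt_of_lt_of_le htε (min_le_right _ _)
        rw [lt_div_iff₀ (by positivity)] at h1
        rw [map_add, map_smul, smul_eq_mul]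
        have h2 := neg_abs_le (p k u)
        nlinarith
      · exact h t ht (lt_of_lt_of_le htε (min_le_left _ _)) k hk
  obtain ⟨t, ht, htF⟩ := (Set.Ioo_infinite hε).exists_notMem_finset (F.image fun i => -(f i l) / f i u)
  refine ⟨l + t • u, W.add_mem hl (W.smul_mem _ hu), fun i hi h0 => htF ?_, hpos t ht.1 ht.2⟩
  rw [Finset.mem_image]
  refine ⟨i, hi, ?_⟩
  have h1 : f i u ≠ 0 := hfu i hi
  rw [map_add, map_smul, smul_eq_mul] at h0
  field_simp
  linarith

theorem exists_interior (τ : Cone V) : ∃ l ∈ τ.carrier, ∀ γ ∈ facets τ, 0 < nrm τ γ l := by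
  obtain ⟨s, hs⟩ := τ.isPoly
  refine ⟨∑ v ∈ s, v, ?_, fun γ hγ => ?_⟩
  · rw [hs]; exact ⟨fun _ => 1, fun _ _ => zero_le_one, by simp⟩
  · rw [map_sum]
    have hnn : ∀ v ∈ s, 0 ≤ nrm τ γ v := fun v hv => nrm_nonneg hγ v (gen_sub hs hv)
    refine lt_of_le_of_ne (Finset.sum_nonneg hnn) fun h0 => ?_
    have h1 := (Finset.sum_eq_zero_iff_of_nonneg hnn).1 h0.symm
    obtain ⟨x, hx, hx0⟩ := nrm_ne hγ
    rw [spanC_gen hs] at hx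
    have : Submodule.span ℝ (s : Set V) ≤ LinearMap.ker (nrm τ γ) := Submodule.span_le.2 h1
    exact hx0 (this hx)

theorem zero_face_fan (Δ : Fan V) {τ : Cone V} (h : τ ∈ Δ.cones) : (zeroCone V).IsFaceOf τ := by
  obtain ⟨ρ, _, h1, _, h2⟩ := Δ.inter_mem τ h _ Δ.zero_mem
  have : ρ = zeroCone V := cone_ext (by
    rw [h2]
    ext x
    exact ⟨fun hx => hx.2, fun hx => ⟨by
      have : x = 0 := hx
      rw [this]; exact cone_zero _, hx⟩⟩)
  rwa [← this]

theorem exists_facet (Δ : Fan V) {τ : Cone V} (h : τ ∈ Δ.cones) (h0 : τ ≠ zeroCone V) :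
    ∃ γ, γ ∈ facets τ := by
  obtain ⟨γ, hγ, _⟩ := proper_in_facet ⟨zero_face_fan Δ h, Ne.symm h0⟩
  exact ⟨γ, hγ⟩

theorem facets_zero : facets (zeroCone V) = ∅ := by
  ext γ
  rw [mem_facets, zeroCone_dim]
  simp

end PartB2

end

section
/-! ### Part C1: graded modules -/
section grad
variable {V : Type} [AddCommGroup V] [Module ℝ V]
open DirectSum

def dec (M : GAMod V) : (⨁ q, M.deg q) ≃ₗ[ℝ] M.M :=
  LinearEquiv.ofBijective (DirectSum.coeLinearMap M.deg) M.internal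

def pr (M : GAMod V) (q : ℤ) : M.M →ₗ[ℝ] M.M :=
  (M.deg q).subtype ∘ₗ DirectSum.component ℝ ℤ (fun q => M.deg q) q ∘ₗ (dec M).symm.toLinearMap

lemma pr_mem (M : GAMod V) (q : ℤ) (x : M.M) : pr M q x ∈ M.deg q := Subtype.mem _

lemma dec_symm (M : GAMod V) {p : ℤ} {x : M.M} (hx : x ∈ M.deg p) :
    (dec M).symm x = DirectSum.lof ℝ ℤ (fun q => M.deg q) p ⟨x, hx⟩ := by
  rw [LinearEquiv.symm_apply_eq]
  exact (DirectSum.coeLinearMap_lof M.deg p ⟨x, hx⟩).symm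

lemma pr_self (M : GAMod V) {q : ℤ} {x : M.M} (hx : x ∈ M.deg q) : pr M q x = x := by
  simp only [pr, LinearMap.comp_apply, LinearEquiv.coe_coe, dec_symm M hx]
  simp [DirectSum.component.of]

lemma pr_ne (M : GAMod V) {p q : ℤ} {x : M.M} (hx : x ∈ M.deg p) (h : p ≠ q) : pr M q x = 0 := by
  simp only [pr, LinearMap.comp_apply, LinearEquiv.coe_coe, dec_symm M hx]
  simp [DirectSum.component.of, h]

lemma hom_induction (M : GAMod V) {P : M.M → Prop} (h0 : P 0)
    (ha : ∀ x y, P x → P y → P (x + y)) (hh : ∀ q, ∀ x ∈ M.deg q, P x) (x : M.M) : P x := by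
  have hx : x ∈ ⨆ q, M.deg q := by rw [M.internal.submodule_iSup_eq_top]; trivial
  exact Submodule.iSup_induction M.deg (motive := P) hx (fun q x hx => hh q x hx) h0 ha

lemma pr_finset (M : GAMod V) (x : M.M) :
    ∃ s : Finset ℤ, (∀ q ∉ s, pr M q x = 0) := by
  refine hom_induction M (P := fun x => ∃ s : Finset ℤ, (∀ q ∉ s, pr M q x = 0)) ⟨∅, by simp⟩ ?_ ?_ x
  · rintro x y ⟨s, hs⟩ ⟨t, ht⟩
    refine ⟨s ∪ t, fun q hq => ?_⟩
    rw [Finset.notMem_union] at hq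
    rw [map_add, hs q hq.1, ht q hq.2, add_zero]
  · intro p x hx
    refine ⟨{p}, fun q hq => pr_ne M hx ?_⟩
    rintro rfl; simp at hq

lemma sum_pr (M : GAMod V) (x : M.M) (s : Finset ℤ) (hs : ∀ q ∉ s, pr M q x = 0) :
    x = ∑ q ∈ s, pr M q x := by
  have key : ∀ x : M.M, ∃ t : Finset ℤ, ∀ s, t ⊆ s → x = ∑ q ∈ s, pr M q x := by
    refine hom_induction M ⟨∅, by simp⟩ ?_ ?_
    · rintro x y ⟨s, hs⟩ ⟨t, ht⟩
      refine ⟨s ∪ t, fun u hu => ?_⟩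
      simp only [map_add, Finset.sum_add_distrib]
      rw [← hs u (Finset.union_subset_left hu), ← ht u (Finset.union_subset_right hu)]
    · intro p x hx
      refine ⟨{p}, fun u hu => ?_⟩
      rw [Finset.sum_eq_single p, pr_self M hx]
      · intro b _ hb; exact pr_ne M hx (Ne.symm hb)
      · intro h; exact absurd (hu (Finset.mem_singleton_self p)) h
  obtain ⟨t, ht⟩ := key x
  rw [Finset.sum_subset (Finset.subset_union_left (s₂ := t)) (fun q _ hq => hs q hq)]
  exact ht _ Finset.subset_union_right

lemma mem_of_pr (M : GAMod V) {S : Type*} [SetLike S M.M] [AddSubmonoidClass S M.M] (N : S) (x : M.M)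
    (h : ∀ q, pr M q x ∈ N) : x ∈ N := by
  obtain ⟨s, hs⟩ := pr_finset M x
  rw [sum_pr M x s hs]
  exact sum_mem fun q _ => h q

lemma eq_zero_of_pr (M : GAMod V) (x : M.M) (h : ∀ q, pr M q x = 0) : x = 0 := by
  obtain ⟨s, hs⟩ := pr_finset M x
  rw [sum_pr M x s hs]
  exact Finset.sum_eq_zero fun q _ => h q

lemma eq_of_pr (M : GAMod V) {x : M.M} {q : ℤ} (h : ∀ p, p ≠ q → pr M p x = 0) : x ∈ M.deg q := by
  rw [sum_pr M x {q} (fun p hp => h p (by simpa using hp))]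
  simp [pr_mem]

lemma smul_deg' (M : GAMod V) {k : ℕ} {a : PolyRing V} (ha : a ∈ AdegN V k) {q : ℤ} {x : M.M}
    (hx : x ∈ M.deg q) : a • x ∈ M.deg (q + 2 * k) := by
  rw [add_comm]
  exact M.smul_deg _ _ a (mem_Adeg ha) x hx

lemma pr_smul (M : GAMod V) {k : ℕ} {a : PolyRing V} (ha : a ∈ AdegN V k) (q : ℤ) (x : M.M) :
    pr M q (a • x) = a • pr M (q - 2 * k) x := by
  refine hom_induction M (P := fun x => pr M q (a • x) = a • pr M (q - 2 * k) x) (by simp) ?_ ?_ x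
  · intro x y hx hy; simp [smul_add, hx, hy]
  · intro p x hx
    by_cases h : p + 2 * k = q
    · subst h
      rw [pr_self M (smul_deg' M ha hx), add_sub_cancel_right, pr_self M hx]
    · rw [pr_ne M (smul_deg' M ha hx) h, pr_ne M hx (by omega), smul_zero]

lemma pr_map {M N : GAMod V} (f : M.M →ₗ[PolyRing V] N.M) (hf : ∀ q, ∀ x ∈ M.deg q, f x ∈ N.deg q)
    (q : ℤ) (x : M.M) : pr N q (f x) = f (pr M q x) := by
  refine hom_induction M (P := fun x => pr N q (f x) = f (pr M q x)) (by simp) ?_ ?_ x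
  · intro x y hx hy; simp [hx, hy]
  · intro p x hx
    by_cases h : p = q
    · subst h; rw [pr_self N (hf _ _ hx), pr_self M hx]
    · rw [pr_ne N (hf _ _ hx) h, pr_ne M hx h, map_zero]

lemma lin_smul_deg (M : GAMod V) (f : V →ₗ[ℝ] ℝ) {q : ℤ} {x : M.M}
    (hx : x ∈ M.deg q) : lin f • x ∈ M.deg (q + 2) := by
  have := smul_deg' M (lin_AdegN f) hx
  simpa using this

lemma pr_mSub (M : GAMod V) {y : M.M} (hy : y ∈ mSub V M.M) (q : ℤ) :
    pr M q y ∈ Submodule.span ℝ {w : M.M | ∃ f : V →ₗ[ℝ] ℝ, ∃ z ∈ M.deg (q - 2), w = lin f • z} := by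
  rw [mSub] at hy
  refine Submodule.smul_induction_on hy ?_ ?_
  · intro a ha x _
    rw [mId_eq] at ha
    revert x
    refine Submodule.span_induction (p := fun a _ => ∀ x : M.M, x ∈ (⊤ : Submodule (PolyRing V) M.M) → pr M q (a • x) ∈ Submodule.span ℝ {w : M.M | ∃ f : V →ₗ[ℝ] ℝ, ∃ z ∈ M.deg (q - 2), w = lin f • z}) ?_ ?_ ?_ ?_ ha
    · rintro _ ⟨f, rfl⟩ x _
      apply Submodule.subset_span
      refine ⟨f, pr M (q - 2) x, pr_mem _ _ _, ?_⟩
      have := pr_smul M (lin_AdegN f) q x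
      simpa using this
    · intro x _; simp
    · intro a b _ _ h1 h2 x hx
      rw [add_smul, map_add]; exact add_mem (h1 x hx) (h2 x hx)
    · intro b a _ h x hx
      rw [smul_eq_mul, mul_comm, mul_smul]; exact h _ trivial
  · intro x y hx hy; rw [map_add]; exact add_mem hx hy

lemma lin_mem_mId (f : V →ₗ[ℝ] ℝ) : lin f ∈ mId V := by
  rw [mId_eq]; exact Submodule.subset_span ⟨f, rfl⟩

lemma smul_mem_mSub {M : Type} [AddCommGroup M] [Module (PolyRing V) M] {a : PolyRing V} (ha : a ∈ mId V)
    (x : M) : a • x ∈ mSub V M := Submodule.smul_mem_smul ha trivial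

lemma real_smul {M : Type*} [AddCommGroup M] [Module (PolyRing V) M] [Module ℝ M]
    [IsScalarTower ℝ (PolyRing V) M] (c : ℝ) (x : M) :
    c • x = (algebraMap ℝ (PolyRing V) c) • x := by
  rw [algebraMap_smul]

lemma span_le_sub {M : Type*} [AddCommGroup M] [Module (PolyRing V) M] [Module ℝ M]
    [IsScalarTower ℝ (PolyRing V) M] (S : Submodule (PolyRing V) M) (T : Set M) (h : T ⊆ S) {x : M}
    (hx : x ∈ Submodule.span ℝ T) : x ∈ S := by
  have : Submodule.span ℝ T ≤ S.restrictScalars ℝ := Submodule.span_le.2 h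
  exact this hx

lemma pr_mSub_mem (M : GAMod V) {y : M.M} (hy : y ∈ mSub V M.M) (q : ℤ) : pr M q y ∈ mSub V M.M := by
  refine span_le_sub _ _ ?_ (pr_mSub M hy q)
  rintro _ ⟨f, z, _, rfl⟩
  exact smul_mem_mSub (lin_mem_mId f) z

/-- graded Nakayama -/
lemma nakayama (M : GAMod V) (q0 : ℤ) (hb : ∀ q < q0, M.deg q = ⊥) (S : Submodule (PolyRing V) M.M)
    (hS : ∀ q, ∀ x ∈ M.deg q, ∃ s ∈ S, s ∈ M.deg q ∧ x - s ∈ mSub V M.M) : S = ⊤ := by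
  have key : ∀ n : ℕ, ∀ q : ℤ, q < q0 + n → M.deg q ≤ S.restrictScalars ℝ := by
    intro n
    induction n with
    | zero => intro q hq; rw [hb q (by simpa using hq)]; exact bot_le
    | succ n ih =>
      intro q hq x hx
      obtain ⟨s, hs, hsd, hm⟩ := hS q x hx
      have h1 := pr_mSub M hm q
      rw [pr_self M (sub_mem hx hsd)] at h1
      have h2 : x - s ∈ S := by
        refine span_le_sub _ _ ?_ h1
        rintro _ ⟨f, z, hz, rfl⟩
        exact S.smul_mem _ (ih (q - 2) (by push_cast at hq; omega) hz)
      have := S.add_mem h2 hs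
      rwa [sub_add_cancel] at this
  rw [eq_top_iff]
  intro x _
  refine mem_of_pr M S x fun q => ?_
  refine key (q - q0 + 1).toNat q ?_ (pr_mem M q x)
  have := Int.self_le_toNat (q - q0 + 1)
  omega

/-- sections as graded module -/
def prSec {Δ : Fan V} (F : FanSheaf Δ) (L : Set (Cone V)) (q : ℤ) (s : F.Sec L) : F.Sec L :=
  ⟨fun σ => pr (F.stalk σ) q (s.1 σ), fun σ h => by change pr (F.stalk σ) q (s.1 σ) = 0; rw [s.2.1 σ h, map_zero],
    fun σ τ hσ hτ h => by
      rw [← pr_map _ (F.res σ τ h).deg_mem, s.2.2 σ τ hσ hτ h]⟩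

lemma prSec_mem {Δ : Fan V} (F : FanSheaf Δ) (L : Set (Cone V)) (q : ℤ) (s : F.Sec L) :
    prSec F L q s ∈ F.secDeg L q := fun σ => pr_mem _ _ _

lemma sec_internal {Δ : Fan V} (F : FanSheaf Δ) (L : Set (Cone V)) :
    DirectSum.IsInternal (F.secDeg L) := by
  apply DirectSum.isInternal_submodule_of_iSupIndep_of_iSup_eq_top
  · rw [iSupIndep_iff_finsetSum_eq_zero_imp_eq_zero]
    intro s v hv h0 i hi
    apply Subtype.ext; funext σ
    have h1 : (∑ i ∈ s, (v i).1 σ) = 0 := by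
      have := congrArg (fun t : F.Sec L => t.1 σ) h0
      simpa using this
    have h2 := congrArg (pr (F.stalk σ) i) h1
    rw [map_sum, map_zero, Finset.sum_eq_single i, pr_self _ (hv i hi σ)] at h2
    · exact h2
    · intro b hb hbi; exact pr_ne _ (hv b hb σ) hbi
    · intro h; exact absurd hi h
  · rw [eq_top_iff]
    intro x _
    haveI : Finite Δ.cones := Δ.finite
    haveI := Fintype.ofFinite Δ.cones
    choose t ht using fun σ : Δ.cones => pr_finset (F.stalk σ) (x.1 σ)
    have hx : x = ∑ q ∈ Finset.univ.biUnion t, prSec F L q x := by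
      apply Subtype.ext; funext σ
      have : (∑ q ∈ Finset.univ.biUnion t, prSec F L q x).1 σ =
          ∑ q ∈ Finset.univ.biUnion t, pr (F.stalk σ) q (x.1 σ) := by
        simp [prSec]
      rw [this]
      apply sum_pr
      intro q hq
      apply ht
      intro h; exact hq (Finset.mem_biUnion.2 ⟨σ, Finset.mem_univ _, h⟩)
    rw [hx]
    exact sum_mem fun q _ => Submodule.mem_iSup_of_mem q (prSec_mem F L q x)

def secG {Δ : Fan V} (F : FanSheaf Δ) (L : Set (Cone V)) : GAMod V where
  M := F.Sec L
  deg := F.secDeg L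
  internal := sec_internal F L
  smul_deg := fun p q a ha x hx σ => (F.stalk σ).smul_deg p q a ha _ (hx σ)

lemma pr_secG {Δ : Fan V} (F : FanSheaf Δ) (L : Set (Cone V)) (q : ℤ) (s : F.Sec L) (σ : Δ.cones) :
    (pr (secG F L) q s : F.Sec L).1 σ = pr (F.stalk σ) q (s.1 σ) := by
  let f : F.Sec L →ₗ[PolyRing V] (F.stalk σ).M :=
    { toFun := fun s => s.1 σ, map_add' := fun _ _ => rfl, map_smul' := fun _ _ => rfl }
  exact (pr_map (M := secG F L) (N := F.stalk σ) f (fun q x hx => hx σ) q s).symm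

/-! ### homogeneous bases -/

structure HB (I : Ideal (PolyRing V)) (M : GAMod V) where
  ι : Type
  [fin : Fintype ι]
  e : ι → M.M
  dg : ι → ℤ
  mem : ∀ i, e i ∈ M.deg (dg i)
  span : Submodule.span (PolyRing V) (Set.range e) = ⊤
  kill : ∀ a ∈ I, ∀ x : M.M, a • x = 0
  ind : ∀ a : ι → PolyRing V, ∑ i, a i • e i = 0 → ∀ i, a i ∈ I

attribute [instance] HB.fin

lemma HB.exists_coord {I : Ideal (PolyRing V)} {M : GAMod V} (H : HB I M) (x : M.M) :
    ∃ a : H.ι → PolyRing V, x = ∑ i, a i • H.e i := by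
  have hx : x ∈ Submodule.span (PolyRing V) (Set.range H.e) := by rw [H.span]; trivial
  obtain ⟨a, ha⟩ := (Submodule.mem_span_range_iff_exists_fun _).1 hx
  exact ⟨a, ha.symm⟩

/-- degree pieces of a module spanned by finitely many homogeneous elements -/
lemma mem_deg_span (M : GAMod V) {ι : Type} [Fintype ι] (e : ι → M.M) (dg : ι → ℤ)
    (he : ∀ i, e i ∈ M.deg (dg i)) (a : ι → PolyRing V) (q : ℤ) :
    ∃ b : ι → PolyRing V, pr M q (∑ i, a i • e i) = ∑ i, b i • e i ∧
      (∀ i, ∀ k : ℕ, q - dg i = 2 * k → b i ∈ AdegN V k) ∧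
      (∀ i, (∀ k : ℕ, q - dg i ≠ 2 * k) → b i = 0) := by
  have key : ∀ i, ∃ b : PolyRing V, pr M q (a i • e i) = b • e i ∧
      (∀ k : ℕ, q - dg i = 2 * k → b ∈ AdegN V k) ∧
      ((∀ k : ℕ, q - dg i ≠ 2 * k) → b = 0) := by
    intro i
    obtain ⟨n, c, hc, hac⟩ := hom_decomp (a i)
    have h1 : ∀ k, pr M q (c k • e i) = if q - dg i = 2 * k then c k • e i else 0 := by
      intro k
      rw [pr_smul M (hc k)]
      split_ifs with h
      · rw [show q - 2 * k = dg i by omega, pr_self M (he i)]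
      · rw [pr_ne M (he i) (by omega), smul_zero]
    refine ⟨∑ k ∈ Finset.range n, if q - dg i = 2 * k then c k else 0, ?_, ?_, ?_⟩
    · rw [hac, Finset.sum_smul, map_sum, Finset.sum_smul]
      refine Finset.sum_congr rfl fun k _ => ?_
      rw [h1]; split_ifs <;> simp
    · intro k hk
      refine sum_mem fun j _ => ?_
      split_ifs with h
      · have : j = k := by omega
        rw [← this]; exact hc j
      · exact zero_mem _
    · intro h
      exact Finset.sum_eq_zero fun k _ => if_neg (h k)
  choose b h1 h2 h3 using key
  refine ⟨b, ?_, h2, h3⟩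
  rw [map_sum]
  exact Finset.sum_congr rfl fun i _ => h1 i

lemma HB.bdd {I : Ideal (PolyRing V)} {M : GAMod V} (H : HB I M) :
    ∃ q0 : ℤ, ∀ q < q0, M.deg q = ⊥ := by
  obtain ⟨q0, hq0⟩ : ∃ q0 : ℤ, ∀ i, q0 ≤ H.dg i := by
    obtain ⟨q0, h⟩ := (Set.finite_range H.dg).bddBelow
    exact ⟨q0, fun i => h ⟨i, rfl⟩⟩
  refine ⟨q0, fun q hq => ?_⟩
  rw [eq_bot_iff]
  intro x hx
  obtain ⟨a, ha⟩ := H.exists_coord x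
  obtain ⟨b, hb, -, hb0⟩ := mem_deg_span M H.e H.dg H.mem a q
  rw [← ha, pr_self M hx] at hb
  change x = 0
  rw [hb]
  refine Finset.sum_eq_zero fun i _ => ?_
  rw [hb0 i (fun k => by have := hq0 i; omega), zero_smul]

/-- finitely generated graded modules are bounded below -/
lemma fg_bdd (M : GAMod V) [Module.Finite (PolyRing V) M.M] :
    ∃ q0 : ℤ, ∀ q < q0, M.deg q = ⊥ := by
  obtain ⟨s, hs⟩ := (Module.finite_def.1 (inferInstance : Module.Finite (PolyRing V) M.M))
  choose t ht using fun x : M.M => pr_finset M x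
  let T : Finset ℤ := s.biUnion t
  let e : s × T → M.M := fun p => pr M p.2 p.1
  have hspan : Submodule.span (PolyRing V) (Set.range e) = ⊤ := by
    rw [eq_top_iff, ← hs, Submodule.span_le]
    intro x hx
    rw [sum_pr M x (T) (fun q hq => ht x q (fun h => hq (Finset.mem_biUnion.2 ⟨x, hx, h⟩)))]
    refine sum_mem fun q hq => Submodule.subset_span ⟨(⟨x, hx⟩, ⟨q, hq⟩), rfl⟩
  obtain ⟨q0, h⟩ := (Set.finite_range (fun p : s × T => (p.2 : ℤ))).bddBelow
  refine ⟨q0, fun q hq => ?_⟩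
  rw [eq_bot_iff]
  intro x hx
  have hx' : x ∈ Submodule.span (PolyRing V) (Set.range e) := by rw [hspan]; trivial
  obtain ⟨a, ha⟩ := (Submodule.mem_span_range_iff_exists_fun _).1 hx'
  obtain ⟨b, hb, -, hb0⟩ := mem_deg_span M e (fun p => p.2) (fun p => pr_mem _ _ _) a q
  rw [ha, pr_self M hx] at hb
  change x = 0
  rw [hb]
  refine Finset.sum_eq_zero fun i _ => ?_
  rw [hb0 i (fun k => by have := h ⟨i, rfl⟩; simp only at this; omega), zero_smul]

end grad

end

section
/-! ### Part C2: minimal extension sheaves are nice -/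
section nice
variable {V : Type} [AddCommGroup V] [Module ℝ V]

lemma bdRes_ap {Δ : Fan V} (F : FanSheaf Δ) (σ : Δ.cones) (x : (F.stalk σ).M) (τ : Δ.cones)
    (h : Cone.IsProperFaceOf τ.1 σ.1) : (F.bdRes σ x).1 τ = (F.res σ τ h.1).toLin x := by
  change (if h : Cone.IsProperFaceOf τ.1 σ.1 then (F.res σ τ h.1).toLin x else 0) = _
  rw [dif_pos h]

lemma bdRes_deg {Δ : Fan V} (F : FanSheaf Δ) (σ : Δ.cones) (q : ℤ) (x : (F.stalk σ).M)
    (hx : x ∈ (F.stalk σ).deg q) : F.bdRes σ x ∈ F.secDeg (FanSheaf.bdFan σ) q := by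
  intro τ
  change (if h : Cone.IsProperFaceOf τ.1 σ.1 then (F.res σ τ h.1).toLin x else 0) ∈ _
  split_ifs with h
  · exact (F.res σ τ h.1).deg_mem q x hx
  · exact zero_mem _

lemma pr_bdRes {Δ : Fan V} (F : FanSheaf Δ) (σ : Δ.cones) (q : ℤ) (x : (F.stalk σ).M) :
    pr (secG F (FanSheaf.bdFan σ)) q (F.bdRes σ x) = F.bdRes σ (pr _ q x) :=
  pr_map (M := F.stalk σ) (N := secG F (FanSheaf.bdFan σ)) (F.bdRes σ) (bdRes_deg F σ) q x

lemma red_surj {Δ : Fan V} (F : FanSheaf Δ) (hF : F.CondLME) (σ : Δ.cones) (h0 : σ.1 ≠ zeroCone V) (q : ℤ)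
    (y : F.Sec (FanSheaf.bdFan σ)) (hy : y ∈ F.secDeg (FanSheaf.bdFan σ) q) :
    ∃ x ∈ (F.stalk σ).deg q, y - F.bdRes σ x ∈ mSub V (F.Sec (FanSheaf.bdFan σ)) := by
  obtain ⟨_, ⟨x, hx, rfl⟩, h⟩ := (hF σ h0 q).surjOn ⟨y, hy, rfl⟩
  refine ⟨x, hx, ?_⟩
  exact (Submodule.Quotient.eq _).1 h.symm

lemma red_inj {Δ : Fan V} (F : FanSheaf Δ) (hF : F.CondLME) (σ : Δ.cones) (h0 : σ.1 ≠ zeroCone V) (q : ℤ)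
    (x : (F.stalk σ).M) (hx : x ∈ (F.stalk σ).deg q)
    (h : F.bdRes σ x ∈ mSub V (F.Sec (FanSheaf.bdFan σ))) : x ∈ mSub V (F.stalk σ).M := by
  have := (hF σ h0 q).injOn (x₁ := (mSub V (F.stalk σ).M).mkQ x) (x₂ := 0) ⟨x, hx, rfl⟩ (zero_mem (mRedPiece V ((F.stalk σ).deg q))) ?_
  · exact (Submodule.Quotient.mk_eq_zero _).1 this
  · rw [map_zero]
    exact (Submodule.Quotient.mk_eq_zero _).2 h

lemma red_inj' {Δ : Fan V} (F : FanSheaf Δ) (hF : F.CondLME) (σ : Δ.cones) (h0 : σ.1 ≠ zeroCone V)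
    (x : (F.stalk σ).M) 
    (h : F.bdRes σ x ∈ mSub V (F.Sec (FanSheaf.bdFan σ))) : x ∈ mSub V (F.stalk σ).M := by
  refine mem_of_pr _ _ x fun q => ?_
  refine red_inj F hF σ h0 q _ (pr_mem _ _ _) ?_
  rw [← pr_bdRes]
  exact pr_mSub_mem (secG F (FanSheaf.bdFan σ)) h q

structure Nice {Δ : Fan V} (F : FanSheaf Δ) : Prop where
  condN : F.CondN
  hb : ∀ σ : Δ.cones, Nonempty (HB (vanishingIdeal V σ.1.carrier) (F.stalk σ))
  surj : ∀ σ : Δ.cones, Surjective (F.bdRes σ)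
  ker : ∀ σ : Δ.cones, σ.1 ≠ zeroCone V → LinearMap.ker (F.bdRes σ) ≤ mSub V (F.stalk σ).M

lemma vI_zero : vanishingIdeal V (zeroCone V).carrier = mId V := by
  ext p
  rw [mem_vI, mem_mId]
  constructor
  · intro h; exact h 0 rfl
  · rintro h x rfl; exact h

lemma vI_le_mId (σ : Cone V) : vanishingIdeal V σ.carrier ≤ mId V := by
  intro p hp
  rw [mem_vI] at hp; rw [mem_mId]; exact hp 0 (cone_zero σ)

lemma sub_alg_mem (a : PolyRing V) : a - algebraMap ℝ (PolyRing V) (a.1 0) ∈ mId V := by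
  rw [mem_mId, sub_ap, alg_ap, sub_self]

lemma smul_eq_of_kill {M : Type*} [AddCommGroup M] [Module (PolyRing V) M] [Module ℝ M]
    [IsScalarTower ℝ (PolyRing V) M] (h : ∀ a ∈ mId V, ∀ x : M, a • x = 0) (a : PolyRing V) (x : M) :
    a • x = a.1 0 • x := by
  have := h _ (sub_alg_mem a) x
  rw [sub_smul, sub_eq_zero] at this
  rw [this, real_smul (V := V)]

lemma mRed_kill {M : Type} [AddCommGroup M] [Module (PolyRing V) M] :
    ∀ a ∈ mId V, ∀ x : mRed V M, a • x = 0 := by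
  intro a ha x
  obtain ⟨x, rfl⟩ := Submodule.Quotient.mk_surjective _ x
  rw [← Submodule.Quotient.mk_smul, Submodule.Quotient.mk_eq_zero]
  exact smul_mem_mSub ha x

lemma finite_of_kill {M : Type*} [AddCommGroup M] [Module (PolyRing V) M] [Module ℝ M]
    [IsScalarTower ℝ (PolyRing V) M] (h : ∀ a ∈ mId V, ∀ x : M, a • x = 0)
    [Module.Finite (PolyRing V) M] : Module.Finite ℝ M := by
  obtain ⟨s, hs⟩ := (Module.finite_def.1 (inferInstance : Module.Finite (PolyRing V) M))
  refine Module.finite_def.2 ⟨s, ?_⟩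
  rw [eq_top_iff]
  intro x _
  have hx : x ∈ Submodule.span (PolyRing V) (s : Set M) := by rw [hs]; trivial
  induction hx using Submodule.span_induction with
  | mem x hx => exact Submodule.subset_span hx
  | zero => exact zero_mem _
  | add x y _ _ h1 h2 => exact add_mem (h1 trivial) (h2 trivial)
  | smul a x _ h1 => rw [smul_eq_of_kill h]; exact Submodule.smul_mem _ _ (h1 trivial)

lemma hb_zero {Δ : Fan V} (F : FanSheaf Δ) (hN : F.CondN) :
    Nonempty (HB (vanishingIdeal V Δ.ozero.1.carrier) (F.stalk Δ.ozero)) := by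
  obtain ⟨h1, h2, h3⟩ := hN
  obtain ⟨v, hv, hsp⟩ := finrank_eq_one_iff'.1 h2
  have hk : ∀ a ∈ mId V, ∀ x : (F.stalk Δ.ozero).M, a • x = 0 := fun a ha x => h1 (x := x) (a := ⟨a, ha⟩)
  refine ⟨{ ι := Unit, e := fun _ => v, dg := fun _ => 0, mem := ?_, span := ?_, kill := ?_, ind := ?_ }⟩
  · intro _
    refine eq_of_pr _ fun p hp => ?_
    have := pr_mem (F.stalk Δ.ozero) p v
    rw [h3 p hp] at this
    exact this
  · rw [eq_top_iff]
    intro w _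
    obtain ⟨c, rfl⟩ := hsp w
    rw [real_smul (V := V)]
    exact Submodule.smul_mem _ _ (Submodule.subset_span ⟨(), rfl⟩)
  · intro a ha x
    exact hk a (vI_le_mId _ ha) x
  · intro a ha i
    change a i ∈ vanishingIdeal V (zeroCone V).carrier
    rw [vI_zero, mem_mId]
    simp only [Finset.univ_unique, Finset.sum_singleton] at ha
    rw [smul_eq_of_kill hk] at ha
    exact (smul_eq_zero.1 ha).resolve_right hv

/-- free modules with finite reduction have homogeneous bases -/
lemma hb_of_free [FiniteDimensional ℝ V] (σ : Cone V) (M : GAMod V) (hfree : FreeOverCone V σ M.M)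
    (hfin : Module.Finite ℝ (mRed V M.M)) : Nonempty (HB (vanishingIdeal V σ.carrier) M) := by
  obtain ⟨hT, hfree⟩ := hfree
  letI := hT.module
  have hsm : ∀ (a : PolyRing V) (x : M.M), (Ideal.Quotient.mk (vanishingIdeal V σ.carrier) a) • x = a • x :=
    fun a x => rfl
  have hnt : Nontrivial (coneRing V σ) := by
    apply Ideal.Quotient.nontrivial_iff.2
    intro h
    have := vI_le_mId σ (show (1 : PolyRing V) ∈ vanishingIdeal V σ.carrier by rw [h]; trivial)
    rw [mem_mId, one_ap] at this
    exact one_ne_zero this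
  let b := Module.Free.chooseBasis (coneRing V σ) M.M
  let ev : coneRing V σ →+* ℝ := Ideal.Quotient.lift _ (evalRH V 0) (fun a ha => vI_le_mId σ ha)
  have hev : ∀ a : PolyRing V, ev (Ideal.Quotient.mk _ a) = a.1 0 := fun a => rfl
  have hm0 : ∀ x ∈ mSub V M.M, ∀ k, ev (b.repr x k) = 0 := by
    intro x hx k
    refine Submodule.smul_induction_on hx ?_ ?_
    · intro a ha x _
      rw [← hsm, map_smul, Finsupp.smul_apply, smul_eq_mul, map_mul, hev, (mem_mId).1 ha, zero_mul]
    · intro x y hx hy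
      rw [map_add, Finsupp.add_apply, map_add, hx, hy, add_zero]
  have hli : LinearIndependent ℝ (fun k => (mSub V M.M).mkQ (b k)) := by
    rw [linearIndependent_iff']
    intro s g hg k hk
    have h1 : ∑ i ∈ s, g i • b i ∈ mSub V M.M := by
      rw [← Submodule.Quotient.mk_eq_zero, ← Submodule.mkQ_apply, map_sum, ← hg]
      refine Finset.sum_congr rfl fun i _ => ?_
      rw [real_smul (V := V), map_smul, ← real_smul (V := V)]
    have h2 := hm0 _ h1 k
    rw [map_sum, Finset.sum_apply', map_sum, Finset.sum_eq_single k] at h2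
    · rw [real_smul (V := V), ← hsm, map_smul, Basis.repr_self, Finsupp.smul_apply, Finsupp.single_eq_same, smul_eq_mul, mul_one, hev, alg_ap] at h2
      exact h2
    · intro i _ hi
      rw [real_smul (V := V), ← hsm, map_smul, Basis.repr_self, Finsupp.smul_apply, Finsupp.single_eq_of_ne (Ne.symm hi), smul_zero, map_zero]
    · intro h; exact absurd hk h
  have hfk : Finite (Module.Free.ChooseBasisIndex (coneRing V σ) M.M) := hli.finite
  have hfA : Module.Finite (coneRing V σ) M.M := Module.Finite.of_basis b
  letI : Fintype (Module.Free.ChooseBasisIndex (coneRing V σ) M.M) := Fintype.ofFinite _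
  have hfP : Module.Finite (PolyRing V) M.M := by
    obtain ⟨s, hs⟩ := hfA
    refine ⟨s, ?_⟩
    rw [eq_top_iff]
    intro x _
    have hx : x ∈ Submodule.span (coneRing V σ) (s : Set M.M) := by rw [hs]; trivial
    induction hx using Submodule.span_induction with
    | mem x hx => exact Submodule.subset_span hx
    | zero => exact zero_mem _
    | add x y _ _ h1 h2 => exact add_mem (h1 trivial) (h2 trivial)
    | smul a x _ h1 =>
      obtain ⟨a, rfl⟩ := Ideal.Quotient.mk_surjective a
      rw [hsm]; exact Submodule.smul_mem _ _ (h1 trivial)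
  obtain ⟨q0, hq0⟩ := fg_bdd M
  -- homogeneous basis of the reduction
  let T : Set (mRed V M.M) := {y | ∃ q, ∃ x ∈ M.deg q, (mSub V M.M).mkQ x = y}
  obtain ⟨B, hBT, hBs, hBl⟩ := exists_linearIndependent ℝ T
  have hTs : Submodule.span ℝ T = ⊤ := by
    rw [eq_top_iff]
    intro y _
    obtain ⟨x, rfl⟩ := Submodule.mkQ_surjective _ y
    refine hom_induction M (P := fun x => (mSub V M.M).mkQ x ∈ Submodule.span ℝ T) (by simp) ?_ ?_ x
    · intro x y hx hy; rw [map_add]; exact add_mem hx hy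
    · intro q x hx; exact Submodule.subset_span ⟨q, x, hx, rfl⟩
  rw [hTs] at hBs
  have hBf : Finite B := hBl.finite
  letI : Fintype B := Fintype.ofFinite _
  choose dg e he hee using fun y : B => hBT y.2
  let bB : Basis B ℝ (mRed V M.M) := Basis.mk hBl (by rw [Subtype.range_coe]; exact hBs.ge)
  have hspan : Submodule.span (PolyRing V) (Set.range e) = ⊤ := by
    refine nakayama M q0 hq0 _ fun q x hx => ?_
    have hx1 : (mSub V M.M).mkQ x ∈ Submodule.span ℝ (Set.range (fun y : B => (y : mRed V M.M))) := by
      rw [Subtype.range_coe, hBs]; trivial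
    obtain ⟨c, hc⟩ := (Submodule.mem_span_range_iff_exists_fun _).1 hx1
    let s := ∑ i, algebraMap ℝ (PolyRing V) (c i) • e i
    have hs : x - s ∈ mSub V M.M := by
      rw [← Submodule.Quotient.mk_eq_zero, ← Submodule.mkQ_apply, map_sub, sub_eq_zero, ← hc, map_sum]
      refine Finset.sum_congr rfl fun i _ => ?_
      rw [map_smul, hee, real_smul (V := V)]
    refine ⟨pr M q s, ?_, pr_mem _ _ _, ?_⟩
    · obtain ⟨b', hb', -, -⟩ := mem_deg_span M e dg he (fun i => algebraMap ℝ (PolyRing V) (c i)) q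
      rw [hb']
      exact sum_mem fun i _ => Submodule.smul_mem _ _ (Submodule.subset_span ⟨i, rfl⟩)
    · have := pr_mSub_mem M hs q
      rwa [map_sub, pr_self M hx] at this
  have hspan2 : (⊤ : Submodule (coneRing V σ) M.M) ≤ Submodule.span (coneRing V σ) (Set.range e) := by
    intro x _
    have hx : x ∈ Submodule.span (PolyRing V) (Set.range e) := by rw [hspan]; trivial
    obtain ⟨c, hc⟩ := (Submodule.mem_span_range_iff_exists_fun _).1 hx
    rw [← hc]
    refine sum_mem fun i _ => ?_
    rw [← hsm]
    exact Submodule.smul_mem _ _ (Submodule.subset_span ⟨i, rfl⟩)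
  have hcard : Fintype.card B ≤ finrank (coneRing V σ) M.M := by
    rw [Module.finrank_eq_card_basis b, ← Module.finrank_eq_card_basis bB]
    refine (finrank_le_of_span_eq_top (R := ℝ) (v := fun k => (mSub V M.M).mkQ (b k)) ?_)
    rw [eq_top_iff]
    intro y _
    obtain ⟨x, rfl⟩ := Submodule.mkQ_surjective _ y
    rw [← b.sum_repr x, map_sum]
    refine sum_mem fun k _ => ?_
    obtain ⟨a, ha⟩ := Ideal.Quotient.mk_surjective (b.repr x k)
    rw [← ha, hsm, map_smul, smul_eq_of_kill mRed_kill]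
    exact Submodule.smul_mem _ _ (Submodule.subset_span ⟨k, rfl⟩)
  have hind := linearIndependent_of_top_le_span_of_card_le_finrank hspan2 hcard
  refine ⟨{ ι := B, e := e, dg := dg, mem := he, span := hspan, kill := ?_, ind := ?_ }⟩
  · intro a ha x
    exact hT (x := x) (a := ⟨a, ha⟩)
  · intro a ha i
    have := Fintype.linearIndependent_iff.1 hind (fun i => Ideal.Quotient.mk _ (a i)) ?_ i
    · exact Ideal.Quotient.eq_zero_iff_mem.1 this
    · rw [← ha]; rfl

lemma HB.finite {I : Ideal (PolyRing V)} {M : GAMod V} (H : HB I M) : Module.Finite (PolyRing V) M.M :=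
  ⟨(Set.finite_range H.e).toFinset, by rw [Set.Finite.coe_toFinset]; exact H.span⟩

lemma sec_finite [FiniteDimensional ℝ V] {Δ : Fan V} (F : FanSheaf Δ) (L : Set (Cone V))
    (hF : ∀ τ : Δ.cones, τ.1 ∈ L → Module.Finite (PolyRing V) (F.stalk τ).M) :
    Module.Finite (PolyRing V) (F.Sec L) := by
  have : Finite Δ.cones := Δ.finite
  let P := ∀ τ : {τ : Δ.cones // τ.1 ∈ L}, (F.stalk τ.1).M
  let f : F.Sec L →ₗ[PolyRing V] P :=
    { toFun := fun s τ => s.1 τ.1, map_add' := fun _ _ => rfl, map_smul' := fun _ _ => rfl }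
  have : ∀ τ : {τ : Δ.cones // τ.1 ∈ L}, Module.Finite (PolyRing V) (F.stalk τ.1).M := fun τ => hF _ τ.2
  have hN : IsNoetherian (PolyRing V) P := inferInstance
  refine Module.Finite.of_injective f ?_
  intro s t hst
  apply Subtype.ext; funext τ
  by_cases h : τ.1 ∈ L
  · exact congrFun hst ⟨τ, h⟩
  · rw [s.2.1 τ h, t.2.1 τ h]

lemma proper_dim_lt [FiniteDimensional ℝ V] {τ σ : Cone V} (h : τ.IsProperFaceOf σ) : τ.dim < σ.dim :=
  face_dim_lt h.1 h.2

lemma mes_nice [FiniteDimensional ℝ V] {Δ : Fan V} (F : FanSheaf Δ) (hF : F.IsMES) : Nice F := by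
  obtain ⟨hN, hPF, hLME⟩ := hF
  have hb : ∀ n : ℕ, ∀ σ : Δ.cones, σ.1.dim = n → Nonempty (HB (vanishingIdeal V σ.1.carrier) (F.stalk σ)) := by
    intro n
    induction n using Nat.strong_induction_on with
    | _ n ih =>
      intro σ hσ
      by_cases h0 : σ.1 = zeroCone V
      · have : σ = Δ.ozero := Subtype.ext h0
        subst this
        exact hb_zero F hN
      · refine hb_of_free σ.1 _ (hPF σ) ?_
        have hfs : Module.Finite (PolyRing V) (F.Sec (FanSheaf.bdFan σ)) := by
          refine sec_finite F _ fun τ hτ => ?_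
          obtain ⟨H⟩ := ih _ (hσ ▸ proper_dim_lt hτ) τ rfl
          exact H.finite
        have hfr : Module.Finite ℝ (mRed V (F.Sec (FanSheaf.bdFan σ))) := finite_of_kill mRed_kill
        refine Module.Finite.of_injective ((F.bdResRed σ).restrictScalars ℝ) ?_
        rw [injective_iff_map_eq_zero]
        intro y hy
        obtain ⟨x, rfl⟩ := Submodule.mkQ_surjective _ y
        have h1 : F.bdRes σ x ∈ mSub V (F.Sec (FanSheaf.bdFan σ)) := (Submodule.Quotient.mk_eq_zero _).1 hy
        exact (Submodule.Quotient.mk_eq_zero _).2 (red_inj' F hLME σ h0 x h1)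
  refine ⟨hN, fun σ => hb _ σ rfl, ?_, ?_⟩
  · intro σ
    by_cases h0 : σ.1 = zeroCone V
    · intro y
      refine ⟨0, ?_⟩
      apply Subtype.ext; funext τ
      rw [y.2.1 τ]
      · simp
      · intro h
        have := proper_dim_lt h
        rw [h0, zeroCone_dim] at this
        omega
    · have hfs : Module.Finite (PolyRing V) (F.Sec (FanSheaf.bdFan σ)) := by
        refine sec_finite F _ fun τ hτ => ?_
        obtain ⟨H⟩ := hb _ τ rfl
        exact H.finite
      obtain ⟨q0, hq0⟩ := @fg_bdd V _ _ (secG F (FanSheaf.bdFan σ)) hfs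
      rw [← LinearMap.range_eq_top]
      refine nakayama (secG F (FanSheaf.bdFan σ)) q0 hq0 _ fun q x hx => ?_
      obtain ⟨z, hz, h⟩ := red_surj F hLME σ h0 q x hx
      exact ⟨F.bdRes σ z, ⟨z, rfl⟩, bdRes_deg F σ q z hz, h⟩
  · intro σ h0 x hx
    refine red_inj' F hLME σ h0 x ?_
    rw [LinearMap.mem_ker.1 hx]; exact zero_mem _

end nice

end

section
/-! ### Part C3: flabbiness and consequences -/
section flab
variable {V : Type} [AddCommGroup V] [Module ℝ V]

lemma res_res {Δ : Fan V} (F : FanSheaf Δ) {σ τ υ : Δ.cones} (h1 : Cone.IsFaceOf τ.1 σ.1)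
    (h2 : Cone.IsFaceOf υ.1 τ.1) (h3 : Cone.IsFaceOf υ.1 σ.1) (x : (F.stalk σ).M) :
    (F.res τ υ h2).toLin ((F.res σ τ h1).toLin x) = (F.res σ υ h3).toLin x := by
  rw [← F.res_comp σ τ υ h1 h2 h3]; rfl

lemma res_id {Δ : Fan V} (F : FanSheaf Δ) {σ : Δ.cones} (h : Cone.IsFaceOf σ.1 σ.1) (x : (F.stalk σ).M) :
    (F.res σ σ h).toLin x = x := by rw [F.res_self]; rfl

variable [FiniteDimensional ℝ V]

lemma flabby_aux {Δ : Fan V} {F : FanSheaf Δ} (hF : Nice F) (σ : Δ.cones) (n : ℕ) :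
    ∀ (S : Set Δ.cones) (_ : ∀ τ ∈ S, Cone.IsFaceOf τ.1 σ.1)
    (_ : ∀ τ ∈ S, ∀ υ : Δ.cones, Cone.IsFaceOf υ.1 τ.1 → υ ∈ S)
    (y : ∀ τ : Δ.cones, (F.stalk τ).M)
    (_ : ∀ τ ∈ S, ∀ υ : Δ.cones, ∀ h : Cone.IsFaceOf υ.1 τ.1, (F.res τ υ h).toLin (y τ) = y υ)
    (_ : Set.ncard {τ : Δ.cones | Cone.IsFaceOf τ.1 σ.1 ∧ τ ∉ S} = n),
    ∃ x : (F.stalk σ).M, ∀ τ ∈ S, ∀ h : Cone.IsFaceOf τ.1 σ.1, (F.res σ τ h).toLin x = y τ := by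
  have hfin : Finite Δ.cones := Δ.finite
  induction n with
  | zero =>
    intro S hS1 hS2 y hy hn
    rw [Set.ncard_eq_zero] at hn
    have hσ : σ ∈ S := by
      by_contra h
      have : σ ∈ {τ : Δ.cones | Cone.IsFaceOf τ.1 σ.1 ∧ τ ∉ S} := ⟨face_refl _, h⟩
      rw [hn] at this; exact this
    exact ⟨y σ, fun τ _ h => hy σ hσ τ h⟩
  | succ n ih =>
    intro S hS1 hS2 y hy hn
    have hne : {τ : Δ.cones | Cone.IsFaceOf τ.1 σ.1 ∧ τ ∉ S}.Nonempty := by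
      rw [Set.nonempty_iff_ne_empty]; intro h; rw [h, Set.ncard_empty] at hn; omega
    obtain ⟨τ, ⟨hτ1, hτ2⟩, hmin⟩ := Set.exists_min_image _ (fun τ : Δ.cones => τ.1.dim) (Set.toFinite _) hne
    have hprop : ∀ υ : Δ.cones, υ.1.IsProperFaceOf τ.1 → υ ∈ S := by
      intro υ hυ
      by_contra h
      have := hmin υ ⟨face_trans hυ.1 hτ1, h⟩
      have h2 := proper_dim_lt hυ
      omega
    obtain ⟨z, hz⟩ := hF.surj τ ⟨fun υ => if υ.1.IsProperFaceOf τ.1 then y υ else 0,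
      fun υ hυ => if_neg hυ, fun υ υ' hυ hυ' h => by
        change (F.res υ υ' h).toLin (if (υ.1).IsProperFaceOf τ.1 then y υ else 0) = if (υ'.1).IsProperFaceOf τ.1 then y υ' else 0
        rw [if_pos (show υ.1.IsProperFaceOf τ.1 from hυ), if_pos (show υ'.1.IsProperFaceOf τ.1 from hυ')]
        exact hy υ (hprop υ hυ) υ' h⟩
    have hz' : ∀ υ : Δ.cones, ∀ h : υ.1.IsProperFaceOf τ.1, (F.res τ υ h.1).toLin z = y υ := by
      intro υ h
      rw [← bdRes_ap F τ z υ h, hz]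
      exact if_pos h
    have key := ih (insert τ S) ?_ ?_ (Function.update y τ z) ?_ ?_
    · obtain ⟨x, hx⟩ := key
      refine ⟨x, fun υ hυ h => ?_⟩
      rw [hx υ (Set.mem_insert_of_mem _ hυ) h, Function.update_of_ne]
      rintro rfl; exact hτ2 hυ
    · rintro υ (rfl | hυ)
      · exact hτ1
      · exact hS1 υ hυ
    · rintro υ (rfl | hυ) ρ hρ
      · by_cases h : ρ = υ
        · exact Or.inl h
        · exact Or.inr (hprop ρ ⟨hρ, fun h' => h (Subtype.ext h')⟩)
      · exact Or.inr (hS2 υ hυ ρ hρ)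
    · rintro υ (rfl | hυ) ρ hρ
      · by_cases h : ρ = υ
        · subst h; rw [Function.update_self, res_id]
        · rw [Function.update_self, Function.update_of_ne h]
          exact hz' ρ ⟨hρ, fun h' => h (Subtype.ext h')⟩
      · rw [Function.update_of_ne, Function.update_of_ne]
        · exact hy υ hυ ρ hρ
        · rintro rfl; exact hτ2 (hS2 υ hυ _ hρ)
        · rintro rfl; exact hτ2 hυ
    · have : {υ : Δ.cones | Cone.IsFaceOf υ.1 σ.1 ∧ υ ∉ S} =
        insert τ {υ : Δ.cones | Cone.IsFaceOf υ.1 σ.1 ∧ υ ∉ insert τ S} := by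
        ext υ
        constructor
        · rintro ⟨h1, h2⟩
          by_cases h : υ = τ
          · exact Or.inl h
          · exact Or.inr ⟨h1, fun h' => h'.elim h h2⟩
        · rintro (rfl | ⟨h1, h2⟩)
          · exact ⟨hτ1, hτ2⟩
          · exact ⟨h1, fun h => h2 (Or.inr h)⟩
      rw [this, Set.ncard_insert_of_notMem] at hn
      · omega
      · rintro ⟨_, h⟩; exact h (Or.inl rfl)

lemma flabby {Δ : Fan V} {F : FanSheaf Δ} (hF : Nice F) (σ : Δ.cones)
    (S : Set Δ.cones) (h1 : ∀ τ ∈ S, Cone.IsFaceOf τ.1 σ.1)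
    (h2 : ∀ τ ∈ S, ∀ υ : Δ.cones, Cone.IsFaceOf υ.1 τ.1 → υ ∈ S)
    (y : ∀ τ : Δ.cones, (F.stalk τ).M)
    (h3 : ∀ τ ∈ S, ∀ υ : Δ.cones, ∀ h : Cone.IsFaceOf υ.1 τ.1, (F.res τ υ h).toLin (y τ) = y υ) :
    ∃ x : (F.stalk σ).M, ∀ τ ∈ S, ∀ h : Cone.IsFaceOf τ.1 σ.1, (F.res σ τ h).toLin x = y τ :=
  flabby_aux hF σ _ S h1 h2 y h3 rfl

/-- extend an element of a face, by zero on a collection of faces -/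
lemma extend_zero {Δ : Fan V} {F : FanSheaf Δ} (hF : Nice F) (σ τ : Δ.cones) (hτ : Cone.IsFaceOf τ.1 σ.1)
    (Z : Set Δ.cones) (hZ : ∀ ρ ∈ Z, Cone.IsFaceOf ρ.1 σ.1) (z : (F.stalk τ).M)
    (hz : ∀ ρ ∈ Z, ∀ δ : Δ.cones, Cone.IsFaceOf δ.1 ρ.1 → ∀ h : Cone.IsFaceOf δ.1 τ.1, (F.res τ δ h).toLin z = 0) :
    ∃ x : (F.stalk σ).M, (F.res σ τ hτ).toLin x = z ∧
      ∀ ρ ∈ Z, ∀ h : Cone.IsFaceOf ρ.1 σ.1, (F.res σ ρ h).toLin x = 0 := by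
  let y : ∀ δ : Δ.cones, (F.stalk δ).M := fun δ =>
    if h : Cone.IsFaceOf δ.1 τ.1 then (F.res τ δ h).toLin z else 0
  have key := flabby hF σ {δ | Cone.IsFaceOf δ.1 τ.1 ∨ ∃ ρ ∈ Z, Cone.IsFaceOf δ.1 ρ.1} ?_ ?_ y ?_
  · obtain ⟨x, hx⟩ := key
    refine ⟨x, ?_, ?_⟩
    · rw [hx τ (Or.inl (face_refl _))]
      simp only [y, dif_pos (face_refl τ.1)]
      exact res_id F _ z
    · intro ρ hρ h
      rw [hx ρ (Or.inr ⟨ρ, hρ, face_refl _⟩)]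
      by_cases h' : Cone.IsFaceOf ρ.1 τ.1
      · simp only [y, dif_pos h']; exact hz ρ hρ ρ (face_refl _) h'
      · simp only [y, dif_neg h']
  · rintro δ (h | ⟨ρ, hρ, h⟩)
    · exact face_trans h hτ
    · exact face_trans h (hZ ρ hρ)
  · rintro δ (h | ⟨ρ, hρ, h⟩) υ hυ
    · exact Or.inl (face_trans hυ h)
    · exact Or.inr ⟨ρ, hρ, face_trans hυ h⟩
  · rintro δ hδ υ hυ
    by_cases h : Cone.IsFaceOf δ.1 τ.1
    · simp only [y, dif_pos h, dif_pos (face_trans hυ h)]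
      exact res_res F h hυ _ z
    · simp only [y, dif_neg h, map_zero]
      by_cases h' : Cone.IsFaceOf υ.1 τ.1
      · rw [dif_pos h']
        obtain ⟨ρ, hρ, hδρ⟩ := hδ.resolve_left h
        exact (hz ρ hρ υ (face_trans hυ hδρ) h').symm
      · rw [dif_neg h']

lemma ker_bdRes {Δ : Fan V} (F : FanSheaf Δ) (σ : Δ.cones) (x : (F.stalk σ).M) :
    x ∈ LinearMap.ker (F.bdRes σ) ↔ ∀ τ : Δ.cones, ∀ h : τ.1 ∈ facets σ.1,
      (F.res σ τ (facet_face h)).toLin x = 0 := by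
  rw [LinearMap.mem_ker]
  constructor
  · intro hx τ h
    rw [← bdRes_ap F σ x τ (facet_proper h), hx]; rfl
  · intro hx
    apply Subtype.ext; funext τ
    by_cases h : Cone.IsProperFaceOf τ.1 σ.1
    · rw [bdRes_ap F σ x τ h]
      obtain ⟨γ, hγ, hτγ⟩ := proper_in_facet h
      have := hx ⟨γ, Δ.face_mem _ σ.2 _ (facet_face hγ)⟩ hγ
      rw [← res_res F (τ := ⟨γ, Δ.face_mem _ σ.2 _ (facet_face hγ)⟩) (facet_face hγ) hτγ h.1, this, map_zero]; rfl
    · exact dif_neg h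

lemma vI_prime (σ : Cone V) {p q : PolyRing V} (h : p * q ∈ vanishingIdeal V σ.carrier)
    (hp : p ∉ vanishingIdeal V σ.carrier) : q ∈ vanishingIdeal V σ.carrier := by
  rw [mem_vI_cone] at *
  by_contra hq
  push Not at hp hq
  obtain ⟨x, hx, h1⟩ := hp
  obtain ⟨y, hy, h2⟩ := hq
  obtain ⟨z, hz, h3, h4⟩ := common_nonzero σ.spanC p q ⟨x, hx, h1⟩ ⟨y, hy, h2⟩
  have := h z hz
  rw [mul_ap] at this
  exact (mul_ne_zero h3 h4) this

lemma HB.lift_hom {I : Ideal (PolyRing V)} {M : GAMod V} (H : HB I M) {N : Type*} [AddCommGroup N]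
    [Module (PolyRing V) N] (hN : ∀ a ∈ I, ∀ x : N, a • x = 0) (v : H.ι → N) :
    ∃ f : M.M →ₗ[PolyRing V] N, ∀ i, f (H.e i) = v i := by
  choose c hc using H.exists_coord
  have key : ∀ a b : H.ι → PolyRing V, ∑ i, a i • H.e i = ∑ i, b i • H.e i →
      ∑ i, a i • v i = ∑ i, b i • v i := by
    intro a b hab
    rw [← sub_eq_zero, ← Finset.sum_sub_distrib] at hab ⊢
    simp only [← sub_smul] at hab ⊢
    exact Finset.sum_eq_zero fun i _ => hN _ (H.ind _ hab i) _
  refine ⟨{ toFun := fun x => ∑ i, c x i • v i, map_add' := ?_, map_smul' := ?_ }, ?_⟩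
  · intro x y
    rw [← Finset.sum_add_distrib]
    simp only [← add_smul]
    apply key
    simp only [add_smul, Finset.sum_add_distrib, ← hc]
  · intro a x
    rw [Finset.smul_sum]
    simp only [smul_smul]
    apply key
    simp only [mul_smul, ← Finset.smul_sum, ← hc, RingHom.id_apply]
  · intro i
    change ∑ j, c (H.e i) j • v j = v i
    have := key (c (H.e i)) (Pi.single i 1) (by rw [← hc]; simp [Pi.single_apply, ite_smul])
    rw [this]; simp [Pi.single_apply, ite_smul]

lemma HB.hom_ext {I : Ideal (PolyRing V)} {M : GAMod V} (H : HB I M) {N : Type*} [AddCommGroup N]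
    [Module (PolyRing V) N] {f g : M.M →ₗ[PolyRing V] N} (h : ∀ i, f (H.e i) = g (H.e i)) : f = g := by
  apply LinearMap.ext_on H.span
  rintro _ ⟨i, rfl⟩; exact h i

lemma HB.torsion_free {σ : Cone V} {M : GAMod V} (H : HB (vanishingIdeal V σ.carrier) M) {p : PolyRing V}
    (hp : p ∉ vanishingIdeal V σ.carrier) {x : M.M} (hx : p • x = 0) : x = 0 := by
  obtain ⟨a, rfl⟩ := H.exists_coord x
  rw [Finset.smul_sum] at hx
  simp only [smul_smul] at hx
  exact Finset.sum_eq_zero fun i _ => H.kill _ (vI_prime σ (H.ind _ hx i) hp) _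

lemma nice_kill {Δ : Fan V} {F : FanSheaf Δ} (hF : Nice F) (σ : Δ.cones) {a : PolyRing V}
    (ha : a ∈ vanishingIdeal V σ.1.carrier) (x : (F.stalk σ).M) : a • x = 0 := (hF.hb σ).some.kill a ha x

lemma nice_bdd {Δ : Fan V} {F : FanSheaf Δ} (hF : Nice F) (n : ℕ) : ∀ (σ : Δ.cones), σ.1.dim = n → ∀ q : ℤ,
    q < 0 → (F.stalk σ).deg q = ⊥ := by
  induction n using Nat.strong_induction_on with
  | _ n ih =>
    intro σ hσ
    by_cases h0 : σ.1 = zeroCone V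
    · have : σ = Δ.ozero := Subtype.ext h0
      subst this
      intro q hq
      exact hF.condN.2.2 q (by omega)
    · obtain ⟨q0, hq0⟩ := (hF.hb σ).some.bdd
      have key : ∀ m : ℕ, ∀ q : ℤ, q < 0 → q < q0 + m → (F.stalk σ).deg q = ⊥ := by
        intro m
        induction m with
        | zero => intro q _ hq; exact hq0 q (by simpa using hq)
        | succ m ihm =>
          intro q hq hqm
          rw [eq_bot_iff]
          intro x hx
          have hK : x ∈ LinearMap.ker (F.bdRes σ) := by
            rw [ker_bdRes]
            intro τ h
            have h1 := (F.res σ τ (facet_face h)).deg_mem q x hx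
            rw [ih _ (hσ ▸ proper_dim_lt (facet_proper h)) τ rfl q hq] at h1
            exact h1
          have h1 := pr_mSub _ (hF.ker σ h0 hK) q
          rw [pr_self _ hx] at h1
          refine (Submodule.span_le.2 ?_) h1
          rintro _ ⟨f, z, hz, rfl⟩
          rw [ihm (q - 2) (by omega) (by push_cast at hqm; omega)] at hz
          rw [(Submodule.mem_bot ℝ).1 hz, smul_zero]; exact zero_mem _
      intro q hq
      refine key (q - q0 + 1).toNat q hq ?_
      have := Int.self_le_toNat (q - q0 + 1)
      omega

end flab

end

section
/-! ### Part D: relative projectivity -/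
section relproj
variable {R : Type} [CommRing R]

def RelProj (I : Ideal R) (M : Type) [AddCommGroup M] [Module R M] : Prop :=
  (∀ a ∈ I, ∀ x : M, a • x = 0) ∧
  ∀ (N N' : Type) [AddCommGroup N] [Module R N] [AddCommGroup N'] [Module R N'] (g : N →ₗ[R] N'),
    Surjective g → (∀ a ∈ I, ∀ x : N, a • x = 0) → ∀ f : M →ₗ[R] N', ∃ f' : M →ₗ[R] N, ∀ x, g (f' x) = f x

lemma RelProj.of_equiv {I : Ideal R} {M M' : Type} [AddCommGroup M] [Module R M] [AddCommGroup M'] [Module R M']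
    (h : RelProj I M) (e : M ≃ₗ[R] M') : RelProj I M' := by
  refine ⟨fun a ha x => ?_, fun N N' _ _ _ _ g hg hN f => ?_⟩
  · apply e.symm.injective
    rw [map_smul, map_zero]; exact h.1 a ha _
  · obtain ⟨f', hf'⟩ := h.2 N N' g hg hN (f ∘ₗ e.toLinearMap)
    refine ⟨f' ∘ₗ e.symm.toLinearMap, fun x => ?_⟩
    rw [LinearMap.comp_apply, hf']; simp

lemma n_lemma {I J : Ideal R} (n : R) (hJ : ∀ j ∈ J, ∃ i ∈ I, ∃ r, j = i + r * n) (hnJ : n ∈ J)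
    {P M L : Type} [AddCommGroup P] [Module R P] [AddCommGroup M] [Module R M] [AddCommGroup L] [Module R L]
    (hP : RelProj I P) (hM : RelProj J M) (hn : ∀ x : P, n • x = 0 → x = 0)
    (f : P →ₗ[R] M) (hf : Surjective f) (j : L →ₗ[R] P) (hj : Injective j)
    (hex : ∀ p, f p = 0 ↔ ∃ l, j l = p) : RelProj I L := by
  have hLI : ∀ a ∈ I, ∀ x : L, a • x = 0 := fun a ha x => by
    apply hj; rw [map_smul, map_zero]; exact hP.1 a ha _
  let nP : P →ₗ[R] P := LinearMap.lsmul R P n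
  have hnP : ∀ x, nP x = n • x := fun x => rfl
  let N0 : Submodule R P := LinearMap.range nP
  let fb : (P ⧸ N0) →ₗ[R] M := N0.liftQ f (by
    rintro _ ⟨x, rfl⟩
    rw [LinearMap.mem_ker, hnP, map_smul]; exact hM.1 n hnJ _)
  have hfb : ∀ x, fb (N0.mkQ x) = f x := fun x => rfl
  obtain ⟨s, hs⟩ := hM.2 (P ⧸ N0) M fb (fun m => by
      obtain ⟨x, rfl⟩ := hf m; exact ⟨N0.mkQ x, rfl⟩) (by
      intro a ha x
      obtain ⟨x, rfl⟩ := Submodule.mkQ_surjective _ x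
      obtain ⟨i, hi, r, rfl⟩ := hJ a ha
      rw [← map_smul, add_smul, hP.1 i hi, zero_add, mul_comm, mul_smul]
      exact (Submodule.Quotient.mk_eq_zero _).2 ⟨r • x, rfl⟩) LinearMap.id
  let Q : Submodule R (P ⧸ N0) := LinearMap.ker fb
  let ρ : P →ₗ[R] Q := LinearMap.codRestrict Q (N0.mkQ - s ∘ₗ f) (by
    intro x
    rw [LinearMap.mem_ker, LinearMap.sub_apply, map_sub, LinearMap.comp_apply, hs, hfb]; simp)
  let κ : L →ₗ[R] Q := LinearMap.codRestrict Q (N0.mkQ ∘ₗ j) (by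
    intro x
    rw [LinearMap.mem_ker, LinearMap.comp_apply, hfb]; exact (hex _).2 ⟨x, rfl⟩)
  have hκ : Surjective κ := by
    rintro ⟨y, hy⟩
    obtain ⟨x, rfl⟩ := Submodule.mkQ_surjective _ y
    obtain ⟨l, rfl⟩ := (hex x).1 hy
    exact ⟨l, rfl⟩
  obtain ⟨r, hr⟩ := hP.2 L Q κ hκ hLI ρ
  have ht : ∀ x : L, ∃ t : P, j x = j (r (j x)) + n • t := by
    intro x
    have h1 := congrArg Subtype.val (hr (j x))
    have h2 : N0.mkQ (j (r (j x))) = N0.mkQ (j x) - s (f (j x)) := h1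
    rw [(hex _).2 ⟨x, rfl⟩, map_zero, sub_zero] at h2
    obtain ⟨t, ht⟩ := (Submodule.Quotient.eq N0).1 h2.symm
    exact ⟨t, by rw [← hnP, ht]; abel⟩
  choose t ht using ht
  have hinj : ∀ x y : P, n • x = n • y → x = y := by
    intro x y hxy
    rw [← sub_eq_zero]; apply hn; rw [smul_sub, hxy, sub_self]
  let T : L →ₗ[R] P :=
    { toFun := t
      map_add' := fun x y => hinj _ _ (by
        have h1 := ht (x + y)
        simp only [map_add] at h1
        rw [ht x, ht y] at h1
        simp only [map_add] at h1
        rw [smul_add]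
        have h2 := ht x
        have h3 := ht y
        have e1 : n • t x = j x - j (r (j x)) := by rw [eq_sub_iff_add_eq, add_comm]; exact h2.symm
        have e2 : n • t y = j y - j (r (j y)) := by rw [eq_sub_iff_add_eq, add_comm]; exact h3.symm
        have e3 : n • t (x + y) = j (x + y) - j (r (j (x + y))) := by
          rw [eq_sub_iff_add_eq, add_comm]; exact (ht (x + y)).symm
        rw [e1, e2, e3]; simp only [map_add]; abel)
      map_smul' := fun a x => hinj _ _ (by
        have h2 := ht x
        have e1 : n • t x = j x - j (r (j x)) := by rw [eq_sub_iff_add_eq, add_comm]; exact h2.symm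
        have e3 : n • t (a • x) = j (a • x) - j (r (j (a • x))) := by
          rw [eq_sub_iff_add_eq, add_comm]; exact (ht (a • x)).symm
        rw [e3, RingHom.id_apply, smul_comm, e1]; simp only [map_smul, smul_sub]) }
  refine ⟨hLI, fun N N' _ _ _ _ g hg hN φ => ?_⟩
  -- multiplication by n lands in L
  have hnL : ∀ p : P, ∃ l : L, j l = n • p := fun p => by
    apply (hex _).1; rw [map_smul]; exact hM.1 n hnJ _
  choose ν hν using hnL
  let Nu : P →ₗ[R] L :=
    { toFun := ν
      map_add' := fun x y => hj (by rw [map_add, hν, hν, hν, smul_add])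
      map_smul' := fun a x => hj (by rw [RingHom.id_apply, map_smul, hν, hν, smul_comm]) }
  obtain ⟨r', hr'⟩ := hP.2 N N' g hg hN (φ ∘ₗ r)
  obtain ⟨n', hn'⟩ := hP.2 N N' g hg hN (φ ∘ₗ Nu)
  refine ⟨r' ∘ₗ j + n' ∘ₗ T, fun x => ?_⟩
  rw [LinearMap.add_apply, map_add, LinearMap.comp_apply, LinearMap.comp_apply, hr', hn',
    LinearMap.comp_apply, LinearMap.comp_apply, ← map_add]
  congr 1
  apply hj
  rw [map_add]
  change j (r (j x)) + j (ν (t x)) = j x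
  rw [hν, ← ht]

lemma dual_basis {I : Ideal R} {K : Type} [AddCommGroup K] [Module R K] (hK : RelProj I K)
    [Module.Finite R K] : ∃ (n : ℕ) (k : Fin n → K) (c : Fin n → (K →ₗ[R] R ⧸ I)),
      (∀ (ψ : K →ₗ[R] R ⧸ I) (x : K), ψ x = ∑ i, c i x * ψ (k i)) ∧
      ∀ x, (∀ i, c i x = 0) → x = 0 := by
  obtain ⟨n, k, hk⟩ := Module.Finite.exists_fin (R := R) (M := K)
  let G : Fin n → ((R ⧸ I) →ₗ[R] K) := fun i =>
    Submodule.liftQ I (LinearMap.toSpanSingleton R K (k i)) (fun a ha => by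
      rw [LinearMap.mem_ker, LinearMap.toSpanSingleton_apply]; exact hK.1 a ha _)
  have hG : ∀ i a, G i (Ideal.Quotient.mk I a) = a • k i := fun i a => rfl
  let g : (Fin n → R ⧸ I) →ₗ[R] K := ∑ i, G i ∘ₗ LinearMap.proj i
  have hg : ∀ y, g y = ∑ i, G i (y i) := fun y => by simp [g]
  obtain ⟨c, hc⟩ := hK.2 (Fin n → R ⧸ I) K g (by
      intro x
      have hx : x ∈ Submodule.span R (Set.range k) := by rw [hk]; trivial
      obtain ⟨a, ha⟩ := (Submodule.mem_span_range_iff_exists_fun _).1 hx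
      refine ⟨fun i => Ideal.Quotient.mk I (a i), ?_⟩
      rw [hg, ← ha]; rfl) (by
      intro a ha x
      funext i
      obtain ⟨b, hb⟩ := Ideal.Quotient.mk_surjective (x i)
      rw [Pi.smul_apply, ← hb, Pi.zero_apply]
      change Ideal.Quotient.mk I (a * b) = 0
      exact Ideal.Quotient.eq_zero_iff_mem.2 (I.mul_mem_right _ ha)) LinearMap.id
  refine ⟨n, k, fun i => LinearMap.proj i ∘ₗ c, fun ψ x => ?_, fun x hx => ?_⟩
  · conv_lhs => rw [← LinearMap.id_apply (R := R) (x := x), ← hc x, hg, map_sum]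
    refine Finset.sum_congr rfl fun i _ => ?_
    rw [LinearMap.comp_apply, LinearMap.proj_apply]
    obtain ⟨b, hb⟩ := Ideal.Quotient.mk_surjective (c x i)
    rw [← hb, hG, map_smul]; rfl
  · have h : c x = 0 := funext hx
    have := hc x
    rw [h, map_zero] at this
    exact this.symm

end relproj
section kproj
variable {V : Type} [AddCommGroup V] [Module ℝ V] [FiniteDimensional ℝ V]

/-- elements vanishing on a set of facets -/
def KT {Δ : Fan V} (F : FanSheaf Δ) (σ : Δ.cones) (T : Finset (Cone V)) : Submodule (PolyRing V) (F.stalk σ).M where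
  carrier := {x | ∀ τ : Δ.cones, ∀ h : τ.1 ∈ facets σ.1, τ.1 ∈ T → (F.res σ τ (facet_face h)).toLin x = 0}
  add_mem' := fun ha hb τ h hT => by rw [map_add, ha τ h hT, hb τ h hT, add_zero]
  zero_mem' := fun τ h hT => map_zero _
  smul_mem' := fun a x hx τ h hT => by rw [map_smul, hx τ h hT, smul_zero]

lemma mem_KT {Δ : Fan V} {F : FanSheaf Δ} {σ : Δ.cones} {T : Finset (Cone V)} {x : (F.stalk σ).M} :
    x ∈ KT F σ T ↔ ∀ τ : Δ.cones, ∀ h : τ.1 ∈ facets σ.1, τ.1 ∈ T → (F.res σ τ (facet_face h)).toLin x = 0 :=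
  Iff.rfl

lemma HB.relProj {I : Ideal (PolyRing V)} {M : GAMod V} (H : HB I M) : RelProj I M.M := by
  refine ⟨H.kill, fun N N' _ _ _ _ g hg hN f => ?_⟩
  choose v hv using fun i => hg (f (H.e i))
  obtain ⟨f', hf'⟩ := H.lift_hom hN v
  refine ⟨f', fun x => ?_⟩
  have : g ∘ₗ f' = f := H.hom_ext fun i => by rw [LinearMap.comp_apply, hf', hv]
  rw [← this]; rfl

lemma nrm_notMem {γ τ : Cone V} (h : γ ∈ facets τ) : lin (nrm τ γ) ∉ vanishingIdeal V τ.carrier := by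
  rw [mem_vI_cone]
  intro h'
  have := h' _ (nvec_mem h)
  rw [lin_apply, nrm_nvec h] at this
  exact one_ne_zero this

lemma nrm_memI {γ τ : Cone V} (h : γ ∈ facets τ) : lin (nrm τ γ) ∈ vanishingIdeal V γ.carrier := by
  rw [mem_vI_cone]
  intro x hx; exact nrm_zero h x hx

lemma vI_mono {γ τ : Cone V} (h : γ.IsFaceOf τ) : vanishingIdeal V τ.carrier ≤ vanishingIdeal V γ.carrier := by
  intro p hp
  rw [mem_vI] at *
  exact fun x hx => hp x (face_sub h hx)

lemma facet_ideal {γ τ : Cone V} (h : γ ∈ facets τ) {p : PolyRing V} (hp : p ∈ vanishingIdeal V γ.carrier) :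
    ∃ i ∈ vanishingIdeal V τ.carrier, ∃ r, p = i + r * lin (nrm τ γ) := by
  rw [mem_vI_cone] at hp
  obtain ⟨q, hq⟩ := div_lin_on τ.spanC (nrm τ γ) (nrm_ne h) p (fun x hx h0 => hp x (mem_facet_span h hx h0))
  refine ⟨p - q * lin (nrm τ γ), ?_, q, by ring⟩
  rw [mem_vI_cone]
  intro x hx
  rw [sub_ap, mul_ap, hq x hx, lin_apply]; ring

lemma facet_form_ne {τ τ' σ : Cone V} (h : τ ∈ facets σ) (h' : τ' ∈ facets σ) (hne : τ ≠ τ') :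
    ∃ x ∈ τ.spanC, nrm σ τ' x ≠ 0 := by
  by_contra hcon
  push Not at hcon
  exact hne (facet_eq_of_span_le h h' fun x hx => mem_facet_span h' (facet_span_le h hx) (hcon x hx))

lemma kt_proj {Δ : Fan V} {F : FanSheaf Δ} (hF : Nice F) (n : ℕ) : ∀ (σ : Δ.cones) (_ : σ.1.dim = n)
    (v : V) (_ : v ∈ σ.1.spanC) (_ : ∀ τ ∈ facets σ.1, nrm σ.1 τ v ≠ 0),
    RelProj (vanishingIdeal V σ.1.carrier) (KT F σ ((facets σ.1).filter fun τ => 0 < nrm σ.1 τ v)) := by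
  induction n using Nat.strong_induction_on with
  | _ n ih =>
  intro σ hσ v hv hgen
  obtain ⟨l, hl, hlpos⟩ := exists_interior σ.1
  obtain ⟨w, hw, hwg, hwpos⟩ := generic_interior σ.1.spanC ((facets σ.1 ×ˢ facets σ.1).filter fun p => p.1 ≠ p.2)
    (fun p => nrm σ.1 p.1 v • nrm σ.1 p.2 - nrm σ.1 p.2 v • nrm σ.1 p.1) (by
      rintro ⟨τ, τ'⟩ hp
      simp only [Finset.mem_filter, Finset.mem_product] at hp
      obtain ⟨x, hx, h0⟩ := facet_form_ne hp.1.1 hp.1.2 hp.2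
      refine ⟨x, facet_span_le hp.1.1 hx, ?_⟩
      simp only [LinearMap.sub_apply, LinearMap.smul_apply, nrm_zero hp.1.1 x hx, smul_eq_mul, mul_zero, sub_zero]
      exact mul_ne_zero (hgen τ hp.1.1) h0) (facets σ.1) (nrm σ.1) l (carrier_sub_span _ hl) hlpos
  have hwg' : ∀ τ ∈ facets σ.1, ∀ τ' ∈ facets σ.1, τ ≠ τ' →
      nrm σ.1 τ v * nrm σ.1 τ' w ≠ nrm σ.1 τ' v * nrm σ.1 τ w := by
    intro τ h τ' h' hne heq
    have := hwg (τ, τ') (by simp [h, h', hne])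
    simp only [LinearMap.sub_apply, LinearMap.smul_apply, smul_eq_mul] at this
    exact this (sub_eq_zero.2 heq)
  set T0 := (facets σ.1).filter fun τ => 0 < nrm σ.1 τ v with hT0
  let lam : Cone V → ℝ := fun τ => nrm σ.1 τ w / nrm σ.1 τ v
  have key : ∀ m : ℕ, ∀ T ⊆ T0, (∀ τ ∈ T, ∀ τ' ∈ T0, lam τ' ≤ lam τ → τ' ∈ T) → T.card = m →
      RelProj (vanishingIdeal V σ.1.carrier) (KT F σ T) := by
    intro m
    induction m with
    | zero =>
      intro T _ _ hc
      rw [Finset.card_eq_zero] at hc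
      subst hc
      have : KT F σ ∅ = ⊤ := by
        rw [eq_top_iff]; intro x _ τ h hT; exact absurd hT (Finset.notMem_empty _)
      rw [this]
      exact (hF.hb σ).some.relProj.of_equiv Submodule.topEquiv.symm
    | succ m ihm =>
      intro T hTT0 hlow hc
      have hTne : T.Nonempty := by rw [← Finset.card_pos]; omega
      obtain ⟨a, haT, hamax⟩ := Finset.exists_max_image T lam hTne
      have haT0 := hTT0 haT
      obtain ⟨haf, hav⟩ := Finset.mem_filter.1 (hT0 ▸ haT0)
      set T' := T.erase a with hT'
      have hlam : ∀ τ ∈ T0, τ ≠ a → lam τ ≠ lam a := by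
        intro τ hτ hne he
        obtain ⟨hτf, hτv⟩ := Finset.mem_filter.1 (hT0 ▸ hτ)
        simp only [lam] at he
        rw [div_eq_div_iff hτv.ne' hav.ne'] at he
        exact hwg' a haf τ hτf (Ne.symm hne) (by linarith)
      have hP := ihm T' ((Finset.erase_subset _ _).trans hTT0) (by
        intro τ hτ τ' hτ' hle
        have hτT := Finset.mem_of_mem_erase hτ
        refine Finset.mem_erase.2 ⟨?_, hlow τ hτT τ' hτ' hle⟩
        rintro rfl
        exact hlam τ (hTT0 hτT) (Finset.ne_of_mem_erase hτ) (le_antisymm (hamax τ hτT) hle))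
        (by rw [hT', Finset.card_erase_of_mem haT]; omega)
      -- the vector in the span of a
      set u := w - lam a • v with hu
      have hnu : ∀ τ, nrm σ.1 τ u = nrm σ.1 τ w - lam a * nrm σ.1 τ v := by
        intro τ; rw [hu, map_sub, map_smul, smul_eq_mul]
      have hua : nrm σ.1 a u = 0 := by
        rw [hnu]; simp only [lam]; field_simp; ring
      have huS : u ∈ σ.1.spanC := Submodule.sub_mem _ hw (Submodule.smul_mem _ _ hv)
      have huA : u ∈ a.spanC := mem_facet_span haf huS hua
      let α : Δ.cones := ⟨a, Δ.face_mem _ σ.2 _ (facet_face haf)⟩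
      have hlapos : 0 < lam a := div_pos (hwpos a haf) hav
      have hne0 : ∀ ρ ∈ facets σ.1, ρ ≠ a → nrm σ.1 ρ u ≠ 0 := by
        intro ρ hρ hne h0
        rw [hnu] at h0
        simp only [lam] at h0
        field_simp at h0
        exact hwg' a haf ρ hρ (Ne.symm hne) (by linarith)
      have hM := ih a.dim (hσ ▸ proper_dim_lt (facet_proper haf)) α rfl (-u) (Submodule.neg_mem _ huA) (by
        intro γ hγ h0
        obtain ⟨ρ, hρ, hρne, hγρ⟩ := diamond_exists haf hγ
        obtain ⟨-, e⟩ := adj_pos haf hρ hρne hγ (facet_face hγρ)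
        apply hne0 ρ hρ hρne
        rw [map_neg, neg_eq_zero] at h0
        change nrm a γ u = 0 at h0
        rw [e u huA, h0, mul_zero])
      set U := (facets α.1).filter fun γ => 0 < nrm α.1 γ (-u) with hU
      have hmemU : ∀ γ, γ ∈ U ↔ γ ∈ facets a ∧ nrm a γ u < 0 := by
        intro γ
        rw [hU, Finset.mem_filter, map_neg, neg_pos]
      -- facets in T' are negative on u
      have hT'neg : ∀ ρ ∈ T', ρ ∈ facets σ.1 ∧ nrm σ.1 ρ u < 0 := by
        intro ρ hρ
        have hρT := Finset.mem_of_mem_erase hρ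
        obtain ⟨hρf, hρv⟩ := Finset.mem_filter.1 (hT0 ▸ hTT0 hρT)
        refine ⟨hρf, lt_of_le_of_ne ?_ (hne0 ρ hρf (Finset.ne_of_mem_erase hρ))⟩
        have := hamax ρ hρT
        rw [hnu]
        have h2 : nrm σ.1 ρ w = lam ρ * nrm σ.1 ρ v := by simp only [lam]; field_simp
        rw [h2, sub_nonpos]
        exact mul_le_mul_of_nonneg_right this hρv.le
      -- restriction map
      have hrange : ∀ x ∈ KT F σ T', (F.res σ α (facet_face haf)).toLin x ∈ KT F α U := by
        intro x hx γ hγ hγU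
        obtain ⟨ρ, hρ, hρne, hγρ⟩ := diamond_exists haf hγ
        obtain ⟨p, e⟩ := adj_pos haf hρ hρne hγ (facet_face hγρ)
        have h1 : nrm σ.1 ρ u < 0 := by
          rw [e u huA]; exact mul_neg_of_pos_of_neg p ((hmemU _).1 hγU).2
        have h2 := hnu ρ
        have h3 : 0 < nrm σ.1 ρ v := by
          by_contra hcon
          push Not at hcon
          have := hwpos ρ hρ
          nlinarith
        have hρT0 : ρ ∈ T0 := by rw [hT0, Finset.mem_filter]; exact ⟨hρ, h3⟩
        have hρT' : ρ ∈ T' := by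
          refine Finset.mem_erase.2 ⟨hρne, hlow a haT ρ hρT0 ?_⟩
          simp only [lam]
          rw [div_le_iff₀ h3]
          change nrm σ.1 ρ w ≤ lam a * nrm σ.1 ρ v
          linarith
        have h4 := hx ⟨ρ, Δ.face_mem _ σ.2 _ (facet_face hρ)⟩ hρ hρT'
        have hγσ : Cone.IsFaceOf γ.1 σ.1 := face_trans (facet_face hγ) (facet_face haf)
        rw [res_res F (facet_face haf) (facet_face hγ) hγσ,
          ← res_res F (τ := ⟨ρ, Δ.face_mem _ σ.2 _ (facet_face hρ)⟩) (facet_face hρ) (facet_face hγρ) hγσ, h4, map_zero]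
      let f : KT F σ T' →ₗ[PolyRing V] KT F α U :=
        LinearMap.codRestrict _ ((F.res σ α (facet_face haf)).toLin ∘ₗ (KT F σ T').subtype) (fun x => hrange x.1 x.2)
      have hf : Surjective f := by
        rintro ⟨z, hz⟩
        have := extend_zero hF σ α (facet_face haf) {ρ | ρ.1 ∈ T'} (fun ρ hρ => facet_face (hT'neg ρ.1 hρ).1) z ?_
        · obtain ⟨x, hx, hx0⟩ := this
          exact ⟨⟨x, fun τ h hT => hx0 τ hT _⟩, Subtype.ext hx⟩
        · intro ρ hρ δ hδρ hδa
          obtain ⟨hρf, hρu⟩ := hT'neg ρ.1 hρ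
          obtain ⟨c, hc, hsum, hface⟩ := farkas a (nrm σ.1 ρ.1) (fun x hx => nrm_nonneg hρf x (face_sub (facet_face haf) hx))
          obtain ⟨γ, hγ, hcγ, hγu⟩ : ∃ γ ∈ facets a, c γ ≠ 0 ∧ nrm a γ u < 0 := by
            by_contra hcon
            push Not at hcon
            rw [hsum u huA] at hρu
            refine absurd hρu (not_lt.2 (Finset.sum_nonneg fun γ hγ => ?_))
            by_cases h0 : c γ = 0
            · rw [h0, zero_mul]
            · exact mul_nonneg (hc γ) (hcon γ hγ h0)
          have hδγ : Cone.IsFaceOf δ.1 γ := by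
            refine face_of_sub hδa (facet_face hγ) fun x hx => ?_
            refine hface γ hγ hcγ x (face_sub hδa hx) ?_
            exact nrm_zero hρf x (carrier_sub_span _ (face_sub hδρ hx))
          have h4 := hz ⟨γ, Δ.face_mem _ α.2 _ (facet_face hγ)⟩ hγ ((hmemU _).2 ⟨hγ, hγu⟩)
          rw [← res_res F (τ := ⟨γ, Δ.face_mem _ α.2 _ (facet_face hγ)⟩) (facet_face hγ) hδγ hδa, h4, map_zero]
      have hsub : KT F σ T ≤ KT F σ T' := fun x hx τ h hT => hx τ h (Finset.mem_of_mem_erase hT)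
      refine n_lemma (lin (nrm σ.1 a)) (fun j hj => facet_ideal haf hj) (nrm_memI haf) hP hM ?_ f hf
        (Submodule.inclusion hsub) (Submodule.inclusion_injective hsub) ?_
      · intro x hx
        apply Subtype.ext
        exact (hF.hb σ).some.torsion_free (nrm_notMem haf) (congrArg Subtype.val hx)
      · intro p
        constructor
        · intro hp
          refine ⟨⟨p.1, fun τ h hT => ?_⟩, Subtype.ext rfl⟩
          by_cases hτa : τ.1 = a
          · have : τ = α := Subtype.ext hτa
            subst this
            exact congrArg Subtype.val hp
          · exact p.2 τ h (Finset.mem_erase.2 ⟨hτa, hT⟩)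
        · rintro ⟨l, rfl⟩
          exact Subtype.ext (l.2 α haf haT)
  exact key _ T0 (Finset.Subset.refl _) (fun _ _ τ' h _ => h) rfl

lemma K_eq {Δ : Fan V} (F : FanSheaf Δ) (σ : Δ.cones) :
    LinearMap.ker (F.bdRes σ) = KT F σ (facets σ.1) := by
  ext x
  rw [ker_bdRes, mem_KT]
  exact ⟨fun h τ hτ _ => h τ hτ, fun h τ hτ => h τ hτ hτ⟩

lemma K_proj {Δ : Fan V} {F : FanSheaf Δ} (hF : Nice F) (σ : Δ.cones) :
    RelProj (vanishingIdeal V σ.1.carrier) (KT F σ (facets σ.1)) := by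
  obtain ⟨l, hl, hlpos⟩ := exists_interior σ.1
  have := kt_proj hF _ σ rfl l (carrier_sub_span _ hl) (fun τ h => (hlpos τ h).ne')
  rwa [Finset.filter_true_of_mem hlpos] at this

lemma K_finite {Δ : Fan V} {F : FanSheaf Δ} (hF : Nice F) (σ : Δ.cones) (T : Finset (Cone V)) :
    Module.Finite (PolyRing V) (KT F σ T) := by
  have := (hF.hb σ).some.finite
  have : IsNoetherian (PolyRing V) (F.stalk σ).M := inferInstance
  infer_instance

end kproj

end

section
/-! ### Part E0: gluing along a shelling -/
section glue
variable {V : Type} [AddCommGroup V] [Module ℝ V] [FiniteDimensional ℝ V]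

lemma glue {Δ : Fan V} {F : FanSheaf Δ} (hF : Nice F) (σ : Δ.cones)
    (y : ∀ τ : Δ.cones, (F.stalk τ).M)
    (hy : ∀ τ τ' γ : Δ.cones, τ.1 ∈ facets σ.1 → τ'.1 ∈ facets σ.1 → τ ≠ τ' →
      ∀ (h : γ.1 ∈ facets τ.1) (h' : γ.1 ∈ facets τ'.1),
        (F.res τ γ (facet_face h)).toLin (y τ) = (F.res τ' γ (facet_face h')).toLin (y τ')) :
    ∃ x : (F.stalk σ).M, ∀ τ : Δ.cones, ∀ h : τ.1 ∈ facets σ.1, (F.res σ τ (facet_face h)).toLin x = y τ := by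
  obtain ⟨v, hv', hgen⟩ := exists_interior σ.1
  have hv := carrier_sub_span _ hv'
  obtain ⟨w, hw, hwg, hwpos⟩ := generic_interior σ.1.spanC ((facets σ.1 ×ˢ facets σ.1).filter fun p => p.1 ≠ p.2)
    (fun p => nrm σ.1 p.1 v • nrm σ.1 p.2 - nrm σ.1 p.2 v • nrm σ.1 p.1) (by
      rintro ⟨τ, τ'⟩ hp
      simp only [Finset.mem_filter, Finset.mem_product] at hp
      obtain ⟨x, hx, h0⟩ := facet_form_ne hp.1.1 hp.1.2 hp.2
      refine ⟨x, facet_span_le hp.1.1 hx, ?_⟩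
      simp only [LinearMap.sub_apply, LinearMap.smul_apply, nrm_zero hp.1.1 x hx, smul_eq_mul, mul_zero, sub_zero]
      exact mul_ne_zero (hgen τ hp.1.1).ne' h0) (facets σ.1) (nrm σ.1) v hv hgen
  have hwg' : ∀ τ ∈ facets σ.1, ∀ τ' ∈ facets σ.1, τ ≠ τ' →
      nrm σ.1 τ v * nrm σ.1 τ' w ≠ nrm σ.1 τ' v * nrm σ.1 τ w := by
    intro τ h τ' h' hne heq
    have := hwg (τ, τ') (by simp [h, h', hne])
    simp only [LinearMap.sub_apply, LinearMap.smul_apply, smul_eq_mul] at this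
    exact this (sub_eq_zero.2 heq)
  let lam : Cone V → ℝ := fun τ => nrm σ.1 τ w / nrm σ.1 τ v
  have key : ∀ m : ℕ, ∀ T ⊆ facets σ.1, (∀ τ ∈ T, ∀ τ' ∈ facets σ.1, lam τ' ≤ lam τ → τ' ∈ T) → T.card = m →
      ∃ x : (F.stalk σ).M, ∀ τ : Δ.cones, ∀ h : τ.1 ∈ facets σ.1, τ.1 ∈ T →
        (F.res σ τ (facet_face h)).toLin x = y τ := by
    intro m
    induction m with
    | zero =>
      intro T _ _ hc
      rw [Finset.card_eq_zero] at hc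
      subst hc
      exact ⟨0, fun τ h hT => absurd hT (Finset.notMem_empty _)⟩
    | succ m ihm =>
      intro T hTT0 hlow hc
      have hTne : T.Nonempty := by rw [← Finset.card_pos]; omega
      obtain ⟨a, haT, hamax⟩ := Finset.exists_max_image T lam hTne
      have haf := hTT0 haT
      have hav := hgen a haf
      set T' := T.erase a with hT'
      have hlam : ∀ τ ∈ facets σ.1, τ ≠ a → lam τ ≠ lam a := by
        intro τ hτf hne he
        have hτv := hgen τ hτf
        simp only [lam] at he
        rw [div_eq_div_iff hτv.ne' hav.ne'] at he
        exact hwg' a haf τ hτf (Ne.symm hne) (by linarith)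
      obtain ⟨x0, hx0⟩ := ihm T' ((Finset.erase_subset _ _).trans hTT0) (by
        intro τ hτ τ' hτ' hle
        have hτT := Finset.mem_of_mem_erase hτ
        refine Finset.mem_erase.2 ⟨?_, hlow τ hτT τ' hτ' hle⟩
        rintro rfl
        exact hlam τ (hTT0 hτT) (Finset.ne_of_mem_erase hτ) (le_antisymm (hamax τ hτT) hle))
        (by rw [hT', Finset.card_erase_of_mem haT]; omega)
      set u := w - lam a • v with hu
      have hnu : ∀ τ, nrm σ.1 τ u = nrm σ.1 τ w - lam a * nrm σ.1 τ v := by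
        intro τ; rw [hu, map_sub, map_smul, smul_eq_mul]
      have hua : nrm σ.1 a u = 0 := by
        rw [hnu]; simp only [lam]; field_simp; ring
      have huS : u ∈ σ.1.spanC := Submodule.sub_mem _ hw (Submodule.smul_mem _ _ hv)
      have huA : u ∈ a.spanC := mem_facet_span haf huS hua
      let α : Δ.cones := ⟨a, Δ.face_mem _ σ.2 _ (facet_face haf)⟩
      have hne0 : ∀ ρ ∈ facets σ.1, ρ ≠ a → nrm σ.1 ρ u ≠ 0 := by
        intro ρ hρ hne h0
        rw [hnu] at h0
        simp only [lam] at h0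
        field_simp at h0
        exact hwg' a haf ρ hρ (Ne.symm hne) (by linarith)
      have hT'neg : ∀ ρ ∈ T', ρ ∈ facets σ.1 ∧ nrm σ.1 ρ u < 0 := by
        intro ρ hρ
        have hρT := Finset.mem_of_mem_erase hρ
        have hρf := hTT0 hρT
        have hρv := hgen ρ hρf
        refine ⟨hρf, lt_of_le_of_ne ?_ (hne0 ρ hρf (Finset.ne_of_mem_erase hρ))⟩
        have := hamax ρ hρT
        rw [hnu]
        have h2 : nrm σ.1 ρ w = lam ρ * nrm σ.1 ρ v := by simp only [lam]; field_simp
        rw [h2, sub_nonpos]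
        exact mul_le_mul_of_nonneg_right this hρv.le
      have := extend_zero hF σ α (facet_face haf) {ρ | ρ.1 ∈ T'} (fun ρ hρ => facet_face (hT'neg ρ.1 hρ).1)
        (y α - (F.res σ α (facet_face haf)).toLin x0) ?_
      · obtain ⟨x, hx, hxz⟩ := this
        refine ⟨x0 + x, fun τ h hT => ?_⟩
        by_cases hτa : τ.1 = a
        · have : τ = α := Subtype.ext hτa
          subst this
          rw [map_add, hx]; abel
        · have hT'' := Finset.mem_erase.2 ⟨hτa, hT⟩
          rw [map_add, hx0 τ h hT'', hxz τ hT'', add_zero]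
      · intro ρ hρ δ hδρ hδa
        obtain ⟨hρf, hρu⟩ := hT'neg ρ.1 hρ
        obtain ⟨c, hc, hsum, hface⟩ := farkas a (nrm σ.1 ρ.1) (fun x hx => nrm_nonneg hρf x (face_sub (facet_face haf) hx))
        obtain ⟨γ, hγ, hcγ, hγu⟩ : ∃ γ ∈ facets a, c γ ≠ 0 ∧ nrm a γ u < 0 := by
          by_contra hcon
          push Not at hcon
          rw [hsum u huA] at hρu
          refine absurd hρu (not_lt.2 (Finset.sum_nonneg fun γ hγ => ?_))
          by_cases h0 : c γ = 0
          · rw [h0, zero_mul]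
          · exact mul_nonneg (hc γ) (hcon γ hγ h0)
        have hδγ : Cone.IsFaceOf δ.1 γ := by
          refine face_of_sub hδa (facet_face hγ) fun x hx => ?_
          refine hface γ hγ hcγ x (face_sub hδa hx) ?_
          exact nrm_zero hρf x (carrier_sub_span _ (face_sub hδρ hx))
        let Γ : Δ.cones := ⟨γ, Δ.face_mem _ α.2 _ (facet_face hγ)⟩
        have hγσ : Cone.IsFaceOf γ σ.1 := face_trans (facet_face hγ) (facet_face haf)
        have h4 : (F.res α Γ (facet_face hγ)).toLin (y α - (F.res σ α (facet_face haf)).toLin x0) = 0 := by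
          obtain ⟨β, hβ, hβne, hγβ⟩ := diamond_exists haf hγ
          obtain ⟨p, e⟩ := adj_pos haf hβ hβne hγ (facet_face hγβ)
          have h1 : nrm σ.1 β u < 0 := by
            rw [e u huA]; exact mul_neg_of_pos_of_neg p hγu
          have h2 := hnu β
          have h3 := hgen β hβ
          have hβT' : β ∈ T' := by
            refine Finset.mem_erase.2 ⟨hβne, hlow a haT β hβ ?_⟩
            simp only [lam]
            rw [div_le_iff₀ h3]
            change nrm σ.1 β w ≤ lam a * nrm σ.1 β v
            linarith
          let β' : Δ.cones := ⟨β, Δ.face_mem _ σ.2 _ (facet_face hβ)⟩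
          rw [map_sub, sub_eq_zero, res_res F (facet_face haf) (facet_face hγ) hγσ,
            ← res_res F (τ := β') (facet_face hβ) (facet_face hγβ) hγσ, hx0 β' hβ hβT']
          exact hy α β' Γ haf hβ (fun h => hβne (congrArg Subtype.val h).symm) hγ hγβ
        rw [← res_res F (τ := Γ) (facet_face hγ) hδγ hδa, h4, map_zero]
  obtain ⟨x, hx⟩ := key _ (facets σ.1) (Finset.Subset.refl _) (fun _ _ τ' h _ => h) rfl
  exact ⟨x, fun τ h => hx τ h h⟩

end glue

end

section
/-! ### Part E1: interpolation -/
section interp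
variable {V : Type} [AddCommGroup V] [Module ℝ V] 

lemma exists_div_prod {β : Type*} (W : Submodule ℝ V) (ℓ : β → V →ₗ[ℝ] ℝ) (S : PolyRing V) (Γ : Finset β) 
    (hpair : ∀ γ ∈ Γ, ∀ γ' ∈ Γ, γ ≠ γ' → ∃ w ∈ W, ℓ γ w = 0 ∧ ℓ γ' w ≠ 0)
    (hne : ∀ γ ∈ Γ, ∃ w ∈ W, ℓ γ w ≠ 0) (hS : ∀ γ ∈ Γ, ∀ w ∈ W, ℓ γ w = 0 → S.1 w = 0) :
    ∃ N : PolyRing V, ∀ w ∈ W, S.1 w = (∏ γ ∈ Γ, ℓ γ w) * N.1 w := by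
  induction Γ using Finset.induction_on with
  | empty => exact ⟨S, fun w _ => by simp⟩
  | insert a Γ ha ih =>
    obtain ⟨N, hN⟩ := ih (fun γ h γ' h' => hpair γ (Finset.mem_insert_of_mem h) γ' (Finset.mem_insert_of_mem h'))
      (fun γ h => hne γ (Finset.mem_insert_of_mem h)) (fun γ h => hS γ (Finset.mem_insert_of_mem h))
    let W' : Submodule ℝ V := W ⊓ LinearMap.ker (ℓ a)
    have hc := cancel_on W' (∏ γ ∈ Γ, lin (ℓ γ)) N (by
      obtain ⟨x, hx, h⟩ := common_nonzero_prod W' Γ (fun γ => lin (ℓ γ)) (fun γ hγ => by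
        obtain ⟨w, hw, h1, h2⟩ := hpair a (Finset.mem_insert_self _ _) γ (Finset.mem_insert_of_mem hγ)
          (fun h => ha (h ▸ hγ))
        exact ⟨w, ⟨hw, h1⟩, h2⟩)
      refine ⟨x, hx, ?_⟩
      rw [prod_ap]; exact Finset.prod_ne_zero_iff.2 h) (by
      intro x hx
      rw [prod_ap]
      simp only [lin_apply]
      rw [← hN x hx.1]
      exact hS a (Finset.mem_insert_self _ _) x hx.1 hx.2)
    obtain ⟨q, hq⟩ := div_lin_on W (ℓ a) (hne a (Finset.mem_insert_self _ _)) N (fun x hx h0 => hc x ⟨hx, h0⟩)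
    refine ⟨q, fun w hw => ?_⟩
    rw [hN w hw, hq w hw, Finset.prod_insert ha]; ring

lemma interp {α β : Type*} (W : Submodule ℝ V) (T : Finset α) (n : α → V →ₗ[ℝ] ℝ) (v : V) (hv : v ∈ W)
    (hnv : ∀ τ ∈ T, n τ v ≠ 0) (Γ : Finset β) (Inc : α → Finset β) (hInc : ∀ τ ∈ T, Inc τ ⊆ Γ)
    (ℓ : β → V →ₗ[ℝ] ℝ) (hlv : ∀ γ ∈ Γ, ℓ γ v = 0) (g : α → β → V →ₗ[ℝ] ℝ) (ε : α → β → ℝ)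
    (hε : ∀ τ ∈ T, ∀ γ ∈ Inc τ, ε τ γ ≠ 0)
    (hg : ∀ τ ∈ T, ∀ γ ∈ Inc τ, ∀ w ∈ W, n τ w = 0 → g τ γ w = ε τ γ * ℓ γ w)
    (N : α → PolyRing V)
    (hridge : ∀ γ ∈ Γ, ∃ τ₁ ∈ T, ∃ τ₂ ∈ T, τ₁ ≠ τ₂ ∧ γ ∈ Inc τ₁ ∧ γ ∈ Inc τ₂ ∧
      (∀ τ ∈ T, γ ∈ Inc τ → τ = τ₁ ∨ τ = τ₂) ∧ ε τ₁ γ * n τ₁ v + ε τ₂ γ * n τ₂ v = 0 ∧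
      (∀ w ∈ W, ℓ γ w = 0 → n τ₁ w = 0 → n τ₂ w = 0) ∧
      (∀ w ∈ W, n τ₁ w = 0 → n τ₂ w = 0 →
        (N τ₁).1 w * ∏ γ' ∈ (Inc τ₂).erase γ, g τ₂ γ' w = (N τ₂).1 w * ∏ γ' ∈ (Inc τ₁).erase γ, g τ₁ γ' w))
    (hpair : ∀ γ ∈ Γ, ∀ γ' ∈ Γ, γ ≠ γ' → ∃ w ∈ W, ℓ γ w = 0 ∧ ℓ γ' w ≠ 0)
    (hne : ∀ γ ∈ Γ, ∃ w ∈ W, ℓ γ w ≠ 0)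
    (hout : ∀ τ ∈ T, ∀ γ ∈ Γ, γ ∉ Inc τ → ∃ w ∈ W, n τ w = 0 ∧ ℓ γ w ≠ 0) :
    ∃ M : PolyRing V, ∀ τ ∈ T, ∀ w ∈ W, n τ w = 0 →
      M.1 w * ∏ γ ∈ Inc τ, g τ γ w = (∏ τ' ∈ T.erase τ, n τ' w) * (N τ).1 w := by
  let p : α → V →ₗ[ℝ] V := fun τ => LinearMap.id - LinearMap.smulRight (n τ) ((n τ v)⁻¹ • v)
  have hp : ∀ τ w, p τ w = w - n τ w • (n τ v)⁻¹ • v := fun τ w => rfl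
  let c : α → ℝ := fun τ => (∏ γ ∈ Inc τ, ε τ γ)⁻¹
  have hc0 : ∀ τ ∈ T, ∏ γ ∈ Inc τ, ε τ γ ≠ 0 := fun τ h => Finset.prod_ne_zero_iff.2 (hε τ h)
  let t : α → PolyRing V := fun τ => algebraMap ℝ _ (c τ) * (∏ τ' ∈ T.erase τ, lin (n τ')) * pull (p τ) (N τ)
    * ∏ γ ∈ Γ \ Inc τ, lin (ℓ γ)
  have ht : ∀ τ w, (t τ).1 w = c τ * (∏ τ' ∈ T.erase τ, n τ' w) * (N τ).1 (p τ w) * ∏ γ ∈ Γ \ Inc τ, ℓ γ w := by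
    intro τ w
    simp only [t, mul_ap, alg_ap, prod_ap, pull_ap, lin_apply]
  obtain ⟨M, hM⟩ := exists_div_prod W ℓ (∑ τ ∈ T, t τ) Γ hpair hne (by
    intro γ hγ
    obtain ⟨τ₁, h1, τ₂, h2, hne12, hi1, hi2, honly, hεn, h12, hcomp⟩ := hridge γ hγ
    have hmain : ∀ w ∈ W, ℓ γ w = 0 → (∏ γ' ∈ Γ.erase γ, ℓ γ' w) * (∑ τ ∈ T, t τ).1 w = 0 := by
      intro w hw hl
      have hs : (∑ τ ∈ T, t τ).1 w = (t τ₁).1 w + (t τ₂).1 w := by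
        rw [sum_ap]
        rw [← Finset.sum_subset (s₁ := {τ₁, τ₂})]
        · rw [Finset.sum_pair hne12]
        · intro x hx
          simp only [Finset.mem_insert, Finset.mem_singleton] at hx
          rcases hx with rfl | rfl <;> assumption
        · intro τ hτ hτn
          simp only [Finset.mem_insert, Finset.mem_singleton] at hτn
          have : γ ∉ Inc τ := fun h => hτn (honly τ hτ h)
          rw [ht, Finset.prod_eq_zero (Finset.mem_sdiff.2 ⟨hγ, this⟩) hl, mul_zero]
      set u := p τ₁ w with hu
      have hu1 : n τ₁ u = 0 := by
        rw [hu, hp, map_sub, map_smul, map_smul, smul_eq_mul, smul_eq_mul, inv_mul_cancel₀ (hnv τ₁ h1)]; ring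
      have hlu : ∀ γ' ∈ Γ, ℓ γ' u = ℓ γ' w := by
        intro γ' h'
        rw [hu, hp, map_sub, map_smul, map_smul, hlv γ' h']; simp
      have huW : u ∈ W := W.sub_mem hw (W.smul_mem _ (W.smul_mem _ hv))
      have hu2 : n τ₂ u = 0 := h12 u huW (by rw [hlu γ hγ, hl]) hu1
      set s : ℝ := n τ₁ w * (n τ₁ v)⁻¹ with hs'
      have hwu : w = u + s • v := by rw [hu, hp, hs', smul_smul]; abel
      have hn1 : n τ₁ w = s * n τ₁ v := by rw [hs', mul_assoc, inv_mul_cancel₀ (hnv τ₁ h1), mul_one]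
      have hn2 : n τ₂ w = s * n τ₂ v := by conv_lhs => rw [hwu, map_add, hu2, map_smul, zero_add, smul_eq_mul]
      have hp2 : p τ₂ w = u := by
        rw [hp, hn2, smul_smul, mul_assoc, mul_inv_cancel₀ (hnv τ₂ h2), mul_one]
        rw [hwu]; abel
      have hcm := hcomp u huW hu1 hu2
      have hprod : ∀ τ ∈ T, n τ u = 0 → γ ∈ Inc τ → ∏ γ' ∈ (Inc τ).erase γ, g τ γ' u =
          (∏ γ' ∈ (Inc τ).erase γ, ε τ γ') * ∏ γ' ∈ (Inc τ).erase γ, ℓ γ' w := by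
        intro τ hτ hn hi
        rw [← Finset.prod_mul_distrib]
        refine Finset.prod_congr rfl fun γ' h' => ?_
        have h'' := Finset.mem_of_mem_erase h'
        rw [hg τ hτ γ' h'' u huW hn, hlu γ' (hInc τ hτ h'')]
      rw [hprod τ₂ h2 hu2 hi2, hprod τ₁ h1 hu1 hi1] at hcm
      have hc1 : ∀ τ ∈ T, γ ∈ Inc τ → c τ = (ε τ γ)⁻¹ * (∏ γ' ∈ (Inc τ).erase γ, ε τ γ')⁻¹ := by
        intro τ _ hi
        simp only [c]
        rw [← Finset.mul_prod_erase _ _ hi, mul_inv]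
      have hab : ∀ τ ∈ T, γ ∈ Inc τ → ∏ γ' ∈ Γ.erase γ, ℓ γ' w =
          (∏ γ' ∈ (Inc τ).erase γ, ℓ γ' w) * ∏ γ' ∈ Γ \ Inc τ, ℓ γ' w := by
        intro τ hτ hi
        rw [← Finset.prod_union]
        · refine Finset.prod_congr ?_ fun _ _ => rfl
          ext x
          have := hInc τ hτ
          simp only [Finset.mem_erase, Finset.mem_union, Finset.mem_sdiff]
          constructor
          · rintro ⟨a, b⟩; by_cases hx : x ∈ Inc τ
            · exact Or.inl ⟨a, hx⟩
            · exact Or.inr ⟨b, hx⟩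
          · rintro (⟨a, b⟩ | ⟨a, b⟩)
            · exact ⟨a, this b⟩
            · exact ⟨fun h => b (h ▸ hi), a⟩
        · rw [Finset.disjoint_left]
          intro x hx hx'
          exact (Finset.mem_sdiff.1 hx').2 (Finset.mem_of_mem_erase hx)
      have e1 := hab τ₁ h1 hi1
      have e2 := hab τ₂ h2 hi2
      rw [hs, ht, ht, hp2, ← hu]
      have m12 : τ₂ ∈ T.erase τ₁ := Finset.mem_erase.2 ⟨hne12.symm, h2⟩
      have m21 : τ₁ ∈ T.erase τ₂ := Finset.mem_erase.2 ⟨hne12, h1⟩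
      rw [← Finset.mul_prod_erase _ _ m12, ← Finset.mul_prod_erase _ _ m21, Finset.erase_right_comm (a := τ₂) (b := τ₁), hn1, hn2,
        hc1 τ₁ h1 hi1, hc1 τ₂ h2 hi2]
      have z1 := hε τ₁ h1 γ hi1
      have z2 := hε τ₂ h2 γ hi2
      have y1 : ∏ γ' ∈ (Inc τ₁).erase γ, ε τ₁ γ' ≠ 0 :=
        Finset.prod_ne_zero_iff.2 fun γ' h' => hε τ₁ h1 γ' (Finset.mem_of_mem_erase h')
      have y2 : ∏ γ' ∈ (Inc τ₂).erase γ, ε τ₂ γ' ≠ 0 :=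
        Finset.prod_ne_zero_iff.2 fun γ' h' => hε τ₂ h2 γ' (Finset.mem_of_mem_erase h')
      set E1 := ∏ γ' ∈ (Inc τ₁).erase γ, ε τ₁ γ'
      set E2 := ∏ γ' ∈ (Inc τ₂).erase γ, ε τ₂ γ'
      set A1 := ∏ γ' ∈ (Inc τ₁).erase γ, ℓ γ' w
      set A2 := ∏ γ' ∈ (Inc τ₂).erase γ, ℓ γ' w
      set B1 := ∏ γ' ∈ Γ \ Inc τ₁, ℓ γ' w
      set B2 := ∏ γ' ∈ Γ \ Inc τ₂, ℓ γ' w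
      set Q := ∏ γ' ∈ Γ.erase γ, ℓ γ' w
      set R := ∏ x ∈ (T.erase τ₁).erase τ₂, n x w
      have hq : Q * (((ε τ₁ γ)⁻¹ * E1⁻¹ * (s * n τ₂ v * R) * (N τ₁).1 u * B1 + (ε τ₂ γ)⁻¹ * E2⁻¹ * (s * n τ₁ v * R) * (N τ₂).1 u * B2))
          = (ε τ₁ γ)⁻¹ * (ε τ₂ γ)⁻¹ * E1⁻¹ * E2⁻¹ * (s * R) * (ε τ₂ γ * n τ₂ v * E2 * (N τ₁).1 u * Q * B1 + ε τ₁ γ * n τ₁ v * E1 * (N τ₂).1 u * Q * B2) := by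
        field_simp
      rw [hq]
      have h5 : ε τ₂ γ * n τ₂ v = - (ε τ₁ γ * n τ₁ v) := by linarith
      have h6 : E2 * (N τ₁).1 u * Q * B1 = E1 * (N τ₂).1 u * Q * B2 := by
        calc E2 * (N τ₁).1 u * Q * B1 = E2 * (N τ₁).1 u * (A2 * B2) * B1 := by rw [← e2]
          _ = ((N τ₁).1 u * (E2 * A2)) * B2 * B1 := by ring
          _ = ((N τ₂).1 u * (E1 * A1)) * B2 * B1 := by rw [hcm]
          _ = E1 * (N τ₂).1 u * (A1 * B1) * B2 := by ring
          _ = _ := by rw [← e1]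
      rw [show ε τ₂ γ * n τ₂ v * E2 * (N τ₁).1 u * Q * B1 = ε τ₂ γ * n τ₂ v * (E2 * (N τ₁).1 u * Q * B1) by ring,
        show ε τ₁ γ * n τ₁ v * E1 * (N τ₂).1 u * Q * B2 = ε τ₁ γ * n τ₁ v * (E1 * (N τ₂).1 u * Q * B2) by ring, h6, h5]
      ring
    let W' : Submodule ℝ V := W ⊓ LinearMap.ker (ℓ γ)
    have hcan := cancel_on W' (∏ γ' ∈ Γ.erase γ, lin (ℓ γ')) (∑ τ ∈ T, t τ) (by
      obtain ⟨x, hx, h⟩ := common_nonzero_prod W' (Γ.erase γ) (fun γ => lin (ℓ γ)) (fun γ' hγ' => by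
        obtain ⟨w, hw, h1, h2⟩ := hpair γ hγ γ' (Finset.mem_of_mem_erase hγ') (Finset.ne_of_mem_erase hγ').symm
        exact ⟨w, ⟨hw, h1⟩, h2⟩)
      refine ⟨x, hx, ?_⟩
      rw [prod_ap]; exact Finset.prod_ne_zero_iff.2 h) (by
      intro x hx
      rw [prod_ap]
      exact hmain x hx.1 hx.2)
    exact fun w hw hl => hcan w ⟨hw, hl⟩)
  refine ⟨M, fun τ hτ => ?_⟩
  let W' : Submodule ℝ V := W ⊓ LinearMap.ker (n τ)
  have hcan := cancel_on W' (∏ γ ∈ Γ \ Inc τ, lin (ℓ γ))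
    (M * (∏ γ ∈ Inc τ, lin (g τ γ)) - (∏ τ' ∈ T.erase τ, lin (n τ')) * N τ) (by
      obtain ⟨x, hx, h⟩ := common_nonzero_prod W' (Γ \ Inc τ) (fun γ => lin (ℓ γ)) (fun γ hγ => by
        obtain ⟨h1, h2⟩ := Finset.mem_sdiff.1 hγ
        obtain ⟨w, hw, h1, h2⟩ := hout τ hτ γ h1 h2
        exact ⟨w, ⟨hw, h1⟩, h2⟩)
      refine ⟨x, hx, ?_⟩
      rw [prod_ap]; exact Finset.prod_ne_zero_iff.2 h) (by
      rintro w ⟨hw, hn⟩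
      have hn : n τ w = 0 := hn
      have h := hM w hw
      have hs : (∑ τ ∈ T, t τ).1 w = (t τ).1 w := by
        rw [sum_ap]
        refine Finset.sum_eq_single_of_mem τ hτ fun τ' _ hne' => ?_
        rw [ht, Finset.prod_eq_zero (Finset.mem_erase.2 ⟨hne'.symm, hτ⟩) hn]; ring
      have hpw : p τ w = w := by rw [hp, hn]; simp
      rw [hs, ht, hpw] at h
      have hD : ∏ γ ∈ Γ, ℓ γ w = (∏ γ ∈ Γ \ Inc τ, ℓ γ w) * ∏ γ ∈ Inc τ, ℓ γ w :=
        (Finset.prod_sdiff (hInc τ hτ)).symm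
      have hG : ∏ γ ∈ Inc τ, g τ γ w = (∏ γ ∈ Inc τ, ε τ γ) * ∏ γ ∈ Inc τ, ℓ γ w := by
        rw [← Finset.prod_mul_distrib]
        exact Finset.prod_congr rfl fun γ hγ => hg τ hτ γ hγ w hw hn
      simp only [mul_ap, sub_ap, prod_ap, lin_apply]
      rw [hG, mul_sub]
      rw [hD] at h
      have h0 := hc0 τ hτ
      simp only [c] at h
      have h7 : (∏ τ' ∈ T.erase τ, n τ' w) * (N τ).1 w * ∏ γ ∈ Γ \ Inc τ, ℓ γ w =
          (∏ γ ∈ Inc τ, ε τ γ) * (((∏ γ ∈ Γ \ Inc τ, ℓ γ w) * ∏ γ ∈ Inc τ, ℓ γ w) * M.1 w) := by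
        rw [← h]; field_simp
      linear_combination -h7)
  intro w hw hn
  have := hcan w ⟨hw, hn⟩
  simp only [mul_ap, sub_ap, prod_ap, lin_apply] at this
  linarith

end interp

end

section
section cinterp
variable {V : Type} [AddCommGroup V] [Module ℝ V] [FiniteDimensional ℝ V]

lemma ridge_span {γ τ ρ σ : Cone V} (hτ : τ ∈ facets σ) (hρ : ρ ∈ facets σ) (hne : ρ ≠ τ)
    (hγ : γ ∈ facets τ) (hγρ : γ ∈ facets ρ) {w : V} (hw : w ∈ σ.spanC) (h1 : nrm σ τ w = 0) (h2 : nrm σ ρ w = 0) :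
    w ∈ γ.spanC := by
  have h3 := mem_facet_span hτ hw h1
  obtain ⟨p, e⟩ := adj_pos hτ hρ hne hγ (facet_face hγρ)
  rw [e w h3] at h2
  exact mem_facet_span hγ h3 ((mul_eq_zero.1 h2).resolve_left p.ne')

lemma cone_interp (σ : Cone V) (N : Cone V → PolyRing V)
    (hN : ∀ τ ∈ facets σ, ∀ ρ ∈ facets σ, τ ≠ ρ → ∀ γ ∈ facets τ, γ ∈ facets ρ → ∀ w ∈ γ.spanC,
      (N τ).1 w * ∏ γ' ∈ (facets ρ).erase γ, nrm ρ γ' w = (N ρ).1 w * ∏ γ' ∈ (facets τ).erase γ, nrm τ γ' w) :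
    ∃ M : PolyRing V, ∀ τ ∈ facets σ, ∀ w ∈ τ.spanC,
      M.1 w * ∏ γ ∈ facets τ, nrm τ γ w = (∏ τ' ∈ (facets σ).erase τ, nrm σ τ' w) * (N τ).1 w := by
  set Γ := (facets σ).biUnion facets with hΓ
  have hex : ∀ γ, ∃ p : Cone V × Cone V, γ ∈ Γ → p.1 ∈ facets σ ∧ p.2 ∈ facets σ ∧ p.2 ≠ p.1 ∧ γ ∈ facets p.1 ∧ γ ∈ facets p.2 := by
    intro γ
    by_cases h : γ ∈ Γ
    · obtain ⟨τ, hτ, hγ⟩ := Finset.mem_biUnion.1 h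
      obtain ⟨ρ, hρ, hne, hγρ⟩ := diamond_exists hτ hγ
      exact ⟨(τ, ρ), fun _ => ⟨hτ, hρ, hne, hγ, hγρ⟩⟩
    · exact ⟨(σ, σ), fun h' => absurd h' h⟩
  choose P hP using hex
  -- generic vectors
  have hu : ∀ q : Cone V × Cone V, ∃ u : V, q.1 ∈ Γ → q.2 ∈ Γ → q.1 ≠ q.2 → u ∈ q.1.spanC ∧ u ∉ q.2.spanC := by
    rintro ⟨γ, γ'⟩
    by_cases h : γ.spanC ≤ γ'.spanC
    · refine ⟨0, fun h1 h2 hne => absurd ?_ hne⟩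
      obtain ⟨h11, -, -, h14, -⟩ := hP γ h1
      obtain ⟨h21, -, -, h24, -⟩ := hP γ' h2
      have f1 := face_trans (facet_face h14) (facet_face h11)
      have f2 := face_trans (facet_face h24) (facet_face h21)
      have hsub : γ.carrier ⊆ γ'.carrier := by
        intro x hx
        have hxσ := face_sub f1 hx
        have h5 := h (carrier_sub_span _ hx)
        exact face_inter_span f2 hxσ h5
      apply face_eq_of_dim (face_of_sub f1 f2 hsub)
      have d1 := facet_dim h14
      have d2 := facet_dim h24
      have d3 := facet_dim h11
      have d4 := facet_dim h21
      omega
    · obtain ⟨u, hu, hu'⟩ := Set.not_subset.1 h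
      exact ⟨u, fun _ _ _ => ⟨hu, hu'⟩⟩
  choose u hu using hu
  obtain ⟨l, hl, hlpos⟩ := exists_interior σ
  obtain ⟨v, hv, hvg, hvpos⟩ := generic_interior σ.spanC ((Γ ×ˢ Γ).filter fun q => q.1 ≠ q.2)
    (fun q => nrm σ (P q.2).2 (u q) • nrm σ (P q.2).1 - nrm σ (P q.2).1 (u q) • nrm σ (P q.2).2) (by
      rintro ⟨γ, γ'⟩ hq
      simp only [Finset.mem_filter, Finset.mem_product] at hq
      obtain ⟨⟨hγ, hγ'⟩, hne⟩ := hq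
      obtain ⟨u1, u2⟩ := hu (γ, γ') hγ hγ' hne
      obtain ⟨p1, p2, p3, p4, p5⟩ := hP γ' hγ'
      obtain ⟨q1, q2, q3, q4, q5⟩ := hP γ hγ
      have huσ : u (γ, γ') ∈ σ.spanC := facet_span_le q1 (facet_span_le q4 u1)
      by_cases h : nrm σ (P γ').1 (u (γ, γ')) = 0
      · have h2 : nrm σ (P γ').2 (u (γ, γ')) ≠ 0 := fun h2 => u2 (ridge_span p1 p2 p3 p4 p5 huσ h h2)
        obtain ⟨x, hx, hx0⟩ := facet_form_ne p2 p1 p3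
        refine ⟨x, facet_span_le p2 hx, ?_⟩
        simp only [LinearMap.sub_apply, LinearMap.smul_apply, smul_eq_mul, h, zero_mul, sub_zero]
        exact mul_ne_zero h2 hx0
      · obtain ⟨x, hx, hx0⟩ := facet_form_ne p1 p2 p3.symm
        refine ⟨x, facet_span_le p1 hx, ?_⟩
        simp only [LinearMap.sub_apply, LinearMap.smul_apply, smul_eq_mul, nrm_zero p1 x hx, mul_zero, zero_sub, neg_ne_zero]
        exact mul_ne_zero h hx0) (facets σ) (nrm σ) l (carrier_sub_span _ hl) hlpos
  let ℓ : Cone V → V →ₗ[ℝ] ℝ := fun γ => nrm σ (P γ).1 v • nrm σ (P γ).2 - nrm σ (P γ).2 v • nrm σ (P γ).1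
  have hℓ : ∀ γ w, ℓ γ w = nrm σ (P γ).1 v * nrm σ (P γ).2 w - nrm σ (P γ).2 v * nrm σ (P γ).1 w := fun γ w => rfl
  let s : Cone V → ℝ := fun γ => nrm σ (P γ).2 (nvec (P γ).1 γ)
  let ε : Cone V → Cone V → ℝ := fun τ γ => if τ = (P γ).1 then (s γ * nrm σ (P γ).1 v)⁻¹ else - (s γ * nrm σ (P γ).2 v)⁻¹
  have hs : ∀ γ ∈ Γ, s γ ≠ 0 := by
    intro γ hγ
    obtain ⟨p1, p2, p3, p4, p5⟩ := hP γ hγ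
    exact (adj_pos p1 p2 p3 p4 (facet_face p5)).1.ne'
  have hInc : ∀ τ ∈ facets σ, facets τ ⊆ Γ := fun τ hτ γ hγ => Finset.mem_biUnion.2 ⟨τ, hτ, hγ⟩
  have honly : ∀ τ ∈ facets σ, ∀ γ ∈ facets τ, τ = (P γ).1 ∨ τ = (P γ).2 := by
    intro τ hτ γ hγ
    obtain ⟨p1, p2, p3, p4, p5⟩ := hP γ (hInc τ hτ hγ)
    by_cases h : τ = (P γ).1
    · exact Or.inl h
    · exact Or.inr (diamond_unique p1 hτ p2 h p3 p4 (facet_face hγ) (facet_face p5))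
  have hne : ∀ γ ∈ Γ, ∃ w ∈ σ.spanC, ℓ γ w ≠ 0 := by
    intro γ hγ
    obtain ⟨p1, p2, p3, p4, p5⟩ := hP γ hγ
    obtain ⟨x, hx, hx0⟩ := facet_form_ne p1 p2 p3.symm
    refine ⟨x, facet_span_le p1 hx, ?_⟩
    rw [hℓ, nrm_zero p1 x hx, mul_zero, sub_zero]
    exact mul_ne_zero (hvpos _ p1).ne' hx0
  have key := interp σ.spanC (facets σ) (nrm σ) v hv (fun τ h => (hvpos τ h).ne') Γ facets hInc ℓ
    (fun γ _ => by rw [hℓ]; ring) nrm ε ?_ ?_ N ?_ ?_ hne ?_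
  · obtain ⟨M, hM⟩ := key
    exact ⟨M, fun τ hτ w hw => hM τ hτ w (facet_span_le hτ hw) (nrm_zero hτ w hw)⟩
  · intro τ hτ γ hγ
    obtain ⟨p1, p2, p3, p4, p5⟩ := hP γ (hInc τ hτ hγ)
    have := hs γ (hInc τ hτ hγ)
    simp only [ε]
    split_ifs
    · exact inv_ne_zero (mul_ne_zero this (hvpos _ p1).ne')
    · exact neg_ne_zero.2 (inv_ne_zero (mul_ne_zero this (hvpos _ p2).ne'))
  · intro τ hτ γ hγ w hw h0
    obtain ⟨p1, p2, p3, p4, p5⟩ := hP γ (hInc τ hτ hγ)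
    have hs' := hs γ (hInc τ hτ hγ)
    have z1 := (hvpos _ p1).ne'
    have z2 := (hvpos _ p2).ne'
    have hwτ := mem_facet_span hτ hw h0
    by_cases h : τ = (P γ).1
    · have he : ε τ γ = (s γ * nrm σ (P γ).1 v)⁻¹ := if_pos h
      obtain ⟨_, e⟩ := adj_pos p1 p2 p3 p4 (facet_face p5)
      rw [he, hℓ, ← h, h0, e w (h ▸ hwτ), mul_zero, sub_zero, ← h]
      change _ = _ * (_ * (nrm σ (P γ).2 (nvec τ γ) * _))
      have : s γ = nrm σ (P γ).2 (nvec τ γ) := by simp only [s]; rw [← h]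
      rw [← this]
      rw [← h] at z1
      field_simp
    · have h2 := (honly τ hτ γ hγ).resolve_left h
      have he : ε τ γ = - (s γ * nrm σ (P γ).2 v)⁻¹ := if_neg h
      obtain ⟨_, e⟩ := adj_pos p2 p1 p3.symm p5 (facet_face p4)
      have hc := diamond_const p1 p2 p3 p4 p5
      rw [he, hℓ, ← h2, h0, e w (h2 ▸ hwτ), mul_zero, zero_sub, ← hc]
      change _ = _ * -(_ * (s γ * _))
      rw [← h2] at z2 ⊢
      field_simp
  · intro γ hγ
    obtain ⟨p1, p2, p3, p4, p5⟩ := hP γ hγ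
    have z1 := (hvpos _ p1).ne'
    have z2 := (hvpos _ p2).ne'
    have hs' := hs γ hγ
    refine ⟨(P γ).1, p1, (P γ).2, p2, p3.symm, p4, p5, fun τ hτ h => honly τ hτ γ h, ?_, ?_, ?_⟩
    · have h1 : ε (P γ).1 γ = (s γ * nrm σ (P γ).1 v)⁻¹ := if_pos rfl
      have h2 : ε (P γ).2 γ = - (s γ * nrm σ (P γ).2 v)⁻¹ := if_neg p3
      rw [h1, h2]
      field_simp; ring
    · intro w hw h0 h1
      rw [hℓ, h1, mul_zero, sub_zero] at h0
      exact (mul_eq_zero.1 h0).resolve_left z1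
    · intro w hw h1 h2
      exact hN _ p1 _ p2 p3.symm γ p4 p5 w (ridge_span p1 p2 p3 p4 p5 hw h1 h2)
  · intro γ hγ γ' hγ' hne'
    obtain ⟨u1, u2⟩ := hu (γ, γ') hγ hγ' hne'
    obtain ⟨q1, q2, q3, q4, q5⟩ := hP γ hγ
    refine ⟨u (γ, γ'), facet_span_le q1 (facet_span_le q4 u1), ?_, ?_⟩
    · rw [hℓ, nrm_zero q1 _ (facet_span_le q4 u1), nrm_zero q2 _ (facet_span_le q5 u1)]; ring
    · have := hvg (γ, γ') (by simp [hγ, hγ', hne'])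
      intro h0
      apply this
      rw [hℓ] at h0
      simp only [LinearMap.sub_apply, LinearMap.smul_apply, smul_eq_mul]
      linarith
  · intro τ hτ γ hγ _
    obtain ⟨w, hw, h0⟩ := hne γ hγ
    have z := (hvpos τ hτ).ne'
    refine ⟨w - (nrm σ τ w / nrm σ τ v) • v, Submodule.sub_mem _ hw (Submodule.smul_mem _ _ hv), ?_, ?_⟩
    · rw [map_sub, map_smul, smul_eq_mul]; field_simp; ring
    · have : ℓ γ v = 0 := by rw [hℓ]; ring
      rw [map_sub, map_smul, this, smul_zero, sub_zero]; exact h0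

end cinterp

end

section
/-! ### Part E1: existence of the pairing -/
section pairing
variable {V : Type} [AddCommGroup V] [Module ℝ V]

/-- linear functionals with values in polynomial functions on `W` -/
structure LF (W : Submodule ℝ V) {M : Type} [AddCommGroup M] [Module (PolyRing V) M] (φ : M → V → ℝ) : Prop where
  poly : ∀ x, ∃ p : PolyRing V, ∀ w ∈ W, φ x w = p.1 w
  add : ∀ x y, ∀ w ∈ W, φ (x + y) w = φ x w + φ y w
  smul : ∀ (a : PolyRing V) x, ∀ w ∈ W, φ (a • x) w = a.1 w * φ x w

lemma LF.zero {W : Submodule ℝ V} {M : Type} [AddCommGroup M] [Module (PolyRing V) M] {φ : M → V → ℝ}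
    (h : LF W φ) {w : V} (hw : w ∈ W) : φ 0 w = 0 := by
  have := h.smul 0 0 w hw
  rwa [zero_smul, zero_ap, zero_mul] at this

lemma LF.sum {W : Submodule ℝ V} {M : Type} [AddCommGroup M] [Module (PolyRing V) M] {φ : M → V → ℝ}
    (h : LF W φ) {ι : Type*} (s : Finset ι) (a : ι → PolyRing V) (e : ι → M) {w : V} (hw : w ∈ W) :
    φ (∑ i ∈ s, a i • e i) w = ∑ i ∈ s, (a i).1 w * φ (e i) w := by
  induction s using Finset.induction_on with
  | empty => simpa using h.zero hw
  | insert i s hi ih => rw [Finset.sum_insert hi, Finset.sum_insert hi, h.add _ _ w hw, h.smul _ _ w hw, ih]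

lemma LF.sub {W : Submodule ℝ V} {M : Type} [AddCommGroup M] [Module (PolyRing V) M] {φ : M → V → ℝ}
    (h : LF W φ) (x y : M) {w : V} (hw : w ∈ W) : φ (x - y) w = φ x w - φ y w := by
  have := h.add (x - y) y w hw
  rw [sub_add_cancel] at this
  linarith

variable [FiniteDimensional ℝ V]

/-- product of all facet normals -/
def hP (σ : Cone V) : PolyRing V := ∏ γ ∈ facets σ, lin (nrm σ γ)

lemma hP_ap (σ : Cone V) (w : V) : (hP σ).1 w = ∏ γ ∈ facets σ, nrm σ γ w := by
  rw [hP, prod_ap]; rfl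

lemma hP_ne (σ : Cone V) : ∃ x ∈ σ.spanC, (hP σ).1 x ≠ 0 := by
  obtain ⟨x, hx, h⟩ := common_nonzero_prod σ.spanC (facets σ) (fun γ => lin (nrm σ γ)) (fun γ h => nrm_ne h)
  exact ⟨x, hx, by rw [hP_ap]; exact Finset.prod_ne_zero_iff.2 h⟩

/-- the pairing axioms at a cone, relative to the pairings on the facets -/
structure PG {Δ : Fan V} (F : FanSheaf Δ) (σ : Δ.cones) (b : (F.stalk σ).M → (F.stalk σ).M → V → ℝ)
    (B : ∀ τ : Δ.cones, (F.stalk τ).M → (F.stalk τ).M → V → ℝ) : Prop where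
  lf : ∀ y, LF σ.1.spanC (fun x => b x y)
  symm : ∀ x y, ∀ w ∈ σ.1.spanC, b x y w = b y x w
  hom : ∀ p q : ℤ, ∀ x ∈ (F.stalk σ).deg p, ∀ y ∈ (F.stalk σ).deg q, ∀ t : ℝ, 0 < t → ∀ w ∈ σ.1.spanC,
    b x y (t ^ 2 • w) = t ^ (p + q + 2 * (facets σ.1).card - 2 * σ.1.dim : ℤ) * b x y w
  compat : ∀ τ : Δ.cones, ∀ h : τ.1 ∈ facets σ.1, ∀ x y, ∀ w ∈ τ.1.spanC,
    b x y w * ∏ γ ∈ facets τ.1, nrm τ.1 γ w = (∏ τ' ∈ (facets σ.1).erase τ.1, nrm σ.1 τ' w) *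
      B τ ((F.res σ τ (facet_face h)).toLin x) ((F.res σ τ (facet_face h)).toLin y) w
  base : σ.1 = zeroCone V → ∃ H : HB (vanishingIdeal V σ.1.carrier) (F.stalk σ), ∀ i j, b (H.e i) (H.e j) 0 = if i = j then 1 else 0

lemma coef_lemma (n : ℕ) (a : ℕ → ℝ) (s : ℤ) (C : ℝ)
    (h : ∀ t : ℝ, 0 < t → ∑ k ∈ Finset.range n, a k * t ^ (2 * k) = t ^ s * C) :
    C = ∑ k ∈ Finset.range n, if (2 * k : ℤ) = s then a k else 0 := by
  set j := s.natAbs with hj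
  obtain ⟨r, hr⟩ : ∃ r : ℕ, (r : ℤ) = s + 2 * j := ⟨(s + 2 * j).toNat, by omega⟩
  have hpoly : (∑ k ∈ Finset.range n, Polynomial.C (a k) * Polynomial.X ^ (2 * (k + j)) : Polynomial ℝ)
      = Polynomial.C C * Polynomial.X ^ r := by
    apply Polynomial.eq_of_infinite_eval_eq
    apply Set.Infinite.mono (s := Set.Ioi 0) _ (Set.Ioi_infinite 0)
    intro t ht
    have ht : 0 < t := ht
    simp only [Set.mem_setOf_eq, Polynomial.eval_finset_sum, Polynomial.eval_mul, Polynomial.eval_C,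
      Polynomial.eval_pow, Polynomial.eval_X]
    have h1 : ∑ k ∈ Finset.range n, a k * t ^ (2 * (k + j)) = (∑ k ∈ Finset.range n, a k * t ^ (2 * k)) * t ^ (2 * j) := by
      rw [Finset.sum_mul]
      exact Finset.sum_congr rfl fun k _ => by rw [mul_add, pow_add]; ring
    rw [h1, h t ht]
    have h2 : t ^ r = t ^ s * t ^ (2 * j) := by
      rw [← zpow_natCast, ← zpow_natCast, hr, zpow_add₀ ht.ne']; push_cast; rfl
    rw [h2]; ring
  have := congrArg (fun P => P.coeff r) hpoly
  simp only [Polynomial.finset_sum_coeff, Polynomial.coeff_C_mul, Polynomial.coeff_X_pow, if_true, mul_one] at this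
  rw [← this]
  refine Finset.sum_congr rfl fun k _ => ?_
  by_cases hk : (2 * k : ℤ) = s
  · rw [if_pos hk, if_pos (by omega), mul_one]
  · rw [if_neg hk, if_neg (by omega), mul_zero]

lemma hom_part (M : PolyRing V) (s : ℤ) : ∃ M' : PolyRing V,
    (∀ t : ℝ, 0 < t → ∀ w, M'.1 (t ^ 2 • w) = t ^ s * M'.1 w) ∧
    ∀ w, (∀ t : ℝ, 0 < t → M.1 (t ^ 2 • w) = t ^ s * M.1 w) → M'.1 w = M.1 w := by
  obtain ⟨n, c, hc, rfl⟩ := hom_decomp M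
  have hc' : ∀ k (t : ℝ) w, (c k).1 (t ^ 2 • w) = t ^ (2 * k) * (c k).1 w := by
    intro k t w
    have : (c k).1 (t ^ 2 • w) = (t ^ 2) ^ k * (c k).1 w := hc k (t ^ 2) w
    rw [this, pow_mul]
  refine ⟨∑ k ∈ Finset.range n, if (2 * k : ℤ) = s then c k else 0, ?_, ?_⟩
  · intro t ht w
    rw [sum_ap, sum_ap, Finset.mul_sum]
    refine Finset.sum_congr rfl fun k _ => ?_
    split_ifs with h
    · rw [hc', ← h]; congr 1
    · rw [zero_ap, zero_ap, mul_zero]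
  · intro w h
    have := coef_lemma n (fun k => (c k).1 w) s ((∑ k ∈ Finset.range n, c k : PolyRing V).1 w) (by
      intro t ht
      rw [← h t ht, sum_ap]
      exact Finset.sum_congr rfl fun k _ => by rw [hc', mul_comm])
    rw [this, sum_ap]
    refine Finset.sum_congr rfl fun k _ => ?_
    split_ifs <;> rfl

/-- bilinear extension -/
lemma mk_pair {σ : Cone V} {M : GAMod V} (H : HB (vanishingIdeal V σ.carrier) M)
    (P : H.ι → H.ι → PolyRing V) (hs : ∀ i j, P i j = P j i) (c : ℤ)
    (hh : ∀ i j, ∀ t : ℝ, 0 < t → ∀ w ∈ σ.spanC, (P i j).1 (t ^ 2 • w) = t ^ (H.dg i + H.dg j + c) * (P i j).1 w) :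
    ∃ b : M.M → M.M → V → ℝ, (∀ y, LF σ.spanC (fun x => b x y)) ∧ (∀ x y, ∀ w ∈ σ.spanC, b x y w = b y x w) ∧
      (∀ p q : ℤ, ∀ x ∈ M.deg p, ∀ y ∈ M.deg q, ∀ t : ℝ, 0 < t → ∀ w ∈ σ.spanC,
        b x y (t ^ 2 • w) = t ^ (p + q + c : ℤ) * b x y w) ∧
      (∀ i j, ∀ w ∈ σ.spanC, b (H.e i) (H.e j) w = (P i j).1 w) := by
  letI := H.fin
  choose r hr using H.exists_coord
  have hun : ∀ x (a : H.ι → PolyRing V), x = ∑ i, a i • H.e i → ∀ w ∈ σ.spanC, ∀ i, (r x i).1 w = (a i).1 w := by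
    intro x a ha w hw i
    have h := hr x
    have h2 : ∑ i, (r x i - a i) • H.e i = 0 := by
      simp only [sub_smul, Finset.sum_sub_distrib]; rw [← h, ← ha, sub_self]
    have := mem_vI_cone.1 (H.ind _ h2 i) w hw
    rw [sub_ap] at this; linarith
  refine ⟨fun x y w => ∑ i, ∑ j, (r x i).1 w * (r y j).1 w * (P i j).1 w, ?_, ?_, ?_, ?_⟩
  · intro y
    refine ⟨fun x => ⟨∑ i, ∑ j, r x i * r y j * P i j, fun w _ => ?_⟩, ?_, ?_⟩
    · simp only [sum_ap, mul_ap]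
    · intro x x' w hw
      have : ∀ i, (r (x + x') i).1 w = (r x i).1 w + (r x' i).1 w := fun i => by
        rw [hun (x + x') (fun i => r x i + r x' i) _ w hw i, add_ap]
        simp only [add_smul, Finset.sum_add_distrib]; rw [← hr, ← hr]
      simp only [this, add_mul, Finset.sum_add_distrib]
    · intro a x w hw
      have : ∀ i, (r (a • x) i).1 w = a.1 w * (r x i).1 w := fun i => by
        rw [hun (a • x) (fun i => a * r x i) _ w hw i, mul_ap]
        simp only [mul_smul, ← Finset.smul_sum]; rw [← hr]
      simp only [this, mul_assoc, Finset.mul_sum]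
  · intro x y w hw
    beta_reduce
    rw [Finset.sum_comm]
    refine Finset.sum_congr rfl fun i _ => Finset.sum_congr rfl fun j _ => ?_
    rw [hs j i]; ring
  · intro p q x hx y hy t ht w hw
    obtain ⟨a, ha, ha1, ha2⟩ := mem_deg_span M H.e H.dg H.mem (r x) p
    rw [← hr, pr_self M hx] at ha
    obtain ⟨a', ha', ha1', ha2'⟩ := mem_deg_span M H.e H.dg H.mem (r y) q
    rw [← hr, pr_self M hy] at ha'
    have hw2 : t ^ 2 • w ∈ σ.spanC := Submodule.smul_mem _ _ hw
    have hsc : ∀ (a : H.ι → PolyRing V) (p : ℤ), (∀ i, ∀ k : ℕ, p - H.dg i = 2 * k → a i ∈ AdegN V k) →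
      (∀ i, (∀ k : ℕ, p - H.dg i ≠ 2 * k) → a i = 0) → ∀ i, (a i).1 (t ^ 2 • w) = t ^ (p - H.dg i) * (a i).1 w := by
      intro a p h1 h2 i
      by_cases h : ∃ k : ℕ, p - H.dg i = 2 * k
      · obtain ⟨k, hk⟩ := h
        have : (a i).1 (t ^ 2 • w) = (t ^ 2) ^ k * (a i).1 w := h1 i k hk (t ^ 2) w
        rw [this, hk, ← pow_mul]; congr 1
      · push Not at h
        rw [h2 i h, zero_ap, zero_ap, mul_zero]
    simp only [hun x a ha _ hw2, hun y a' ha' _ hw2, hun x a ha _ hw, hun y a' ha' _ hw, Finset.mul_sum]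
    refine Finset.sum_congr rfl fun i _ => Finset.sum_congr rfl fun j _ => ?_
    rw [hsc a p ha1 ha2 i, hsc a' q ha1' ha2' j, hh i j t ht w hw]
    have h3 : t ^ (p + q + c) = t ^ (p - H.dg i) * t ^ (q - H.dg j) * t ^ (H.dg i + H.dg j + c) := by
      rw [← zpow_add₀ ht.ne', ← zpow_add₀ ht.ne']; congr 1; ring
    rw [h3]
    generalize t ^ (H.dg i + H.dg j + c) = z
    ring
  · intro i j w hw
    have hd : ∀ i, ∀ k, (r (H.e i) k).1 w = if k = i then 1 else 0 := by
      intro i k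
      rw [hun (H.e i) (fun k => if k = i then 1 else 0) (by simp) w hw k]
      split_ifs <;> rfl
    simp [hd]

end pairing

end

section
section pairing2
variable {V : Type} [AddCommGroup V] [Module ℝ V] [FiniteDimensional ℝ V]

lemma prod_scale {ι : Type*} (s : Finset ι) (f : ι → V →ₗ[ℝ] ℝ) (t : ℝ) (w : V) :
    ∏ i ∈ s, f i (t ^ 2 • w) = t ^ (2 * s.card) * ∏ i ∈ s, f i w := by
  simp only [map_smul, smul_eq_mul, Finset.prod_mul_distrib, Finset.prod_const, ← pow_mul]

lemma pair_entry {Δ : Fan V} {F : FanSheaf Δ} (σ : Δ.cones)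
    (B : ∀ τ : Δ.cones, (F.stalk τ).M → (F.stalk τ).M → V → ℝ)
    (hB : ∀ τ : Δ.cones, τ.1 ∈ facets σ.1 → PG F τ (B τ) B) (p q : ℤ) (x y : (F.stalk σ).M)
    (hx : x ∈ (F.stalk σ).deg p) (hy : y ∈ (F.stalk σ).deg q) :
    ∃ M : PolyRing V, (∀ t : ℝ, 0 < t → ∀ w, M.1 (t ^ 2 • w) = t ^ (p + q + (2 * (facets σ.1).card - 2 * σ.1.dim) : ℤ) * M.1 w) ∧
      ∀ τ : Δ.cones, ∀ h : τ.1 ∈ facets σ.1, ∀ w ∈ τ.1.spanC,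
    M.1 w * ∏ γ ∈ facets τ.1, nrm τ.1 γ w = (∏ τ' ∈ (facets σ.1).erase τ.1, nrm σ.1 τ' w) *
      B τ ((F.res σ τ (facet_face h)).toLin x) ((F.res σ τ (facet_face h)).toLin y) w := by
  have hex : ∀ τ : Cone V, ∃ N : PolyRing V, ∀ h : τ ∈ facets σ.1, ∀ w ∈ τ.spanC,
      B ⟨τ, Δ.face_mem _ σ.2 _ (facet_face h)⟩ ((F.res σ ⟨τ, Δ.face_mem _ σ.2 _ (facet_face h)⟩ (facet_face h)).toLin x)
        ((F.res σ ⟨τ, Δ.face_mem _ σ.2 _ (facet_face h)⟩ (facet_face h)).toLin y) w = N.1 w := by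
    intro τ
    by_cases h : τ ∈ facets σ.1
    · obtain ⟨N, hN⟩ := ((hB ⟨τ, Δ.face_mem _ σ.2 _ (facet_face h)⟩ h).lf
        ((F.res σ ⟨τ, Δ.face_mem _ σ.2 _ (facet_face h)⟩ (facet_face h)).toLin y)).poly
        ((F.res σ ⟨τ, Δ.face_mem _ σ.2 _ (facet_face h)⟩ (facet_face h)).toLin x)
      exact ⟨N, fun _ => hN⟩
    · exact ⟨0, fun h' => absurd h' h⟩
  choose N hN using hex
  have hN' : ∀ (τ : Δ.cones) (h : τ.1 ∈ facets σ.1), ∀ w ∈ τ.1.spanC,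
      B τ ((F.res σ τ (facet_face h)).toLin x) ((F.res σ τ (facet_face h)).toLin y) w = (N τ.1).1 w :=
    fun τ h => hN τ.1 h
  have hridge : ∀ τ ∈ facets σ.1, ∀ γ ∈ facets τ, ∀ hγ : γ ∈ Δ.cones, ∀ hγσ : γ.IsFaceOf σ.1, ∀ w ∈ γ.spanC,
      (N τ).1 w * ∏ γ' ∈ facets γ, nrm γ γ' w = (∏ γ' ∈ (facets τ).erase γ, nrm τ γ' w) *
        B ⟨γ, hγ⟩ ((F.res σ ⟨γ, hγ⟩ hγσ).toLin x) ((F.res σ ⟨γ, hγ⟩ hγσ).toLin y) w := by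
    intro τ hτ γ hγτ hγ hγσ w hw
    let τ' : Δ.cones := ⟨τ, Δ.face_mem _ σ.2 _ (facet_face hτ)⟩
    have := (hB τ' hτ).compat ⟨γ, hγ⟩ hγτ ((F.res σ τ' (facet_face hτ)).toLin x) ((F.res σ τ' (facet_face hτ)).toLin y) w hw
    rw [hN' τ' hτ w (facet_span_le hγτ hw), res_res F _ _ hγσ, res_res F _ _ hγσ] at this
    exact this
  obtain ⟨M, hM⟩ := cone_interp σ.1 N (by
    intro τ hτ ρ hρ hne γ hγτ hγρ w hw
    have hγσ := face_trans (facet_face hγτ) (facet_face hτ)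
    have hγ := Δ.face_mem _ σ.2 _ hγσ
    have := cancel_on γ.spanC (hP γ) (N τ * (∏ γ' ∈ (facets ρ).erase γ, lin (nrm ρ γ')) - N ρ * ∏ γ' ∈ (facets τ).erase γ, lin (nrm τ γ'))
      (hP_ne γ) (by
        intro u hu
        rw [sub_ap, mul_ap, mul_ap, prod_ap, prod_ap, hP_ap]
        simp only [lin_apply]
        have h1 := hridge τ hτ γ hγτ hγ hγσ u hu
        have h2 := hridge ρ hρ γ hγρ hγ hγσ u hu
        linear_combination (∏ γ' ∈ (facets ρ).erase γ, nrm ρ γ' u) * h1 - (∏ γ' ∈ (facets τ).erase γ, nrm τ γ' u) * h2) w hw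
    rw [sub_ap, mul_ap, mul_ap, prod_ap, prod_ap] at this
    simp only [lin_apply] at this
    linarith)
  obtain ⟨M', h1, h2⟩ := hom_part M (p + q + (2 * (facets σ.1).card - 2 * σ.1.dim))
  refine ⟨M', h1, fun τ h w hw => ?_⟩
  rw [hN' τ h w hw, ← hM τ.1 h w hw]
  by_cases h0 : ∏ γ ∈ facets τ.1, nrm τ.1 γ w = 0
  · rw [h0, mul_zero, mul_zero]
  rw [h2 w]
  intro t ht
  have e1 := hM τ.1 h w hw
  have e2 := hM τ.1 h (t ^ 2 • w) (Submodule.smul_mem _ _ hw)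
  rw [prod_scale, prod_scale, ← hN' τ h _ (Submodule.smul_mem _ _ hw),
    (hB τ h).hom p q _ ((F.res σ τ (facet_face h)).deg_mem p x hx) _ ((F.res σ τ (facet_face h)).deg_mem q y hy) t ht w hw,
    hN' τ h w hw, Finset.card_erase_of_mem h] at e2
  have hd := facet_dim h
  have hc : 1 ≤ (facets σ.1).card := Finset.card_pos.2 ⟨_, h⟩
  have e3 : t ^ (2 * ((facets σ.1).card - 1)) * t ^ (p + q + 2 * (facets τ.1).card - 2 * τ.1.dim : ℤ)
     = t ^ (p + q + (2 * (facets σ.1).card - 2 * σ.1.dim) : ℤ) * t ^ (2 * (facets τ.1).card) := by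
    rw [← zpow_natCast, ← zpow_natCast, ← zpow_add₀ ht.ne', ← zpow_add₀ ht.ne']
    congr 1
    push_cast [hc]
    rw [← hd]; push_cast; ring
  have h4 : t ^ (2 * (facets τ.1).card) ≠ 0 := pow_ne_zero _ ht.ne'
  have h5 : M.1 (t ^ 2 • w) * (t ^ (2 * (facets τ.1).card) * ∏ γ ∈ facets τ.1, nrm τ.1 γ w)
     = t ^ (p + q + (2 * (facets σ.1).card - 2 * σ.1.dim) : ℤ) * M.1 w * (t ^ (2 * (facets τ.1).card) * ∏ γ ∈ facets τ.1, nrm τ.1 γ w) := by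
    rw [e2]
    linear_combination (∏ τ' ∈ (facets σ.1).erase τ.1, nrm σ.1 τ' w) * (N τ.1).1 w * e3 - t ^ (p + q + (2 * (facets σ.1).card - 2 * σ.1.dim) : ℤ) * t ^ (2 * (facets τ.1).card) * e1
  exact mul_right_cancel₀ (mul_ne_zero h4 h0) h5

lemma pair_step {Δ : Fan V} {F : FanSheaf Δ} (hF : Nice F) (σ : Δ.cones)
    (B : ∀ τ : Δ.cones, (F.stalk τ).M → (F.stalk τ).M → V → ℝ)
    (hB : ∀ τ : Δ.cones, τ.1 ∈ facets σ.1 → PG F τ (B τ) B) : ∃ b, PG F σ b B := by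
  have H := (hF.hb σ).some
  letI := H.fin
  have hent : ∃ P : H.ι → H.ι → PolyRing V, (∀ i j, P i j = P j i) ∧
    (∀ i j, ∀ t : ℝ, 0 < t → ∀ w ∈ σ.1.spanC, (P i j).1 (t ^ 2 • w) = t ^ (H.dg i + H.dg j + (2 * (facets σ.1).card - 2 * σ.1.dim : ℤ)) * (P i j).1 w) ∧
    (∀ i j, ∀ τ : Δ.cones, ∀ h : τ.1 ∈ facets σ.1, ∀ w ∈ τ.1.spanC,
    (P i j).1 w * ∏ γ ∈ facets τ.1, nrm τ.1 γ w = (∏ τ' ∈ (facets σ.1).erase τ.1, nrm σ.1 τ' w) *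
      B τ ((F.res σ τ (facet_face h)).toLin (H.e i)) ((F.res σ τ (facet_face h)).toLin (H.e j)) w) ∧
    (σ.1 = zeroCone V → ∀ i j, (P i j).1 0 = if i = j then 1 else 0) := by
    by_cases h0 : σ.1 = zeroCone V
    · have hf : facets σ.1 = ∅ := by rw [h0]; exact facets_zero
      have hdim : σ.1.dim = 0 := by rw [h0]; exact zeroCone_dim
      have hdg : ∀ i, H.dg i = 0 := by
        intro i
        by_contra hne
        have hσ : σ = Δ.ozero := Subtype.ext h0
        have h1 : (F.stalk σ).deg (H.dg i) = ⊥ := by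
          generalize H.dg i = q at hne
          rw [hσ]; exact hF.condN.2.2 _ hne
        have h2 := H.mem i
        rw [h1] at h2
        have h2 : H.e i = 0 := h2
        have h3 := H.ind (fun k => if k = i then 1 else 0) (by simp [h2]) i
        rw [if_pos rfl] at h3
        exact one_ne_zero (mem_vI_cone.1 h3 0 (Submodule.zero_mem _))
      refine ⟨fun i j => if i = j then 1 else 0, fun i j => by simp only [eq_comm], ?_, ?_, fun _ i j => by beta_reduce; split_ifs <;> rfl⟩
      · intro i j t ht w hw
        rw [hdg, hdg, hf, hdim]
        beta_reduce
        split_ifs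
        · simp [one_ap]
        · simp [zero_ap]
      · intro i j τ h; rw [hf] at h; exact absurd h (Finset.notMem_empty _)
    · choose Q hQ1 hQ2 using fun i j => pair_entry σ B hB (H.dg i) (H.dg j) (H.e i) (H.e j) (H.mem i) (H.mem j)
      refine ⟨fun i j => (1 / 2 : ℝ) • (Q i j + Q j i), fun i j => by beta_reduce; rw [add_comm], ?_, ?_, fun h => absurd h h0⟩
      · intro i j t ht w hw
        rw [smul_ap, smul_ap, add_ap, add_ap, hQ1 i j t ht, hQ1 j i t ht, add_comm (H.dg j)]; ring
      · intro i j τ h w hw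
        rw [smul_ap, add_ap]
        have e1 := hQ2 i j τ h w hw
        have e2 := hQ2 j i τ h w hw
        rw [(hB τ h).symm _ _ w hw] at e2
        linear_combination (1 / 2 : ℝ) * e1 + (1 / 2 : ℝ) * e2
  obtain ⟨P, hs, hh, hc, hz⟩ := hent
  obtain ⟨b, b1, b2, b3, b4⟩ := mk_pair H P hs _ hh
  refine ⟨b, b1, b2, ?_, ?_, ?_⟩
  · intro p q x hx y hy t ht w hw
    rw [b3 p q x hx y hy t ht w hw, add_sub_assoc]
  · intro τ h x y w hw
    have hwσ := facet_span_le h hw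
    obtain ⟨a, rfl⟩ := H.exists_coord x
    obtain ⟨a', rfl⟩ := H.exists_coord y
    simp only [map_sum, map_smul]
    have l1 : ∀ y, LF σ.1.spanC (fun x => b x y) := b1
    have e1 : b (∑ i, a i • H.e i) (∑ i, a' i • H.e i) w = ∑ i, ∑ j, (a i).1 w * ((a' j).1 w * b (H.e i) (H.e j) w) := by
      rw [(l1 _).sum _ _ _ hwσ]
      refine Finset.sum_congr rfl fun i _ => ?_
      rw [b2 _ _ w hwσ, (l1 _).sum _ _ _ hwσ, Finset.mul_sum]
      exact Finset.sum_congr rfl fun j _ => by rw [b2 _ _ w hwσ]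
    have l2 := (hB τ h).lf
    have s2 := (hB τ h).symm
    rw [e1, (l2 _).sum _ _ _ hw, Finset.sum_mul, Finset.mul_sum]
    refine Finset.sum_congr rfl fun i _ => ?_
    rw [s2 _ _ w hw, (l2 _).sum _ _ _ hw, Finset.sum_mul, Finset.mul_sum, Finset.mul_sum]
    refine Finset.sum_congr rfl fun j _ => ?_
    rw [b4 i j w hwσ, s2 _ _ w hw]
    have := hc i j τ h w hw
    linear_combination (a i).1 w * (a' j).1 w * this
  · intro h0
    refine ⟨H, fun i j => ?_⟩
    rw [b4 i j 0 (Submodule.zero_mem _), hz h0]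

lemma PG.congr {Δ : Fan V} {F : FanSheaf Δ} {σ : Δ.cones} {b : (F.stalk σ).M → (F.stalk σ).M → V → ℝ}
    {B B' : ∀ τ : Δ.cones, (F.stalk τ).M → (F.stalk τ).M → V → ℝ} (h : PG F σ b B)
    (hBB : ∀ τ : Δ.cones, τ.1 ∈ facets σ.1 → B τ = B' τ) : PG F σ b B' :=
  ⟨h.lf, h.symm, h.hom, fun τ hτ => by rw [← hBB τ hτ]; exact h.compat τ hτ, h.base⟩

lemma pair_exists {Δ : Fan V} {F : FanSheaf Δ} (hF : Nice F) :
    ∃ B : ∀ τ : Δ.cones, (F.stalk τ).M → (F.stalk τ).M → V → ℝ, ∀ σ, PG F σ (B σ) B := by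
  have key : ∀ n : ℕ, ∃ B : ∀ τ : Δ.cones, (F.stalk τ).M → (F.stalk τ).M → V → ℝ,
      ∀ σ : Δ.cones, σ.1.dim < n → PG F σ (B σ) B := by
    intro n
    induction n with
    | zero => exact ⟨fun _ _ _ _ => 0, fun σ h => absurd h (Nat.not_lt_zero _)⟩
    | succ n ih =>
      obtain ⟨B, hB⟩ := ih
      let B' : ∀ τ : Δ.cones, (F.stalk τ).M → (F.stalk τ).M → V → ℝ := fun τ =>
        if τ.1.dim < n then B τ else if h : ∃ b, PG F τ b B then h.choose else B τ
      have hlt : ∀ τ : Δ.cones, τ.1.dim < n → B τ = B' τ := fun τ h => by simp only [B', if_pos h]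
      refine ⟨B', fun σ hσ => ?_⟩
      have hf : ∀ τ : Δ.cones, τ.1 ∈ facets σ.1 → τ.1.dim < n := fun τ h => by
        have := facet_dim h; omega
      by_cases h : σ.1.dim < n
      · rw [← hlt σ h]
        exact (hB σ h).congr fun τ hτ => hlt τ (hf τ hτ)
      · have hex := pair_step hF σ B (fun τ hτ => hB τ (hf τ hτ))
        have : B' σ = hex.choose := by simp only [B', if_neg h, dif_pos hex]
        rw [this]
        exact hex.choose_spec.congr fun τ hτ => hlt τ (hf τ hτ)
  obtain ⟨B, hB⟩ := key (finrank ℝ V + 1)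
  exact ⟨B, fun σ => hB σ (Nat.lt_succ_of_le (Submodule.finrank_le _))⟩

end pairing2

end

section
/-! ### Part E2: duality -/
section dual
variable {V : Type} [AddCommGroup V] [Module ℝ V] [FiniteDimensional ℝ V]

lemma PG.lf' {Δ : Fan V} {F : FanSheaf Δ} {σ : Δ.cones} {b : (F.stalk σ).M → (F.stalk σ).M → V → ℝ}
    {B : ∀ τ : Δ.cones, (F.stalk τ).M → (F.stalk τ).M → V → ℝ} (h : PG F σ b B) (x) :
    LF σ.1.spanC (fun y => b x y) := by
  refine ⟨fun y => ?_, fun y y' w hw => ?_, fun a y w hw => ?_⟩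
  · obtain ⟨p, hp⟩ := (h.lf y).poly x
    exact ⟨p, hp⟩
  · beta_reduce
    rw [h.symm _ _ w hw, (h.lf x).add _ _ w hw, h.symm _ _ w hw, h.symm x y' w hw]
  · beta_reduce
    rw [h.symm _ _ w hw, (h.lf x).smul _ _ w hw, h.symm _ _ w hw]

lemma LF.comp {W : Submodule ℝ V} {M N : Type} [AddCommGroup M] [Module (PolyRing V) M] [AddCommGroup N] [Module (PolyRing V) N]
    {φ : M → V → ℝ} (h : LF W φ) (f : N →ₗ[PolyRing V] M) : LF W (fun x => φ (f x)) :=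
  ⟨fun x => h.poly (f x), fun x y w hw => by beta_reduce; rw [map_add, h.add _ _ w hw],
    fun a x w hw => by beta_reduce; rw [map_smul, h.smul _ _ w hw]⟩

lemma dualLF {Δ : Fan V} {F : FanSheaf Δ} (hF : Nice F) (σ : Δ.cones) :
    ∃ (n : ℕ) (k : Fin n → KT F σ (facets σ.1)) (c : Fin n → KT F σ (facets σ.1) → V → ℝ),
      (∀ i, LF σ.1.spanC (c i)) ∧
      (∀ φ : KT F σ (facets σ.1) → V → ℝ, LF σ.1.spanC φ → ∀ x, ∀ w ∈ σ.1.spanC, φ x w = ∑ i, c i x w * φ (k i) w) ∧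
      ∀ x, (∀ i, ∀ w ∈ σ.1.spanC, c i x w = 0) → x = 0 := by
  have hfin := K_finite hF σ (facets σ.1)
  obtain ⟨n, k, c, h1, h2⟩ := dual_basis (K_proj hF σ)
  have hmk : ∀ q : PolyRing V ⧸ vanishingIdeal V σ.1.carrier, ∃ p, Ideal.Quotient.mk _ p = q := Ideal.Quotient.mk_surjective
  choose r hr using hmk
  have heq : ∀ p p' : PolyRing V, Ideal.Quotient.mk (vanishingIdeal V σ.1.carrier) p = Ideal.Quotient.mk _ p' →
      ∀ w ∈ σ.1.spanC, p.1 w = p'.1 w := by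
    intro p p' h w hw
    have := mem_vI_cone.1 (Ideal.Quotient.eq.1 h) w hw
    rw [sub_ap] at this; linarith
  have hsm : ∀ (a : PolyRing V) (q : PolyRing V ⧸ vanishingIdeal V σ.1.carrier), a • q = Ideal.Quotient.mk _ (a * r q) := by
    intro a q
    rw [map_mul, hr]; rfl
  refine ⟨n, k, fun i x w => (r (c i x)).1 w, fun i => ⟨fun x => ⟨r (c i x), fun w _ => rfl⟩, ?_, ?_⟩, ?_, ?_⟩
  · intro x y w hw
    beta_reduce
    rw [map_add, ← add_ap]
    exact heq _ _ (by rw [hr, map_add, hr, hr]) w hw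
  · intro a x w hw
    beta_reduce
    rw [map_smul, ← mul_ap]
    exact heq _ _ (by rw [hr, hsm]) w hw
  · intro φ hφ x w hw
    choose p hp using hφ.poly
    have heq' : ∀ p p' : PolyRing V, (∀ w ∈ σ.1.spanC, p.1 w = p'.1 w) → Ideal.Quotient.mk (vanishingIdeal V σ.1.carrier) p = Ideal.Quotient.mk _ p' := by
      intro p p' h
      rw [Ideal.Quotient.eq, mem_vI_cone]
      intro w hw
      rw [sub_ap, h w hw, sub_self]
    let ψ : KT F σ (facets σ.1) →ₗ[PolyRing V] PolyRing V ⧸ vanishingIdeal V σ.1.carrier :=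
      { toFun := fun x => Ideal.Quotient.mk _ (p x)
        map_add' := fun x y => by
          rw [← map_add]
          exact heq' _ _ fun w hw => by rw [add_ap, ← hp _ w hw, ← hp _ w hw, ← hp _ w hw, hφ.add _ _ w hw]
        map_smul' := fun a x => by
          rw [RingHom.id_apply, hsm]
          refine heq' _ _ fun w hw => ?_
          rw [mul_ap, ← hp _ w hw, heq (r (Ideal.Quotient.mk _ (p x))) (p x) (hr _) w hw, ← hp _ w hw, hφ.smul _ _ w hw] }
    have := h1 ψ x
    have e : Ideal.Quotient.mk (vanishingIdeal V σ.1.carrier) (p x) = Ideal.Quotient.mk _ (∑ i, r (c i x) * p (k i)) := by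
      change ψ x = _
      rw [this, map_sum]
      refine Finset.sum_congr rfl fun i _ => ?_
      rw [map_mul, hr]; rfl
    rw [hp x w hw, heq _ _ e w hw, sum_ap]
    exact Finset.sum_congr rfl fun i _ => by rw [mul_ap, hp _ w hw]
  · intro x hx
    apply h2 x
    intro i
    rw [← hr (c i x), Ideal.Quotient.eq_zero_iff_mem, mem_vI_cone]
    exact hx i

lemma K_zero {Δ : Fan V} {F : FanSheaf Δ} {σ : Δ.cones} {x : (F.stalk σ).M} (hx : x ∈ KT F σ (facets σ.1))
    (δ : Δ.cones) (h : Cone.IsFaceOf δ.1 σ.1) (hne : δ.1 ≠ σ.1) : (F.res σ δ h).toLin x = 0 := by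
  rw [← K_eq, LinearMap.mem_ker] at hx
  rw [← bdRes_ap F σ x δ ⟨h, hne⟩, hx]; rfl

lemma mem_K {Δ : Fan V} {F : FanSheaf Δ} {σ : Δ.cones} {x : (F.stalk σ).M} :
    x ∈ KT F σ (facets σ.1) ↔ ∀ τ : Δ.cones, ∀ h : τ.1 ∈ facets σ.1, (F.res σ τ (facet_face h)).toLin x = 0 := by
  rw [mem_KT]; exact ⟨fun h τ hτ => h τ hτ hτ, fun h τ hτ _ => h τ hτ⟩

lemma hP_smul {Δ : Fan V} {F : FanSheaf Δ} (hF : Nice F) (σ : Δ.cones) (x : (F.stalk σ).M) :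
    hP σ.1 • x ∈ KT F σ (facets σ.1) := by
  rw [mem_K]
  intro τ h
  rw [map_smul]
  apply nice_kill hF τ
  rw [mem_vI_cone]
  intro w hw
  rw [hP_ap]
  exact Finset.prod_eq_zero h (nrm_zero h w hw)

/-- the duality statement (3*) -/
def DT {Δ : Fan V} (F : FanSheaf Δ) (B : ∀ τ : Δ.cones, (F.stalk τ).M → (F.stalk τ).M → V → ℝ) (σ : Δ.cones) : Prop :=
  ∃ a : PolyRing V, a.1 0 = 1 ∧ ∀ φ : KT F σ (facets σ.1) → V → ℝ, LF σ.1.spanC φ →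
    ∃ y, ∀ k : KT F σ (facets σ.1), ∀ w ∈ σ.1.spanC, (hP σ.1).1 w * a.1 w * φ k w = B σ k.1 y w

lemma ND {Δ : Fan V} {F : FanSheaf Δ} (hF : Nice F) {B : ∀ τ : Δ.cones, (F.stalk τ).M → (F.stalk τ).M → V → ℝ}
    (hB : ∀ σ, PG F σ (B σ) B) (σ : Δ.cones) (hD : DT F B σ) (y : (F.stalk σ).M)
    (hy : ∀ k ∈ KT F σ (facets σ.1), ∀ w ∈ σ.1.spanC, B σ k y w = 0) : y = 0 := by
  obtain ⟨a, ha, hD⟩ := hD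
  have h1 : ∀ x, ∀ w ∈ σ.1.spanC, B σ y x w = 0 := by
    intro x
    obtain ⟨p, hp⟩ := ((hB σ).lf y).poly x
    have := cancel_on σ.1.spanC (hP σ.1) p (hP_ne _) (by
      intro w hw
      rw [← hp w hw]
      have := hy _ (hP_smul hF σ x) w hw
      rwa [((hB σ).lf y).smul _ _ w hw] at this)
    intro w hw
    rw [(hB σ).symm _ _ w hw]
    have h := hp w hw
    beta_reduce at h
    rw [h, this w hw]
  obtain ⟨n, k, c, c1, c2, c3⟩ := dualLF hF σ
  have h2 := c3 ⟨hP σ.1 • y, hP_smul hF σ y⟩ (by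
    intro i
    obtain ⟨p, hp⟩ := (c1 i).poly ⟨hP σ.1 • y, hP_smul hF σ y⟩
    obtain ⟨y', hy'⟩ := hD (c i) (c1 i)
    have := cancel_on σ.1.spanC (hP σ.1 * a) p ?_ ?_
    · intro w hw; rw [hp w hw, this w hw]
    · obtain ⟨w, hw, h1, h2⟩ := common_nonzero σ.1.spanC (hP σ.1) a (hP_ne _) ⟨0, Submodule.zero_mem _, by rw [ha]; exact one_ne_zero⟩
      exact ⟨w, hw, by rw [mul_ap]; exact mul_ne_zero h1 h2⟩
    · intro w hw
      rw [mul_ap, ← hp w hw, hy' _ w hw]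
      change B σ (hP σ.1 • y) y' w = 0
      rw [((hB σ).lf y').smul _ _ w hw, h1 _ w hw, mul_zero])
  have h3 : hP σ.1 • y = 0 := congrArg Subtype.val h2
  refine (hF.hb σ).some.torsion_free ?_ h3
  rw [mem_vI_cone]
  intro h
  obtain ⟨x, hx, h0⟩ := hP_ne σ.1
  exact h0 (h x hx)

lemma ridge_side {Δ : Fan V} {F : FanSheaf Δ} {B : ∀ τ : Δ.cones, (F.stalk τ).M → (F.stalk τ).M → V → ℝ}
    (hB : ∀ σ, PG F σ (B σ) B) (σ τ τ' γ : Δ.cones) (hτ : τ.1 ∈ facets σ.1) (hτ' : τ'.1 ∈ facets σ.1) (hne : τ'.1 ≠ τ.1)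
    (hγ : γ.1 ∈ facets τ.1) (hγ' : γ.1 ∈ facets τ'.1) (Z y : (F.stalk τ).M) (P : PolyRing V)
    (H : ∀ w ∈ τ.1.spanC, (hP τ.1).1 w * P.1 w = nrm σ.1 τ'.1 w * B τ Z y w) :
    ∀ w ∈ γ.1.spanC, (hP γ.1).1 w * P.1 w = nrm σ.1 τ'.1 (nvec τ.1 γ.1) *
      B γ ((F.res τ γ (facet_face hγ)).toLin Z) ((F.res τ γ (facet_face hγ)).toLin y) w := by
  obtain ⟨hs, hadj⟩ := adj_pos hτ hτ' hne hγ (facet_face hγ')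
  set s := nrm σ.1 τ'.1 (nvec τ.1 γ.1) with hsdef
  obtain ⟨b, hb⟩ := ((hB τ).lf y).poly Z
  beta_reduce at hb
  set g : PolyRing V := ∏ γ' ∈ (facets τ.1).erase γ.1, lin (nrm τ.1 γ') with hg
  have hg' : ∀ w, g.1 w = ∏ γ' ∈ (facets τ.1).erase γ.1, nrm τ.1 γ' w := fun w => by rw [hg, prod_ap]; rfl
  have h1 := cancel_on τ.1.spanC (lin (nrm τ.1 γ.1)) (g * P - s • b) (nrm_ne hγ) (by
    intro w hw
    have := H w hw
    rw [hP_ap, hadj w hw, hb w hw, ← Finset.mul_prod_erase _ _ hγ, ← hg'] at this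
    rw [lin_apply, sub_ap, mul_ap, smul_ap]
    linear_combination this)
  obtain ⟨b', hb'⟩ := ((hB γ).lf ((F.res τ γ (facet_face hγ)).toLin y)).poly ((F.res τ γ (facet_face hγ)).toLin Z)
  beta_reduce at hb'
  have h2 := cancel_on γ.1.spanC g (hP γ.1 * P - s • b') (by
      obtain ⟨w, hw, h⟩ := common_nonzero_prod γ.1.spanC ((facets τ.1).erase γ.1) (fun γ' => lin (nrm τ.1 γ')) (by
        intro γ' h
        exact facet_form_ne hγ (Finset.mem_of_mem_erase h) (Finset.ne_of_mem_erase h).symm)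
      exact ⟨w, hw, by rw [hg']; exact Finset.prod_ne_zero_iff.2 h⟩) (by
    intro w hw
    have e1 := h1 w (facet_span_le hγ hw)
    have e2 := (hB τ).compat γ hγ Z y w hw
    rw [hb w (facet_span_le hγ hw), hb' w hw, ← hg', ← hP_ap] at e2
    rw [sub_ap, mul_ap, smul_ap] at e1 ⊢
    linear_combination (hP γ.1).1 w * e1 + s * e2)
  intro w hw
  have := h2 w hw
  rw [sub_ap, mul_ap, smul_ap, ← hb' w hw] at this
  linarith

end dual

end

section
/-! ### Part E3: the duality step -/
section dualstep
variable {V : Type} [AddCommGroup V] [Module ℝ V] [FiniteDimensional ℝ V]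

lemma phi_congr {N : Type} {P : N → Prop} (φ : {x // P x} → V → ℝ) {x x' : N} (h : P x) (h' : P x') (e : x = x') :
    φ ⟨x, h⟩ = φ ⟨x', h'⟩ := by subst e; rfl

lemma DT_base {Δ : Fan V} {F : FanSheaf Δ} {B : ∀ τ : Δ.cones, (F.stalk τ).M → (F.stalk τ).M → V → ℝ}
    (hB : ∀ σ, PG F σ (B σ) B) (σ : Δ.cones) (h0 : σ.1 = zeroCone V) : DT F B σ := by
  obtain ⟨H, hH⟩ := (hB σ).base h0
  letI := H.fin
  have hf : facets σ.1 = ∅ := by rw [h0]; exact facets_zero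
  have hK : ∀ x, x ∈ KT F σ (facets σ.1) := by
    intro x; rw [mem_K]; intro τ h; rw [hf] at h; exact absurd h (Finset.notMem_empty _)
  refine ⟨1, rfl, fun φ hφ => ?_⟩
  choose p hp using hφ.poly
  refine ⟨∑ i, p ⟨H.e i, hK _⟩ • H.e i, ?_⟩
  rintro ⟨k, hk⟩ w hw
  have hw0 : w = 0 := by rw [h0, zeroCone_span] at hw; exact hw
  obtain ⟨a, ha⟩ := H.exists_coord k
  have e : (⟨k, hk⟩ : KT F σ (facets σ.1)) = ∑ i, a i • (⟨H.e i, hK _⟩ : KT F σ (facets σ.1)) := by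
    apply Subtype.ext
    rw [AddSubmonoidClass.coe_finset_sum]; exact ha
  have hP1 : (hP σ.1).1 w = 1 := by rw [hP_ap, hf, Finset.prod_empty]
  rw [hP1, one_ap, one_mul, one_mul, e, hφ.sum _ _ _ hw, ← e]
  change _ = B σ k _ w
  rw [ha, ((hB σ).lf _).sum _ _ _ hw]
  refine Finset.sum_congr rfl fun i _ => ?_
  rw [((hB σ).lf' (H.e i)).sum _ _ _ hw, Finset.sum_eq_single i]
  · rw [hp _ w hw, hw0, hH i i, if_pos rfl, mul_one]
  · intro j _ hj
    rw [hw0, hH i j, if_neg hj.symm, mul_zero]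
  · intro h; exact absurd (Finset.mem_univ _) h

lemma lift_K {Δ : Fan V} {F : FanSheaf Δ} (hF : Nice F) (σ τ : Δ.cones) {x : (F.stalk σ).M}
    (hx : ∀ ρ : Δ.cones, ∀ h : ρ.1 ∈ facets σ.1, ρ.1 ≠ τ.1 → (F.res σ ρ (facet_face h)).toLin x = 0) :
    lin (nrm σ.1 τ.1) • x ∈ KT F σ (facets σ.1) := by
  rw [mem_K]
  intro ρ hρ
  rw [map_smul]
  by_cases hne : ρ.1 = τ.1
  · apply nice_kill hF ρ
    rw [mem_vI_cone]
    intro w hw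
    rw [lin_apply, ← hne]
    exact nrm_zero hρ w hw
  · rw [hx ρ hρ hne, smul_zero]

lemma exists_lift {Δ : Fan V} {F : FanSheaf Δ} (hF : Nice F) (σ τ : Δ.cones) (hτ : τ.1 ∈ facets σ.1)
    (z : (F.stalk τ).M) (hz : z ∈ KT F τ (facets τ.1)) :
    ∃ x : (F.stalk σ).M, (F.res σ τ (facet_face hτ)).toLin x = z ∧
      ∀ ρ : Δ.cones, ∀ h : ρ.1 ∈ facets σ.1, ρ.1 ≠ τ.1 → (F.res σ ρ (facet_face h)).toLin x = 0 := by
  have key := extend_zero hF σ τ (facet_face hτ) {ρ | ρ.1 ∈ facets σ.1 ∧ ρ.1 ≠ τ.1} (fun ρ h => facet_face h.1) z ?_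
  · obtain ⟨x, h1, h2⟩ := key
    exact ⟨x, h1, fun ρ h hne => h2 ρ ⟨h, hne⟩ _⟩
  · rintro ρ ⟨hρ, hne⟩ δ hδρ hδτ
    refine K_zero hz δ hδτ fun he => ?_
    rw [he] at hδρ
    have h1 := facet_dim hτ
    have h2 := facet_dim hρ
    exact hne (face_eq_of_dim hδρ (by omega)).symm

lemma facet_func {Δ : Fan V} {F : FanSheaf Δ} (hF : Nice F) (σ τ : Δ.cones) (hτ : τ.1 ∈ facets σ.1)
    (φ : KT F σ (facets σ.1) → V → ℝ) (hφ : LF σ.1.spanC φ) :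
    ∃ ψ : KT F τ (facets τ.1) → V → ℝ, LF τ.1.spanC ψ ∧ ∀ (z : KT F τ (facets τ.1)) (x : (F.stalk σ).M),
      (F.res σ τ (facet_face hτ)).toLin x = z.1 →
      (∀ ρ : Δ.cones, ∀ h : ρ.1 ∈ facets σ.1, ρ.1 ≠ τ.1 → (F.res σ ρ (facet_face h)).toLin x = 0) →
      ∀ hk : lin (nrm σ.1 τ.1) • x ∈ KT F σ (facets σ.1), ∀ w ∈ τ.1.spanC, φ ⟨_, hk⟩ w = ψ z w := by
  choose L hL1 hL2 using fun z : KT F τ (facets τ.1) => exists_lift hF σ τ hτ z.1 z.2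
  have uniq : ∀ (z : KT F τ (facets τ.1)) (x : (F.stalk σ).M),
      (F.res σ τ (facet_face hτ)).toLin x = z.1 →
      (∀ ρ : Δ.cones, ∀ h : ρ.1 ∈ facets σ.1, ρ.1 ≠ τ.1 → (F.res σ ρ (facet_face h)).toLin x = 0) →
      ∀ hk : lin (nrm σ.1 τ.1) • x ∈ KT F σ (facets σ.1), ∀ w ∈ τ.1.spanC, φ ⟨_, hk⟩ w = φ ⟨_, lift_K hF σ τ (hL2 z)⟩ w := by
    intro z x hx hx0 hk w hw
    have hd : x - L z ∈ KT F σ (facets σ.1) := by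
      rw [mem_K]
      intro ρ hρ
      rw [map_sub]
      by_cases hne : ρ.1 = τ.1
      · have : ρ = τ := Subtype.ext hne
        subst this
        rw [hx, hL1, sub_self]
      · rw [hx0 ρ hρ hne, hL2 z ρ hρ hne, sub_self]
    have hwσ := facet_span_le hτ hw
    have e1 := hφ.smul (lin (nrm σ.1 τ.1)) ⟨_, hd⟩ w hwσ
    rw [lin_apply, nrm_zero hτ w hw, zero_mul] at e1
    have e2 := hφ.sub ⟨_, hk⟩ ⟨_, lift_K hF σ τ (hL2 z)⟩ hwσ
    have e3 : (⟨_, hk⟩ - ⟨_, lift_K hF σ τ (hL2 z)⟩ : KT F σ (facets σ.1)) = lin (nrm σ.1 τ.1) • ⟨_, hd⟩ := by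
      apply Subtype.ext
      exact (smul_sub _ _ _).symm
    rw [e3, e1] at e2
    linarith
  refine ⟨fun z => φ ⟨_, lift_K hF σ τ (hL2 z)⟩, ⟨?_, ?_, ?_⟩, uniq⟩
  · intro z
    obtain ⟨p, hp⟩ := hφ.poly ⟨_, lift_K hF σ τ (hL2 z)⟩
    exact ⟨p, fun w hw => hp w (facet_span_le hτ hw)⟩
  · intro z z' w hw
    beta_reduce
    have h0 : ∀ ρ : Δ.cones, ∀ h : ρ.1 ∈ facets σ.1, ρ.1 ≠ τ.1 → (F.res σ ρ (facet_face h)).toLin (L z + L z') = 0 :=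
      fun ρ h hne => by rw [map_add, hL2 z ρ h hne, hL2 z' ρ h hne, add_zero]
    rw [← uniq (z + z') (L z + L z') (by rw [map_add, hL1, hL1]; rfl) h0 (lift_K hF σ τ h0) w hw,
      ← hφ.add _ _ w (facet_span_le hτ hw)]
    exact congrFun (phi_congr φ _ _ (smul_add _ _ _)) w
  · intro a z w hw
    beta_reduce
    have h0 : ∀ ρ : Δ.cones, ∀ h : ρ.1 ∈ facets σ.1, ρ.1 ≠ τ.1 → (F.res σ ρ (facet_face h)).toLin (a • L z) = 0 :=
      fun ρ h hne => by rw [map_smul, hL2 z ρ h hne, smul_zero]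
    rw [← uniq (a • z) (a • L z) (by rw [map_smul, hL1]; rfl) h0 (lift_K hF σ τ h0) w hw,
      ← hφ.smul _ _ w (facet_span_le hτ hw)]
    exact congrFun (phi_congr φ _ _ (smul_comm _ _ _)) w

lemma ridge_eq {Δ : Fan V} {F : FanSheaf Δ} (hF : Nice F) {B : ∀ τ : Δ.cones, (F.stalk τ).M → (F.stalk τ).M → V → ℝ}
    (hB : ∀ σ, PG F σ (B σ) B) (σ τ τ' γ : Δ.cones) (hτ : τ.1 ∈ facets σ.1) (hτ' : τ'.1 ∈ facets σ.1) (hne : τ'.1 ≠ τ.1)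
    (hγ : γ.1 ∈ facets τ.1) (hγ' : γ.1 ∈ facets τ'.1) (hD : DT F B γ) (a : PolyRing V)
    (φ : KT F σ (facets σ.1) → V → ℝ) (hφ : LF σ.1.spanC φ)
    (y : (F.stalk τ).M) (y' : (F.stalk τ').M)
    (hy : ∀ (x : (F.stalk σ).M) (_ : (F.res σ τ (facet_face hτ)).toLin x ∈ KT F τ (facets τ.1)),
      (∀ ρ : Δ.cones, ∀ h : ρ.1 ∈ facets σ.1, ρ.1 ≠ τ.1 → (F.res σ ρ (facet_face h)).toLin x = 0) →
      ∀ hk : lin (nrm σ.1 τ.1) • x ∈ KT F σ (facets σ.1), ∀ w ∈ τ.1.spanC,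
        (hP τ.1).1 w * (a.1 w * φ ⟨_, hk⟩ w) = B τ ((F.res σ τ (facet_face hτ)).toLin x) y w)
    (hy' : ∀ (x : (F.stalk σ).M) (_ : (F.res σ τ' (facet_face hτ')).toLin x ∈ KT F τ' (facets τ'.1)),
      (∀ ρ : Δ.cones, ∀ h : ρ.1 ∈ facets σ.1, ρ.1 ≠ τ'.1 → (F.res σ ρ (facet_face h)).toLin x = 0) →
      ∀ hk : lin (nrm σ.1 τ'.1) • x ∈ KT F σ (facets σ.1), ∀ w ∈ τ'.1.spanC,
        (hP τ'.1).1 w * (a.1 w * φ ⟨_, hk⟩ w) = B τ' ((F.res σ τ' (facet_face hτ')).toLin x) y' w) :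
    (F.res τ γ (facet_face hγ)).toLin y = (F.res τ' γ (facet_face hγ')).toLin y' := by
  rw [← sub_eq_zero]
  refine ND hF hB γ hD _ fun z hz => ?_
  have hγσ : Cone.IsFaceOf γ.1 σ.1 := face_trans (facet_face hγ) (facet_face hτ)
  have key := extend_zero hF σ γ hγσ {ρ | ρ.1 ∈ facets σ.1 ∧ ρ.1 ≠ τ.1 ∧ ρ.1 ≠ τ'.1} (fun ρ h => facet_face h.1) z ?_
  · obtain ⟨x, h1, h2⟩ := key
    have h2 : ∀ ρ : Δ.cones, ∀ h : ρ.1 ∈ facets σ.1, ρ.1 ≠ τ.1 → ρ.1 ≠ τ'.1 → (F.res σ ρ (facet_face h)).toLin x = 0 :=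
      fun ρ h ha hb => h2 ρ ⟨h, ha, hb⟩ _
    -- both sides, symmetric
    have gen : ∀ (τ τ' : Δ.cones) (hτ : τ.1 ∈ facets σ.1) (hτ' : τ'.1 ∈ facets σ.1) (_ : τ'.1 ≠ τ.1)
      (hγ : γ.1 ∈ facets τ.1) (_ : γ.1 ∈ facets τ'.1) (_ : ∀ ρ : Δ.cones, ∀ h : ρ.1 ∈ facets σ.1, ρ.1 ≠ τ.1 → ρ.1 ≠ τ'.1 → (F.res σ ρ (facet_face h)).toLin x = 0)
      (y : (F.stalk τ).M) (_ : ∀ (x : (F.stalk σ).M) (_ : (F.res σ τ (facet_face hτ)).toLin x ∈ KT F τ (facets τ.1)),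
      (∀ ρ : Δ.cones, ∀ h : ρ.1 ∈ facets σ.1, ρ.1 ≠ τ.1 → (F.res σ ρ (facet_face h)).toLin x = 0) →
      ∀ hk : lin (nrm σ.1 τ.1) • x ∈ KT F σ (facets σ.1), ∀ w ∈ τ.1.spanC,
        (hP τ.1).1 w * (a.1 w * φ ⟨_, hk⟩ w) = B τ ((F.res σ τ (facet_face hτ)).toLin x) y w),
      ∃ hk : lin (nrm σ.1 τ.1) • lin (nrm σ.1 τ'.1) • x ∈ KT F σ (facets σ.1), ∀ P : PolyRing V,
        (∀ w ∈ τ.1.spanC, P.1 w = a.1 w * φ ⟨_, hk⟩ w) → ∀ w ∈ γ.1.spanC, (hP γ.1).1 w * P.1 w = nrm σ.1 τ'.1 (nvec τ.1 γ.1) *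
      B γ z ((F.res τ γ (facet_face hγ)).toLin y) w := by
      intro τ τ' hτ hτ' hne hγ hγ' h2 y hy
      have h0 : ∀ ρ : Δ.cones, ∀ h : ρ.1 ∈ facets σ.1, ρ.1 ≠ τ.1 → (F.res σ ρ (facet_face h)).toLin (lin (nrm σ.1 τ'.1) • x) = 0 := by
        intro ρ hρ hn
        rw [map_smul]
        by_cases hn' : ρ.1 = τ'.1
        · apply nice_kill hF ρ
          rw [mem_vI_cone]
          intro w hw
          rw [lin_apply, ← hn']
          exact nrm_zero hρ w hw
        · rw [h2 ρ hρ hn hn', smul_zero]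
      have hm : (F.res σ τ (facet_face hτ)).toLin (lin (nrm σ.1 τ'.1) • x) ∈ KT F τ (facets τ.1) := by
        rw [mem_K]
        intro δ hδ
        obtain ⟨ρ, hρ, hρne, hδρ⟩ := diamond_exists hτ hδ
        let ρ' : Δ.cones := ⟨ρ, Δ.face_mem _ σ.2 _ (facet_face hρ)⟩
        have hδσ : Cone.IsFaceOf δ.1 σ.1 := face_trans (facet_face hδ) (facet_face hτ)
        rw [res_res F (facet_face hτ) (facet_face hδ) hδσ, ← res_res F (τ := ρ') (facet_face hρ) (facet_face hδρ) hδσ,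
          h0 ρ' hρ hρne, map_zero]
      refine ⟨lift_K hF σ τ h0, fun P hPP => ?_⟩
      have := ridge_side hB σ τ τ' γ hτ hτ' hne hγ hγ' ((F.res σ τ (facet_face hτ)).toLin x) y P (by
        intro w hw
        rw [hPP w hw, hy _ hm h0 (lift_K hF σ τ h0) w hw, map_smul, ((hB τ).lf y).smul _ _ w hw]; rfl)
      rw [res_res F (facet_face hτ) (facet_face hγ) hγσ, h1] at this
      exact this
    obtain ⟨k1, g1⟩ := gen τ τ' hτ hτ' hne hγ hγ' h2 y hy
    obtain ⟨k2, g2⟩ := gen τ' τ hτ' hτ hne.symm hγ' hγ (fun ρ h ha hb => h2 ρ h hb ha) y' hy'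
    obtain ⟨p, hp⟩ := hφ.poly ⟨_, k1⟩
    intro w hw
    have e1 := g1 (a * p) (fun w hw => by rw [mul_ap, hp w (facet_span_le hτ hw)]) w hw
    have e2 := g2 (a * p) (fun w hw => by
      rw [mul_ap, ← hp w (facet_span_le hτ' hw), phi_congr φ k1 k2 (smul_comm _ _ _)]) w hw
    rw [diamond_const hτ' hτ hne.symm hγ' hγ, e1] at e2
    rw [((hB γ).lf' z).sub _ _ hw, sub_eq_zero]
    exact mul_left_cancel₀ (adj_pos hτ hτ' hne hγ (facet_face hγ')).1.ne' e2
  · rintro ρ ⟨hρ, hn, hn'⟩ δ hδρ hδγ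
    refine K_zero hz δ hδγ fun he => ?_
    rw [he] at hδρ
    exact hn' (diamond_unique hτ hρ hτ' hn hne hγ hδρ (facet_face hγ'))

end dualstep

end

section
/-! ### Part E4: the duality theorem -/
section dualthm
variable {V : Type} [AddCommGroup V] [Module ℝ V] [FiniteDimensional ℝ V]

lemma hP_split {σ τ : Cone V} (h : τ ∈ facets σ) :
    hP σ = lin (nrm σ τ) * ∏ τ' ∈ (facets σ).erase τ, lin (nrm σ τ') :=
  (Finset.mul_prod_erase (facets σ) (fun γ => lin (nrm σ γ)) h).symm

lemma chi_exists {Δ : Fan V} {F : FanSheaf Δ} (hF : Nice F) {B : ∀ τ : Δ.cones, (F.stalk τ).M → (F.stalk τ).M → V → ℝ}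
    (hB : ∀ σ, PG F σ (B σ) B) (σ : Δ.cones) (a : PolyRing V)
    (ha : ∀ τ : Δ.cones, τ.1 ∈ facets σ.1 → ∀ φ : KT F τ (facets τ.1) → V → ℝ, LF τ.1.spanC φ →
      ∃ y, ∀ k : KT F τ (facets τ.1), ∀ w ∈ τ.1.spanC, (hP τ.1).1 w * (a.1 w * φ k w) = B τ k.1 y w)
    (hD : ∀ γ : Δ.cones, γ.1.dim < σ.1.dim → DT F B γ)
    (φ : KT F σ (facets σ.1) → V → ℝ) (hφ : LF σ.1.spanC φ) :
    ∃ (y : (F.stalk σ).M) (χ : (F.stalk σ).M → V → ℝ), LF σ.1.spanC χ ∧ ∀ e, ∀ w ∈ σ.1.spanC,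
      a.1 w * φ ⟨_, hP_smul hF σ e⟩ w = B σ e y w + (hP σ.1).1 w * χ e w := by
  have hex : ∀ τ : Δ.cones, ∃ y, ∀ hτ : τ.1 ∈ facets σ.1, ∀ (x : (F.stalk σ).M) (_ : (F.res σ τ (facet_face hτ)).toLin x ∈ KT F τ (facets τ.1)),
      (∀ ρ : Δ.cones, ∀ h : ρ.1 ∈ facets σ.1, ρ.1 ≠ τ.1 → (F.res σ ρ (facet_face h)).toLin x = 0) →
      ∀ hk : lin (nrm σ.1 τ.1) • x ∈ KT F σ (facets σ.1), ∀ w ∈ τ.1.spanC,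
        (hP τ.1).1 w * (a.1 w * φ ⟨_, hk⟩ w) = B τ ((F.res σ τ (facet_face hτ)).toLin x) y w := by
    intro τ
    by_cases hτ : τ.1 ∈ facets σ.1
    · obtain ⟨ψ, h1, h2⟩ := facet_func hF σ τ hτ φ hφ
      obtain ⟨y, hy⟩ := ha τ hτ ψ h1
      refine ⟨y, fun hτ x hx h0 hk w hw => ?_⟩
      rw [h2 ⟨_, hx⟩ x rfl h0 hk w hw]
      exact hy ⟨_, hx⟩ w hw
    · exact ⟨0, fun h => absurd h hτ⟩
  choose y hy using hex
  obtain ⟨Y, hY⟩ := glue hF σ y (by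
    intro τ τ' γ hτ hτ' hne hγ hγ'
    refine ridge_eq hF hB σ τ τ' γ hτ hτ' (fun h => hne (Subtype.ext h.symm)) hγ hγ' (hD γ ?_) a φ hφ _ _ (hy τ hτ) (hy τ' hτ')
    have h1 := facet_dim hτ
    have h2 := facet_dim hγ
    omega)
  have hvan : ∀ e, ∀ τ : Δ.cones, τ.1 ∈ facets σ.1 → ∀ w ∈ τ.1.spanC, a.1 w * φ ⟨_, hP_smul hF σ e⟩ w - B σ e Y w = 0 := by
    intro e τ hτ
    set g : PolyRing V := ∏ τ' ∈ (facets σ.1).erase τ.1, lin (nrm σ.1 τ') with hg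
    have hg' : ∀ w, g.1 w = ∏ τ' ∈ (facets σ.1).erase τ.1, nrm σ.1 τ' w := fun w => by rw [hg, prod_ap]; rfl
    have h0 : ∀ ρ : Δ.cones, ∀ h : ρ.1 ∈ facets σ.1, ρ.1 ≠ τ.1 → (F.res σ ρ (facet_face h)).toLin (g • e) = 0 := by
      intro ρ hρ hn
      rw [map_smul]
      apply nice_kill hF ρ
      rw [mem_vI_cone]
      intro w hw
      rw [hg']
      exact Finset.prod_eq_zero (Finset.mem_erase.2 ⟨hn, hρ⟩) (nrm_zero hρ w hw)
    have hm : (F.res σ τ (facet_face hτ)).toLin (g • e) ∈ KT F τ (facets τ.1) := by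
      rw [mem_K]
      intro δ hδ
      obtain ⟨ρ, hρ, hρne, hδρ⟩ := diamond_exists hτ hδ
      let ρ' : Δ.cones := ⟨ρ, Δ.face_mem _ σ.2 _ (facet_face hρ)⟩
      have hδσ : Cone.IsFaceOf δ.1 σ.1 := face_trans (facet_face hδ) (facet_face hτ)
      rw [res_res F (facet_face hτ) (facet_face hδ) hδσ, ← res_res F (τ := ρ') (facet_face hρ) (facet_face hδρ) hδσ,
        h0 ρ' hρ hρne, map_zero]
    obtain ⟨p, hp⟩ := hφ.poly ⟨_, hP_smul hF σ e⟩
    obtain ⟨q, hq⟩ := ((hB σ).lf Y).poly e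
    beta_reduce at hq
    have := cancel_on τ.1.spanC (hP τ.1) (a * p - q) (hP_ne _) (by
      intro w hw
      have hwσ := facet_span_le hτ hw
      have e1 := hy τ hτ (g • e) hm h0 (lift_K hF σ τ h0) w hw
      rw [phi_congr φ (lift_K hF σ τ h0) (hP_smul hF σ e) (by rw [smul_smul, ← hP_split hτ]), hp w hwσ, map_smul,
        ((hB τ).lf (y τ)).smul _ _ w hw] at e1
      have e2 := (hB σ).compat τ hτ e Y w hw
      rw [hY τ hτ, hq w hwσ, ← hg', ← hP_ap] at e2
      rw [sub_ap, mul_ap]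
      linear_combination e1 - e2)
    intro w hw
    have h := this w hw
    rw [sub_ap, mul_ap, ← hp w (facet_span_le hτ hw), ← hq w (facet_span_le hτ hw)] at h
    exact h
  have hN : ∀ e, ∃ N : PolyRing V, ∀ w ∈ σ.1.spanC, a.1 w * φ ⟨_, hP_smul hF σ e⟩ w - B σ e Y w = (hP σ.1).1 w * N.1 w := by
    intro e
    obtain ⟨p, hp⟩ := hφ.poly ⟨_, hP_smul hF σ e⟩
    obtain ⟨q, hq⟩ := ((hB σ).lf Y).poly e
    beta_reduce at hq
    have hpq : ∀ w ∈ σ.1.spanC, (a * p - q).1 w = a.1 w * φ ⟨_, hP_smul hF σ e⟩ w - B σ e Y w := fun w hw => by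
      rw [sub_ap, mul_ap, hp w hw, hq w hw]
    obtain ⟨N, hN⟩ := exists_div_prod σ.1.spanC (nrm σ.1) (a * p - q) (facets σ.1) (by
        intro γ hγ γ' hγ' hne
        obtain ⟨x, hx, h⟩ := facet_form_ne hγ hγ' hne
        exact ⟨x, facet_span_le hγ hx, nrm_zero hγ x hx, h⟩) (fun γ hγ => nrm_ne hγ) (by
        intro γ hγ w hw h
        rw [hpq w hw]
        exact hvan e ⟨γ, Δ.face_mem _ σ.2 _ (facet_face hγ)⟩ hγ w (mem_facet_span hγ hw h))
    exact ⟨N, fun w hw => by rw [← hpq w hw, hN w hw, hP_ap]⟩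
  choose N hN using hN
  refine ⟨Y, fun e w => (N e).1 w, ⟨fun e => ⟨N e, fun w _ => rfl⟩, ?_, ?_⟩, fun e w hw => ?_⟩
  · intro e e' w hw
    have := cancel_on σ.1.spanC (hP σ.1) (N (e + e') - (N e + N e')) (hP_ne _) (by
      intro w hw
      have h1 := hN (e + e') w hw
      have h2 := hN e w hw
      have h3 := hN e' w hw
      have h4 := hφ.add ⟨_, hP_smul hF σ e⟩ ⟨_, hP_smul hF σ e'⟩ w hw
      have h5 : φ (⟨_, hP_smul hF σ e⟩ + ⟨_, hP_smul hF σ e'⟩) = φ ⟨_, hP_smul hF σ (e + e')⟩ :=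
        congrArg φ (Subtype.ext (smul_add _ _ _).symm)
      rw [h5] at h4
      rw [h4, ((hB σ).lf Y).add _ _ w hw] at h1
      rw [sub_ap, add_ap]
      linear_combination h2 + h3 - h1) w hw
    rw [sub_ap, add_ap] at this
    linarith
  · intro b e w hw
    have := cancel_on σ.1.spanC (hP σ.1) (N (b • e) - b * N e) (hP_ne _) (by
      intro w hw
      have h1 := hN (b • e) w hw
      have h2 := hN e w hw
      have h4 := hφ.smul b ⟨_, hP_smul hF σ e⟩ w hw
      have h5 : φ (b • ⟨_, hP_smul hF σ e⟩) = φ ⟨_, hP_smul hF σ (b • e)⟩ :=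
        congrArg φ (Subtype.ext (smul_comm _ _ _))
      rw [h5] at h4
      rw [h4, ((hB σ).lf Y).smul _ _ w hw] at h1
      rw [sub_ap, mul_ap]
      linear_combination b.1 w * h2 - h1) w hw
    rw [sub_ap, mul_ap] at this
    linarith
  · have := hN e w hw
    beta_reduce
    linarith

lemma LF.mSub_zero {W : Submodule ℝ V} {M : Type} [AddCommGroup M] [Module (PolyRing V) M] {φ : M → V → ℝ}
    (h : LF W φ) {x : M} (hx : x ∈ mSub V M) : φ x 0 = 0 := by
  have h0 : (0 : V) ∈ W := W.zero_mem
  rw [mSub] at hx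
  refine Submodule.smul_induction_on hx (fun r hr n _ => ?_) (fun x y hx hy => ?_)
  · rw [h.smul _ _ 0 h0, mem_mId.1 hr, zero_mul]
  · rw [h.add _ _ 0 h0, hx, hy, add_zero]

lemma DT_step {Δ : Fan V} {F : FanSheaf Δ} (hF : Nice F) {B : ∀ τ : Δ.cones, (F.stalk τ).M → (F.stalk τ).M → V → ℝ}
    (hB : ∀ σ, PG F σ (B σ) B) (σ : Δ.cones) (h0 : σ.1 ≠ zeroCone V)
    (hD : ∀ γ : Δ.cones, γ.1.dim < σ.1.dim → DT F B γ) : DT F B σ := by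
  have hDf : ∀ τ : Δ.cones, τ.1 ∈ facets σ.1 → DT F B τ := fun τ h => hD τ (by have := facet_dim h; omega)
  have haex : ∀ τ : Cone V, ∃ a : PolyRing V, a.1 0 = 1 ∧ ∀ h : τ ∈ facets σ.1, ∀ φ : KT F ⟨τ, Δ.face_mem _ σ.2 _ (facet_face h)⟩ (facets τ) → V → ℝ, LF τ.spanC φ →
    ∃ y, ∀ k : KT F ⟨τ, Δ.face_mem _ σ.2 _ (facet_face h)⟩ (facets τ), ∀ w ∈ τ.spanC, (hP τ).1 w * a.1 w * φ k w = B ⟨τ, Δ.face_mem _ σ.2 _ (facet_face h)⟩ k.1 y w := by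
    intro τ
    by_cases h : τ ∈ facets σ.1
    · obtain ⟨a, h1, h2⟩ := hDf ⟨τ, Δ.face_mem _ σ.2 _ (facet_face h)⟩ h
      exact ⟨a, h1, fun _ => h2⟩
    · exact ⟨1, rfl, fun h' => absurd h' h⟩
  choose at' hat hat' using haex
  set a : PolyRing V := ∏ τ ∈ facets σ.1, at' τ with hadef
  have ha0 : a.1 0 = 1 := by
    rw [hadef, prod_ap]; exact Finset.prod_eq_one fun τ _ => hat τ
  have ha : ∀ τ : Δ.cones, τ.1 ∈ facets σ.1 → ∀ φ : KT F τ (facets τ.1) → V → ℝ, LF τ.1.spanC φ →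
      ∃ y, ∀ k : KT F τ (facets τ.1), ∀ w ∈ τ.1.spanC, (hP τ.1).1 w * (a.1 w * φ k w) = B τ k.1 y w := by
    intro τ hτ φ hφ
    obtain ⟨y, hy⟩ := hat' τ.1 hτ φ hφ
    refine ⟨(∏ τ' ∈ (facets σ.1).erase τ.1, at' τ') • y, fun k w hw => ?_⟩
    have e : a = at' τ.1 * ∏ τ' ∈ (facets σ.1).erase τ.1, at' τ' := (Finset.mul_prod_erase _ _ hτ).symm
    rw [((hB τ).lf' k.1).smul _ _ w hw, e, mul_ap]
    have := hy k w hw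
    linear_combination (∏ τ' ∈ (facets σ.1).erase τ.1, at' τ').1 w * this
  obtain ⟨n, k, c, c1, c2, c3⟩ := dualLF hF σ
  choose y χ hχ hyχ using fun j => chi_exists hF hB σ a ha hD (c j) (c1 j)
  choose m hm using fun j x => (hχ j).poly x
  have hm0 : ∀ j i, (m j (k i).1).1 0 = 0 := by
    intro j i
    rw [← hm j (k i).1 0 (Submodule.zero_mem _)]
    refine (hχ j).mSub_zero (hF.ker σ h0 ?_)
    rw [K_eq]; exact (k i).2
  let D : Matrix (Fin n) (Fin n) (PolyRing V) := fun j i => (if j = i then a else 0) - m j (k i).1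
  -- relation
  have hrel : ∀ (x : KT F σ (facets σ.1)) j, ∀ w ∈ σ.1.spanC, (hP σ.1).1 w * ∑ i, (D j i).1 w * c i x w = B σ x.1 (y j) w := by
    intro x j w hw
    have e1 := hyχ j x.1 w hw
    have e2 := (c1 j).smul (hP σ.1) x w hw
    have e3 : c j (hP σ.1 • x) w = c j ⟨_, hP_smul hF σ x.1⟩ w := rfl
    rw [← e3, e2] at e1
    have e4 := c2 (fun x => χ j x.1) ((hχ j).comp (KT F σ (facets σ.1)).subtype) x w hw
    beta_reduce at e4
    rw [e4] at e1
    have e5 : ∑ i, (D j i).1 w * c i x w = a.1 w * c j x w - ∑ i, c i x w * χ j (k i).1 w := by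
      simp only [D]
      rw [Finset.sum_congr rfl (fun i _ => show ((if j = i then a else 0) - m j (k i).1).1 w * c i x w =
        (if j = i then a.1 w * c i x w else 0) - c i x w * χ j (k i).1 w by
          rw [sub_ap, hm j _ w hw]; split_ifs
          · ring
          · rw [zero_ap]; ring), Finset.sum_sub_distrib, Finset.sum_ite_eq, if_pos (Finset.mem_univ _)]
    rw [e5]
    linear_combination e1
  have hadj : ∀ l i, ∑ j, D.adjugate l j * D j i = if l = i then D.det else 0 := by
    intro l i
    have := congrFun (congrFun D.adjugate_mul l) i
    rw [Matrix.mul_apply] at this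
    rw [this, Matrix.smul_apply, Matrix.one_apply, smul_eq_mul, mul_ite, mul_one, mul_zero]
  refine ⟨D.det, ?_, fun φ hφ => ?_⟩
  · rw [← evalRH_ap, RingHom.map_det]
    have : (evalRH V 0).mapMatrix D = 1 := by
      ext j i
      rw [RingHom.mapMatrix_apply, Matrix.map_apply, Matrix.one_apply, evalRH_ap]
      simp only [D]
      rw [sub_ap, hm0, sub_zero]
      split_ifs
      · exact ha0
      · exact zero_ap _
    rw [this, Matrix.det_one]
  · choose p hp using fun i => hφ.poly (k i)
    refine ⟨∑ l, p l • ∑ j, D.adjugate l j • y j, fun x w hw => ?_⟩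
    rw [((hB σ).lf' x.1).sum _ _ _ hw, c2 φ hφ x w hw, Finset.mul_sum]
    refine Finset.sum_congr rfl fun l _ => ?_
    rw [((hB σ).lf' x.1).sum _ _ _ hw, hp l w hw]
    have h1 : ∑ j, (D.adjugate l j).1 w * B σ x.1 (y j) w = (hP σ.1).1 w * (D.det.1 w * c l x w) := by
      rw [Finset.sum_congr rfl fun j _ => by rw [← hrel x j w hw]]
      have h2 : ∀ i, ∑ j, (D.adjugate l j).1 w * (D j i).1 w = if l = i then D.det.1 w else 0 := by
        intro i
        have := congrArg (fun q : PolyRing V => q.1 w) (hadj l i)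
        beta_reduce at this
        rw [sum_ap, Finset.sum_congr rfl fun j _ => mul_ap _ _ _] at this
        rw [this]; split_ifs
        · rfl
        · exact zero_ap _
      calc _ = (hP σ.1).1 w * ∑ i, (∑ j, (D.adjugate l j).1 w * (D j i).1 w) * c i x w := by
            simp only [Finset.mul_sum, Finset.sum_mul]
            rw [Finset.sum_comm]
            exact Finset.sum_congr rfl fun i _ => Finset.sum_congr rfl fun j _ => by ring
        _ = _ := by
            congr 1
            rw [Finset.sum_congr rfl fun i _ => by rw [h2 i, ite_mul, zero_mul], Finset.sum_ite_eq, if_pos (Finset.mem_univ _)]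
    rw [h1]; ring

lemma DT_all {Δ : Fan V} {F : FanSheaf Δ} (hF : Nice F) {B : ∀ τ : Δ.cones, (F.stalk τ).M → (F.stalk τ).M → V → ℝ}
    (hB : ∀ σ, PG F σ (B σ) B) : ∀ (n : ℕ) (σ : Δ.cones), σ.1.dim = n → DT F B σ := by
  intro n
  induction n using Nat.strong_induction_on with
  | _ n ih =>
    intro σ hσ
    by_cases h0 : σ.1 = zeroCone V
    · exact DT_base hB σ h0
    · exact DT_step hF hB σ h0 fun γ hγ => ih _ (hσ ▸ hγ) γ rfl

end dualthm

end

section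
/-! ### Part F: vanishing of low degree sections with support -/
section key
variable {V : Type} [AddCommGroup V] [Module ℝ V] [FiniteDimensional ℝ V]

lemma HB.coordLF {σ : Cone V} {M : GAMod V} (H : HB (vanishingIdeal V σ.carrier) M) :
    ∃ c : H.ι → M.M → V → ℝ, (∀ i, LF σ.spanC (c i)) ∧
      ∀ (a : H.ι → PolyRing V) i, ∀ w ∈ σ.spanC, c i (letI := H.fin; ∑ i, a i • H.e i) w = (a i).1 w := by
  letI := H.fin
  choose b hb using H.exists_coord
  have uniq : ∀ (a a' : H.ι → PolyRing V), ∑ i, a i • H.e i = ∑ i, a' i • H.e i → ∀ i, ∀ w ∈ σ.spanC, (a i).1 w = (a' i).1 w := by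
    intro a a' h i w hw
    have h1 : ∑ i, (a i - a' i) • H.e i = 0 := by
      simp only [sub_smul, Finset.sum_sub_distrib]; exact sub_eq_zero.2 h
    have := mem_vI_cone.1 (H.ind _ h1 i) w hw
    rw [sub_ap] at this
    linarith
  refine ⟨fun i x w => (b x i).1 w, fun i => ⟨fun x => ⟨b x i, fun w _ => rfl⟩, ?_, ?_⟩, ?_⟩
  · intro x y w hw
    have := uniq (b (x + y)) (fun i => b x i + b y i) (by
      rw [← hb]; simp only [add_smul, Finset.sum_add_distrib]; rw [← hb, ← hb]) i w hw
    rw [add_ap] at this; exact this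
  · intro a x w hw
    have := uniq (b (a • x)) (fun i => a * b x i) (by
      rw [← hb]; simp only [mul_smul, ← Finset.smul_sum]; rw [← hb]) i w hw
    rw [mul_ap] at this; exact this
  · intro a i w hw
    exact uniq _ _ (hb _).symm i w hw

lemma HB.e_notMem {σ : Cone V} {M : GAMod V} (H : HB (vanishingIdeal V σ.carrier) M) (i : H.ι) : H.e i ∉ mSub V M.M := by
  letI := H.fin
  obtain ⟨c, c1, c2⟩ := H.coordLF
  intro h
  have h1 := (c1 i).mSub_zero h
  have h2 := c2 (fun j => if j = i then 1 else 0) i 0 (Submodule.zero_mem _)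
  beta_reduce at h2
  simp only [ite_smul, one_smul, zero_smul, Finset.sum_ite_eq', Finset.mem_univ, if_true] at h2
  rw [h1, one_ap] at h2
  exact zero_ne_one h2

lemma HB.dg_lt {σ : Cone V} {M : GAMod V} (H : HB (vanishingIdeal V σ.carrier) M) (d : ℤ)
    (hvan : ∀ q : ℤ, d ≤ q → mRedPiece V (M.deg q) = ⊥) (i : H.ι) : H.dg i < d := by
  by_contra hlt
  apply H.e_notMem i
  have h1 : (mSub V M.M).mkQ (H.e i) ∈ mRedPiece V (M.deg (H.dg i)) := ⟨_, H.mem i, rfl⟩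
  rw [hvan _ (not_lt.1 hlt)] at h1
  exact (Submodule.Quotient.mk_eq_zero _).1 h1

lemma neg_scale_zero (N : PolyRing V) (s : ℤ) (hs : s < 0) (w : V)
    (h : ∀ t : ℝ, 0 < t → N.1 (t ^ 2 • w) = t ^ s * N.1 w) : N.1 w = 0 := by
  obtain ⟨n, c, hc, hN⟩ := hom_decomp N
  have := coef_lemma n (fun k => (c k).1 w) s (N.1 w) (by
    intro t ht
    rw [← h t ht]
    conv_rhs => rw [hN]
    rw [sum_ap]
    refine Finset.sum_congr rfl fun k _ => ?_
    rw [hc k (t ^ 2) w, ← pow_mul, mul_comm])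
  rw [this]
  refine Finset.sum_eq_zero fun k _ => if_neg ?_
  omega

lemma K_low {Δ : Fan V} {F : FanSheaf Δ} (hF : Nice F) (σ : Δ.cones)
    (hvan : ∀ q : ℤ, (σ.1.dim : ℤ) ≤ q → mRedPiece V ((F.stalk σ).deg q) = ⊥) (q : ℤ) (hq : q < σ.1.dim)
    (x : (F.stalk σ).M) (hx : x ∈ (F.stalk σ).deg q) (hK : x ∈ KT F σ (facets σ.1)) : x = 0 := by
  obtain ⟨B, hB⟩ := pair_exists hF
  obtain ⟨a, ha, hD⟩ := DT_all hF hB _ σ rfl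
  have H := (hF.hb σ).some
  letI := H.fin
  have h1 : ∀ i, ∀ w ∈ σ.1.spanC, B σ x (H.e i) w = 0 := by
    intro i
    obtain ⟨p, hp⟩ := ((hB σ).lf (H.e i)).poly x
    beta_reduce at hp
    have hv : ∀ τ : Δ.cones, τ.1 ∈ facets σ.1 → ∀ w ∈ τ.1.spanC, p.1 w = 0 := by
      intro τ hτ
      refine cancel_on τ.1.spanC (hP τ.1) p (hP_ne _) fun w hw => ?_
      have := (hB σ).compat τ hτ x (H.e i) w hw
      rw [mem_K.1 hK τ hτ, ((hB τ).lf _).zero hw, mul_zero, hp w (facet_span_le hτ hw), ← hP_ap, mul_comm] at this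
      exact this
    obtain ⟨N, hN⟩ := exists_div_prod σ.1.spanC (nrm σ.1) p (facets σ.1) (by
        intro γ hγ γ' hγ' hne
        obtain ⟨x, hx, h⟩ := facet_form_ne hγ hγ' hne
        exact ⟨x, facet_span_le hγ hx, nrm_zero hγ x hx, h⟩) (fun γ hγ => nrm_ne hγ) (by
        intro γ hγ w hw h
        exact hv ⟨γ, Δ.face_mem _ σ.2 _ (facet_face hγ)⟩ hγ w (mem_facet_span hγ hw h))
    intro w hw
    rw [hp w hw, hN w hw]
    by_cases h0 : ∏ γ ∈ facets σ.1, nrm σ.1 γ w = 0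
    · rw [h0, zero_mul]
    · rw [neg_scale_zero N (q + H.dg i - 2 * σ.1.dim) (by have := H.dg_lt _ hvan i; omega) w, mul_zero]
      intro t ht
      have hw' : t ^ 2 • w ∈ σ.1.spanC := Submodule.smul_mem _ _ hw
      have e1 := (hB σ).hom q (H.dg i) x hx _ (H.mem i) t ht w hw
      rw [hp w hw, hp _ hw', hN w hw, hN _ hw', prod_scale] at e1
      have e2 : t ^ (q + H.dg i + 2 * (facets σ.1).card - 2 * σ.1.dim : ℤ) =
        t ^ (2 * (facets σ.1).card) * t ^ (q + H.dg i - 2 * σ.1.dim : ℤ) := by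
        rw [← zpow_natCast, ← zpow_add₀ ht.ne']; congr 1; push_cast; ring
      rw [e2] at e1
      have e3 : t ^ (2 * (facets σ.1).card) ≠ 0 := (pow_pos ht _).ne'
      refine mul_left_cancel₀ (mul_ne_zero e3 h0) ?_
      linear_combination e1
  have h2 : ∀ y, ∀ w ∈ σ.1.spanC, B σ x y w = 0 := by
    intro y w hw
    obtain ⟨b, rfl⟩ := H.exists_coord y
    rw [((hB σ).lf' x).sum _ _ _ hw]
    exact Finset.sum_eq_zero fun i _ => by rw [h1 i w hw, mul_zero]
  obtain ⟨n, k, c, c1, c2, c3⟩ := dualLF hF σ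
  have := c3 ⟨x, hK⟩ (by
    intro i
    obtain ⟨p, hp⟩ := (c1 i).poly ⟨x, hK⟩
    obtain ⟨y', hy'⟩ := hD (c i) (c1 i)
    have := cancel_on σ.1.spanC (hP σ.1 * a) p ?_ ?_
    · intro w hw; rw [hp w hw, this w hw]
    · obtain ⟨w, hw, h1, h2⟩ := common_nonzero σ.1.spanC (hP σ.1) a (hP_ne _) ⟨0, Submodule.zero_mem _, by rw [ha]; exact one_ne_zero⟩
      exact ⟨w, hw, by rw [mul_ap]; exact mul_ne_zero h1 h2⟩
    · intro w hw
      rw [mul_ap, ← hp w hw, hy' _ w hw]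
      exact h2 y' w hw)
  exact congrArg Subtype.val this

end key

end

section
/-! ### Part G1: uniqueness of minimal extension sheaves -/
section unique
variable {V : Type} [AddCommGroup V] [Module ℝ V] [FiniteDimensional ℝ V]

/-- degree preserving -/
def DP {M N : GAMod V} (f : M.M →ₗ[PolyRing V] N.M) : Prop := ∀ q, ∀ x ∈ M.deg q, f x ∈ N.deg q

lemma DP.reflect {M N : GAMod V} {f : M.M →ₗ[PolyRing V] N.M} (hf : DP f) (hinj : Injective f) {q : ℤ} {x : M.M}
    (hx : f x ∈ N.deg q) : x ∈ M.deg q := by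
  refine eq_of_pr M fun p hp => hinj ?_
  rw [← pr_map f hf, pr_ne N hx hp.symm, map_zero]

lemma HB.dp_of_basis {I : Ideal (PolyRing V)} {M N : GAMod V} (H : HB I M) (f : M.M →ₗ[PolyRing V] N.M)
    (hf : ∀ i, f (H.e i) ∈ N.deg (H.dg i)) : DP f := by
  letI := H.fin
  intro q x hx
  obtain ⟨a, ha⟩ := H.exists_coord x
  obtain ⟨b, hb, h1, h2⟩ := mem_deg_span M H.e H.dg H.mem a q
  rw [← ha, pr_self M hx] at hb
  rw [hb, map_sum]
  refine sum_mem fun i _ => ?_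
  rw [map_smul]
  by_cases h : ∃ k : ℕ, q - H.dg i = 2 * k
  · obtain ⟨k, hk⟩ := h
    have := smul_deg' N (h1 i k hk) (hf i)
    rwa [← hk, add_sub_cancel] at this
  · rw [h2 i (fun k hk => h ⟨k, hk⟩), zero_smul]; exact zero_mem _

/-- half step: a surjective map extending isomorphisms on the boundary -/
lemma half_step {Δ : Fan V} {F F' : FanSheaf Δ} (hF : Nice F) (hF' : Nice F') (c : Δ.cones) (hc : c.1 ≠ zeroCone V)
    (f : ∀ d : Δ.cones, (F.stalk d).M →ₗ[PolyRing V] (F'.stalk d).M)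
    (f' : ∀ d : Δ.cones, (F'.stalk d).M →ₗ[PolyRing V] (F.stalk d).M)
    (hff : ∀ d : Δ.cones, Cone.IsProperFaceOf d.1 c.1 → ∀ x, f d (f' d x) = x)
    (hcomm : ∀ d d' : Δ.cones, Cone.IsProperFaceOf d.1 c.1 → ∀ h : Cone.IsFaceOf d'.1 d.1, ∀ x,
      (F'.res d d' h).toLin (f d x) = f d' ((F.res d d' h).toLin x))
    (hcomm' : ∀ d d' : Δ.cones, Cone.IsProperFaceOf d.1 c.1 → ∀ h : Cone.IsFaceOf d'.1 d.1, ∀ x,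
      (F.res d d' h).toLin (f' d x) = f' d' ((F'.res d d' h).toLin x))
    (hdp : ∀ d : Δ.cones, Cone.IsProperFaceOf d.1 c.1 → DP (f d)) (hdp' : ∀ d : Δ.cones, Cone.IsProperFaceOf d.1 c.1 → DP (f' d)) :
    ∃ g : (F.stalk c).M →ₗ[PolyRing V] (F'.stalk c).M, Surjective g ∧ DP g ∧
      ∀ d : Δ.cones, ∀ h : Cone.IsProperFaceOf d.1 c.1, ∀ x, (F'.res c d h.1).toLin (g x) = f d ((F.res c d h.1).toLin x) := by
  have H := (hF.hb c).some
  letI := H.fin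
  have hpf : ∀ d d' : Δ.cones, Cone.IsProperFaceOf d.1 c.1 → Cone.IsFaceOf d'.1 d.1 → Cone.IsProperFaceOf d'.1 c.1 := by
    intro d d' h h'
    refine ⟨face_trans h' h.1, fun he => h.2 ?_⟩
    rw [he] at h'
    exact face_antisymm h.1 h'
  have trans : ∀ {F F' : FanSheaf Δ} (_ : Nice F') (f : ∀ d : Δ.cones, (F.stalk d).M →ₗ[PolyRing V] (F'.stalk d).M)
      (_ : ∀ d d' : Δ.cones, Cone.IsProperFaceOf d.1 c.1 → ∀ h : Cone.IsFaceOf d'.1 d.1, ∀ x,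
      (F'.res d d' h).toLin (f d x) = f d' ((F.res d d' h).toLin x)) (_ : ∀ d : Δ.cones, Cone.IsProperFaceOf d.1 c.1 → DP (f d))
      (q : ℤ) (x : (F.stalk c).M) (_ : x ∈ (F.stalk c).deg q), ∃ v ∈ (F'.stalk c).deg q,
        ∀ d : Δ.cones, ∀ h : Cone.IsProperFaceOf d.1 c.1, (F'.res c d h.1).toLin v = f d ((F.res c d h.1).toLin x) := by
    intro F F' hF' f hcomm hdp q x hx
    obtain ⟨v, hv⟩ := flabby hF' c {d | Cone.IsProperFaceOf d.1 c.1} (fun d h => h.1) (fun d h d' h' => hpf d d' h h')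
      (fun d => if h : Cone.IsProperFaceOf d.1 c.1 then f d ((F.res c d h.1).toLin x) else 0) (by
        intro d h d' h'
        have h : Cone.IsProperFaceOf d.1 c.1 := h
        beta_reduce
        rw [dif_pos h, dif_pos (hpf d d' h h'), hcomm d d' h, res_res F h.1 h' (hpf d d' h h').1])
    refine ⟨pr _ q v, pr_mem _ _ _, fun d h => ?_⟩
    have h1 := hv d h h.1
    rw [dif_pos h] at h1
    rw [← pr_map _ (F'.res c d h.1).deg_mem, h1, pr_self]
    exact hdp d h q _ ((F.res c d h.1).deg_mem q x hx)
  choose v hv1 hv2 using fun i => trans hF' f hcomm hdp (H.dg i) (H.e i) (H.mem i)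
  obtain ⟨g, hg⟩ := H.lift_hom (fun a ha x => nice_kill hF' c ha x) v
  have hgdp : DP g := H.dp_of_basis g (fun i => by rw [hg]; exact hv1 i)
  have hgc : ∀ d : Δ.cones, ∀ h : Cone.IsProperFaceOf d.1 c.1, ∀ x, (F'.res c d h.1).toLin (g x) = f d ((F.res c d h.1).toLin x) := by
    intro d h x
    obtain ⟨a, rfl⟩ := H.exists_coord x
    simp only [map_sum, map_smul, hg, hv2 _ d h]
  refine ⟨g, ?_, hgdp, hgc⟩
  obtain ⟨q0, hq0⟩ := (hF'.hb c).some.bdd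
  rw [← LinearMap.range_eq_top]
  refine nakayama (F'.stalk c) q0 hq0 _ fun q x hx => ?_
  obtain ⟨u, hu1, hu2⟩ := trans hF f' hcomm' hdp' q x hx
  refine ⟨g u, ⟨u, rfl⟩, hgdp q u hu1, hF'.ker c hc ?_⟩
  rw [ker_bdRes]
  intro d hd
  rw [map_sub, hgc d (facet_proper hd), hu2 d (facet_proper hd), hff d (facet_proper hd), sub_self]

lemma base_step {Δ : Fan V} {F F' : FanSheaf Δ} (hF : F.CondN) (hF' : F'.CondN) :
    ∃ g : (F.stalk Δ.ozero).M →ₗ[PolyRing V] (F'.stalk Δ.ozero).M, Bijective g ∧ DP g := by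
  have f1 : Module.Finite ℝ (F.stalk Δ.ozero).M := Module.finite_of_finrank_pos (by rw [hF.2.1]; exact one_pos)
  have f2 : Module.Finite ℝ (F'.stalk Δ.ozero).M := Module.finite_of_finrank_pos (by rw [hF'.2.1]; exact one_pos)
  let e : (F.stalk Δ.ozero).M ≃ₗ[ℝ] (F'.stalk Δ.ozero).M := LinearEquiv.ofFinrankEq _ _ (by rw [hF.2.1, hF'.2.1])
  have hs : ∀ {F : FanSheaf Δ} (_ : F.CondN) (a : PolyRing V) (x : (F.stalk Δ.ozero).M), a • x = (a.1 0) • x := by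
    intro F hF a x
    have h1 : a - algebraMap ℝ (PolyRing V) (a.1 0) ∈ mId V := by
      rw [mem_mId, sub_ap, alg_ap, sub_self]
    obtain ⟨hF1, -⟩ := hF
    have h3 : (a - algebraMap ℝ (PolyRing V) (a.1 0)) • x = 0 := hF1 (x := x) (a := ⟨_, h1⟩)
    rw [sub_smul, sub_eq_zero, algebraMap_smul] at h3
    exact h3
  refine ⟨{ toFun := e, map_add' := fun x y => map_add e x y, map_smul' := fun a x => ?_ }, e.bijective, ?_⟩
  · rw [RingHom.id_apply, hs hF, hs hF', map_smul]
  · intro q x hx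
    by_cases hq : q = 0
    · subst hq
      refine eq_of_pr _ fun p hp => ?_
      have := pr_mem (F'.stalk Δ.ozero) p (e x)
      rw [hF'.2.2 p hp] at this
      exact this
    · rw [hF.2.2 q hq] at hx
      have hx : x = 0 := hx
      rw [hx, map_zero]; exact zero_mem _

/-- the family is an isomorphism near `c` -/
structure Good {Δ : Fan V} (F F' : FanSheaf Δ) (f : ∀ d : Δ.cones, (F.stalk d).M →ₗ[PolyRing V] (F'.stalk d).M)
    (c : Δ.cones) (g : (F.stalk c).M →ₗ[PolyRing V] (F'.stalk c).M) : Prop where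
  bij : Bijective g
  dp : DP g
  comm : ∀ d : Δ.cones, ∀ h : Cone.IsProperFaceOf d.1 c.1, ∀ x, (F'.res c d h.1).toLin (g x) = f d ((F.res c d h.1).toLin x)

lemma good_step {Δ : Fan V} {F F' : FanSheaf Δ} (hF : Nice F) (hF' : Nice F') (c : Δ.cones)
    (f : ∀ d : Δ.cones, (F.stalk d).M →ₗ[PolyRing V] (F'.stalk d).M)
    (hf : ∀ d : Δ.cones, d.1.dim < c.1.dim → Good F F' f d (f d)) : ∃ g, Good F F' f c g := by
  by_cases hc : c.1 = zeroCone V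
  · have hc' : c = Δ.ozero := Subtype.ext hc
    subst hc'
    obtain ⟨g, h1, h2⟩ := base_step hF.condN hF'.condN
    refine ⟨g, h1, h2, fun d h => ?_⟩
    exact absurd (face_dim_lt h.1 h.2) (by have := zeroCone_dim (V := V); change ¬ _ < (zeroCone V).dim; omega)
  · have hg : ∀ d : Δ.cones, Cone.IsProperFaceOf d.1 c.1 → Good F F' f d (f d) := fun d h => hf d (face_dim_lt h.1 h.2)
    let f' : ∀ d : Δ.cones, (F'.stalk d).M →ₗ[PolyRing V] (F.stalk d).M := fun d =>
      if h : Bijective (f d) then (LinearEquiv.ofBijective (f d) h).symm.toLinearMap else 0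
    have h1 : ∀ d : Δ.cones, Cone.IsProperFaceOf d.1 c.1 → ∀ x, f d (f' d x) = x := by
      intro d h x
      simp only [f', dif_pos (hg d h).bij]
      exact LinearEquiv.apply_symm_apply (LinearEquiv.ofBijective (f d) (hg d h).bij) x
    have h2 : ∀ d : Δ.cones, Cone.IsProperFaceOf d.1 c.1 → ∀ x, f' d (f d x) = x := fun d h x =>
      (hg d h).bij.1 (h1 d h _)
    have hcomm : ∀ d d' : Δ.cones, Cone.IsProperFaceOf d.1 c.1 → ∀ h : Cone.IsFaceOf d'.1 d.1, ∀ x,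
      (F'.res d d' h).toLin (f d x) = f d' ((F.res d d' h).toLin x) := by
      intro d d' hd h x
      by_cases he : d'.1 = d.1
      · have : d' = d := Subtype.ext he
        subst this
        rw [res_id, res_id]
      · exact (hg d hd).comm d' ⟨h, he⟩ x
    have hpf : ∀ d d' : Δ.cones, Cone.IsProperFaceOf d.1 c.1 → Cone.IsFaceOf d'.1 d.1 → Cone.IsProperFaceOf d'.1 c.1 := by
      intro d d' h h'
      refine ⟨face_trans h' h.1, fun he => h.2 ?_⟩
      rw [he] at h'
      exact face_antisymm h.1 h'
    have hcomm' : ∀ d d' : Δ.cones, Cone.IsProperFaceOf d.1 c.1 → ∀ h : Cone.IsFaceOf d'.1 d.1, ∀ x,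
      (F.res d d' h).toLin (f' d x) = f' d' ((F'.res d d' h).toLin x) := by
      intro d d' hd h x
      apply (hg d' (hpf d d' hd h)).bij.1
      rw [← hcomm d d' hd h, h1 d hd, h1 d' (hpf d d' hd h)]
    have hdp' : ∀ d : Δ.cones, Cone.IsProperFaceOf d.1 c.1 → DP (f' d) := by
      intro d hd q x hx
      apply (hg d hd).dp.reflect (hg d hd).bij.1
      rw [h1 d hd]; exact hx
    obtain ⟨g, g1, g2, g3⟩ := half_step hF hF' c hc f f' h1 hcomm hcomm' (fun d hd => (hg d hd).dp) hdp'
    obtain ⟨g', g1', g2', g3'⟩ := half_step hF' hF c hc f' f h2 hcomm' hcomm hdp' (fun d hd => (hg d hd).dp)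
    refine ⟨g, ⟨?_, g1⟩, g2, g3⟩
    have hfin := (hF.hb c).some.finite
    have := OrzechProperty.injective_of_surjective_endomorphism (g' ∘ₗ g) (by
      rw [LinearMap.coe_comp]; exact g1'.comp g1)
    rw [LinearMap.coe_comp] at this
    exact this.of_comp

lemma unique_iso {Δ : Fan V} {F F' : FanSheaf Δ} (hF : Nice F) (hF' : Nice F') :
    ∃ f : ∀ d : Δ.cones, (F.stalk d).M →ₗ[PolyRing V] (F'.stalk d).M, ∀ d, Good F F' f d (f d) := by
  have key : ∀ n : ℕ, ∃ f : ∀ d : Δ.cones, (F.stalk d).M →ₗ[PolyRing V] (F'.stalk d).M,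
      ∀ d : Δ.cones, d.1.dim < n → Good F F' f d (f d) := by
    intro n
    induction n with
    | zero => exact ⟨fun _ => 0, fun d h => absurd h (Nat.not_lt_zero _)⟩
    | succ n ih =>
      obtain ⟨f, hf⟩ := ih
      let f' : ∀ d : Δ.cones, (F.stalk d).M →ₗ[PolyRing V] (F'.stalk d).M := fun d =>
        if d.1.dim < n then f d else if h : ∃ g, Good F F' f d g then h.choose else 0
      have hlt : ∀ d : Δ.cones, d.1.dim < n → f' d = f d := fun d h => by simp only [f', if_pos h]
      have hgood : ∀ d : Δ.cones, d.1.dim < n + 1 → Good F F' f d (f' d) := by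
        intro d hd
        by_cases h : d.1.dim < n
        · rw [hlt d h]; exact hf d h
        · have hex := good_step hF hF' d f (fun d' h' => hf d' (by omega))
          simp only [f', if_neg h, dif_pos hex]
          exact hex.choose_spec
      refine ⟨f', fun d hd => ⟨(hgood d hd).bij, (hgood d hd).dp, fun d' h' x => ?_⟩⟩
      rw [(hgood d hd).comm d' h' x, hlt d' (by have := face_dim_lt h'.1 h'.2; omega)]
  obtain ⟨n, hn⟩ : ∃ n, ∀ d ∈ Δ.cones, d.dim < n := by
    obtain ⟨n, hn⟩ := (Δ.finite.image Cone.dim).bddAbove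
    exact ⟨n + 1, fun d hd => Nat.lt_succ_of_le (hn ⟨d, hd, rfl⟩)⟩
  obtain ⟨f, hf⟩ := key n
  exact ⟨f, fun d => hf d (hn d.1 d.2)⟩

/-- global sections of two nice sheaves agree -/
lemma global_iso {Δ : Fan V} {F F' : FanSheaf Δ} (hF : Nice F) (hF' : Nice F') :
    ∃ Φ : F.globalSec →ₗ[PolyRing V] F'.globalSec, Bijective Φ ∧
      ∀ q x, x ∈ F.secDeg Δ.cones q ↔ Φ x ∈ F'.secDeg Δ.cones q := by
  obtain ⟨f, hf⟩ := unique_iso hF hF'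
  have hcomm : ∀ d d' : Δ.cones, ∀ h : Cone.IsFaceOf d'.1 d.1, ∀ x,
      (F'.res d d' h).toLin (f d x) = f d' ((F.res d d' h).toLin x) := by
    intro d d' h x
    by_cases he : d'.1 = d.1
    · have : d' = d := Subtype.ext he
      subst this
      rw [res_id, res_id]
    · exact (hf d).comm d' ⟨h, he⟩ x
  let Φ : F.globalSec →ₗ[PolyRing V] F'.globalSec :=
    { toFun := fun s => ⟨fun d => f d (s.1 d), fun d hd => absurd d.2 hd, fun d d' hd hd' h => by
        rw [hcomm, s.2.2 d d' hd hd' h]⟩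
      map_add' := fun s t => Subtype.ext (funext fun d => map_add (f d) (s.1 d) (t.1 d))
      map_smul' := fun a s => Subtype.ext (funext fun d => map_smul (f d) a (s.1 d)) }
  have hΦ : ∀ s d, (Φ s).1 d = f d (s.1 d) := fun _ _ => rfl
  refine ⟨Φ, ⟨fun s t h => ?_, fun t => ?_⟩, fun q s => ⟨fun h d => (hf d).dp q _ (h d), fun h d => (hf d).dp.reflect (hf d).bij.1 (h d)⟩⟩
  · apply Subtype.ext; funext d
    apply (hf d).bij.1
    rw [← hΦ, ← hΦ, h]
  · choose u hu using fun d => (hf d).bij.2 (t.1 d)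
    refine ⟨⟨u, fun d hd => absurd d.2 hd, fun d d' hd hd' h => ?_⟩, ?_⟩
    · apply (hf d').bij.1
      rw [← hcomm d d' h, hu, hu, t.2.2 d d' hd hd' h]
    · apply Subtype.ext; funext d
      rw [hΦ]; exact hu d

end unique

end

section

variable {V : Type} [AddCommGroup V] [Module ℝ V] {U : Type} [AddCommGroup U] [Module ℝ U]

/-- a `GAMod V` seen as a `GAMod U` along a linear map `V → U` -/
def pushM (g : V →ₗ[ℝ] U) (M : GAMod V) : GAMod U :=
  letI m1 : Module (PolyRing U) M.M := Module.compHom M.M (pull g : PolyRing U →ₐ[ℝ] PolyRing V).toRingHom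
  letI t1 : IsScalarTower ℝ (PolyRing U) M.M := ⟨fun r a x => by
    change (pull g (r • a)) • x = r • (pull g a • x)
    rw [map_smul, smul_assoc]⟩
  { M := M.M
    acg := M.acg
    modA := m1
    modR := M.modR
    tower := t1
    deg := M.deg
    internal := M.internal
    smul_deg := fun p q a ha x hx => by
      have h1 : Adeg U p ≤ (Adeg V p).comap (pull g : PolyRing U →ₐ[ℝ] PolyRing V).toLinearMap := by
        unfold Adeg
        refine iSup_le fun k => iSup_le fun hk => ?_
        intro b hb
        exact Submodule.mem_iSup_of_mem k (Submodule.mem_iSup_of_mem hk (pull_AdegN g hb))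
      exact M.smul_deg p q (pull g a) (h1 ha) x hx }

lemma pushH_aux (g : V →ₗ[ℝ] U) {M N : GAMod V} (f : M.M →ₗ[PolyRing V] N.M) (a : PolyRing U) (x : M.M) :
    f (pull g a • x) = pull g a • f x := map_smul f _ x

def pushH (g : V →ₗ[ℝ] U) {M N : GAMod V} (f : GHom M N) : GHom (pushM g M) (pushM g N) where
  toLin :=
    { toFun := f.toLin
      map_add' := f.toLin.map_add
      map_smul' := pushH_aux g f.toLin }
  deg_mem := f.deg_mem

structure BK (g : V →ₗ[ℝ] U) (Δ : Fan V) (Λ : Fan U) where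
  back : Λ.cones → Δ.cones
  car : ∀ c, c.1.carrier = g '' (back c).1.carrier
  inj : ∀ c, ∀ x ∈ (back c).1.spanC, g x = 0 → x = 0
  face : ∀ c c', Cone.IsFaceOf c.1 c'.1 ↔ Cone.IsFaceOf (back c).1 (back c').1
  down : ∀ c, ∀ τ : Δ.cones, Cone.IsFaceOf τ.1 (back c).1 → ∃ c', back c' = τ
  injective : Injective back

variable {g : V →ₗ[ℝ] U} {Δ : Fan V} {Λ : Fan U}

def pushF (B : BK g Δ Λ) (F : FanSheaf Δ) : FanSheaf Λ where
  stalk c := pushM g (F.stalk (B.back c))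
  res c c' h := pushH g (F.res (B.back c) (B.back c') ((B.face _ _).1 h))
  res_self c h := by
    apply LinearMap.ext
    intro x
    exact res_id F _ x
  res_comp c c' c'' h1 h2 h3 := by
    apply LinearMap.ext
    intro x
    exact res_res F _ _ _ x

def up (B : BK g Δ Λ) (F : FanSheaf Δ) (c : Λ.cones) (x : (F.stalk (B.back c)).M) : ((pushF B F).stalk c).M := x
def dn (B : BK g Δ Λ) (F : FanSheaf Δ) (c : Λ.cones) (x : ((pushF B F).stalk c).M) : (F.stalk (B.back c)).M := x

lemma up_add (B : BK g Δ Λ) (F : FanSheaf Δ) (c : Λ.cones) (x y : (F.stalk (B.back c)).M) :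
    up B F c (x + y) = up B F c x + up B F c y := rfl
lemma up_smul (B : BK g Δ Λ) (F : FanSheaf Δ) (c : Λ.cones) (a : PolyRing U) (x : (F.stalk (B.back c)).M) :
    up B F c (pull g a • x) = a • up B F c x := rfl
lemma res_up (B : BK g Δ Λ) (F : FanSheaf Δ) (c c' : Λ.cones) (h : Cone.IsFaceOf c'.1 c.1) (x : (F.stalk (B.back c)).M) :
    ((pushF B F).res c c' h).toLin (up B F c x) = up B F c' ((F.res _ _ ((B.face _ _).1 h)).toLin x) := rfl

lemma ext_dep {I J : Type*} {M : J → Type*} [∀ j, Zero (M j)] (b : I → J) (hb : Injective b) (s : ∀ i, M (b i)) :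
    ∃ y : ∀ j, M j, ∀ i, y (b i) = s i := by
  refine ⟨fun j => if h : ∃ i, b i = j then h.choose_spec ▸ s h.choose else 0, fun i => ?_⟩
  have h : ∃ i', b i' = b i := ⟨i, rfl⟩
  beta_reduce
  rw [dif_pos h]
  have key : ∀ i' (hi' : b i' = b i), (hi' ▸ s i' : M (b i)) = s i := by
    intro i' hi'
    obtain rfl := hb hi'
    rfl
  exact key _ h.choose_spec

lemma BK.proper (B : BK g Δ Λ) (c c' : Λ.cones) : Cone.IsProperFaceOf c.1 c'.1 ↔ Cone.IsProperFaceOf (B.back c).1 (B.back c').1 := by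
  unfold Cone.IsProperFaceOf
  rw [B.face]
  refine and_congr Iff.rfl (not_congr ?_)
  constructor
  · intro h; rw [Subtype.ext h]
  · intro h; rw [B.injective (Subtype.ext h)]

lemma BK.replace (B : BK g Δ Λ) {F : FanSheaf Δ} (hF : Nice F) (c : Λ.cones) (a : PolyRing V) :
    ∃ b : PolyRing U, b.1 0 = a.1 0 ∧ ∀ x : (F.stalk (B.back c)).M, a • x = pull g b • x := by
  have h0 : LinearMap.ker (g ∘ₗ (B.back c).1.spanC.subtype) = ⊥ := by
    rw [LinearMap.ker_eq_bot']
    intro x hx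
    exact Subtype.ext (B.inj c x.1 x.2 hx)
  obtain ⟨k, hk⟩ := LinearMap.exists_leftInverse_of_injective _ h0
  refine ⟨pull ((B.back c).1.spanC.subtype ∘ₗ k) a, ?_, fun x => ?_⟩
  · rw [pull_ap, map_zero]
  · rw [← sub_eq_zero, ← sub_smul]
    refine (hF.hb (B.back c)).some.kill _ ?_ x
    rw [mem_vI_cone]
    intro w hw
    rw [sub_ap, pull_ap, pull_ap]
    have := LinearMap.congr_fun hk ⟨w, hw⟩
    have h2 : k (g w) = ⟨w, hw⟩ := this
    rw [LinearMap.comp_apply, h2, sub_eq_zero]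
    rfl

lemma BK.mSub_le (B : BK g Δ Λ) {F : FanSheaf Δ} (hF : Nice F) (c : Λ.cones) (x : (F.stalk (B.back c)).M)
    (hx : x ∈ mSub V (F.stalk (B.back c)).M) : up B F c x ∈ mSub U ((pushF B F).stalk c).M := by
  rw [mSub] at hx
  refine Submodule.smul_induction_on (p := fun x => up B F c x ∈ mSub U ((pushF B F).stalk c).M) hx ?_ ?_
  · intro a ha y _
    obtain ⟨b, hb0, hb⟩ := B.replace hF c a
    rw [hb y, up_smul]
    exact smul_mem_mSub (by rw [mem_mId, hb0]; exact ha) _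
  · intro y z hy hz
    rw [up_add]
    exact add_mem hy hz

lemma BK.zero (B : BK g Δ Λ) (c : Λ.cones) : c.1 = zeroCone U ↔ (B.back c).1 = zeroCone V := by
  constructor
  · intro h
    apply cone_ext
    ext x
    constructor
    · intro hx
      refine B.inj c x (carrier_sub_span _ hx) ?_
      have : g x ∈ c.1.carrier := by rw [B.car]; exact ⟨x, hx, rfl⟩
      rw [h] at this
      exact this
    · rintro rfl
      exact cone_zero _
  · intro h
    apply cone_ext
    rw [B.car, h]
    change g '' {0} = {0}
    simp

def BK.hb (B : BK g Δ Λ) {F : FanSheaf Δ} (hF : Nice F) (c : Λ.cones) (H : HB (vanishingIdeal V (B.back c).1.carrier) (F.stalk (B.back c))) :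
    HB (vanishingIdeal U c.1.carrier) ((pushF B F).stalk c) where
  ι := H.ι
  fin := H.fin
  e := H.e
  dg := H.dg
  mem := H.mem
  span := by
    letI := H.fin
    rw [eq_top_iff]
    intro x _
    obtain ⟨a, ha⟩ := H.exists_coord x
    choose b hb0 hb using fun i => B.replace hF c (a i)
    have h2 : x = ∑ i, (b i) • up B F c (H.e i) := by
      refine ha.trans ?_
      exact Finset.sum_congr rfl fun i _ => hb i (H.e i)
    rw [h2]
    exact sum_mem fun i _ => Submodule.smul_mem _ _ (Submodule.subset_span ⟨i, rfl⟩)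
  kill a ha x := by
    refine H.kill (pull g a) ?_ x
    rw [mem_vI] at ha ⊢
    intro w hw
    rw [pull_ap]
    exact ha _ (by rw [B.car]; exact ⟨w, hw, rfl⟩)
  ind a ha i := by
    have h1 := H.ind (fun i => pull g (a i)) ha i
    rw [mem_vI] at h1 ⊢
    intro w hw
    rw [B.car] at hw
    obtain ⟨w, hw, rfl⟩ := hw
    exact h1 w hw

lemma BK.nice [FiniteDimensional ℝ V] (B : BK g Δ Λ) {F : FanSheaf Δ} (hF : Nice F) : Nice (pushF B F) where
  condN := by
    have h0 : B.back Λ.ozero = Δ.ozero := Subtype.ext ((B.zero _).1 rfl)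
    have key : ∀ τ : Δ.cones, τ = Δ.ozero → (∀ a ∈ mId V, ∀ x : (F.stalk τ).M, a • x = 0) ∧
        finrank ℝ (F.stalk τ).M = 1 ∧ ∀ q : ℤ, q ≠ 0 → (F.stalk τ).deg q = ⊥ := by
      rintro _ rfl
      obtain ⟨hN1, hN2⟩ := hF.condN
      exact ⟨fun a ha x => hN1 (x := x) (a := ⟨a, ha⟩), hN2⟩
    obtain ⟨k1, k2, k3⟩ := key _ h0
    refine ⟨?_, k2, k3⟩
    intro x a
    exact k1 (pull g a.1) (by rw [mem_mId, pull_ap, map_zero]; exact a.2) x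
  hb c := ⟨B.hb hF c (hF.hb _).some⟩
  surj c := by
    intro y
    obtain ⟨Y, hY⟩ := ext_dep (M := fun τ => (F.stalk τ).M) B.back B.injective (fun c' => dn B F c' (y.1 c'))
    have key := flabby hF (B.back c) {τ | ∃ c', Cone.IsProperFaceOf c'.1 c.1 ∧ B.back c' = τ} ?_ ?_ Y ?_
    · obtain ⟨x, hx⟩ := key
      refine ⟨up B F c x, ?_⟩
      apply Subtype.ext
      funext c'
      by_cases h : Cone.IsProperFaceOf c'.1 c.1
      · rw [bdRes_ap _ _ _ _ h]
        have := hx (B.back c') ⟨c', h, rfl⟩ ((B.face _ _).1 h.1)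
        rw [hY] at this
        rw [res_up, this]
        rfl
      · rw [y.2.1 c' h]
        exact (((pushF B F).bdRes c) (up B F c x)).2.1 c' h
    · rintro _ ⟨c', h, rfl⟩
      exact (B.face _ _).1 h.1
    · rintro _ ⟨c', h, rfl⟩ υ hυ
      obtain ⟨c'', rfl⟩ := B.down c' υ hυ
      refine ⟨c'', ?_, rfl⟩
      have h1 := (B.face c'' c').2 hυ
      refine ⟨face_trans h1 h.1, fun he => h.2 ?_⟩
      rw [he] at h1
      exact face_antisymm h.1 h1
    · rintro _ ⟨c', h, rfl⟩ υ hυ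
      obtain ⟨c'', rfl⟩ := B.down c' υ hυ
      rw [hY, hY]
      change _ = up B F c'' _
      have h1 := (B.face c'' c').2 hυ
      refine y.2.2 c' c'' h ?_ h1
      refine ⟨face_trans h1 h.1, fun he => h.2 ?_⟩
      rw [he] at h1
      exact face_antisymm h.1 h1
  ker c h0 := by
    intro x hx
    rw [LinearMap.mem_ker] at hx
    refine B.mSub_le hF c (dn B F c x) (hF.ker (B.back c) (fun h => h0 ((B.zero c).2 h)) ?_)
    rw [LinearMap.mem_ker]
    apply Subtype.ext
    funext τ
    by_cases h : Cone.IsProperFaceOf τ.1 (B.back c).1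
    · obtain ⟨c', rfl⟩ := B.down c τ h.1
      rw [bdRes_ap _ _ _ _ h]
      have h1 : (((pushF B F).bdRes c) x).1 c' = 0 := by rw [hx]; rfl
      rw [bdRes_ap _ _ _ _ ((B.proper _ _).2 h)] at h1
      exact h1
    · exact (F.bdRes (B.back c) (dn B F c x)).2.1 τ h

end

section

variable {V : Type} [AddCommGroup V] [Module ℝ V]

lemma flat_eq {σ : Cone V} {l : V} (hl : l ∈ σ.carrier)
    (hlrel : ∀ τ : Cone V, τ.IsProperFaceOf σ → l ∉ τ.carrier) {τ τ' : Cone V} (h : τ.IsProperFaceOf σ)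
    (h' : τ'.IsProperFaceOf σ) {x x' : V} (hx : x ∈ τ.carrier) (hx' : x' ∈ τ'.carrier)
    (he : (Submodule.span ℝ {l}).mkQ x = (Submodule.span ℝ {l}).mkQ x') : x = x' := by
  have key : ∀ {τ τ' : Cone V} (_ : τ.IsProperFaceOf σ) (_ : τ'.IsProperFaceOf σ) {x x' : V}
      (_ : x ∈ τ.carrier) (_ : x' ∈ τ'.carrier) (s : ℝ) (_ : 0 < s) (_ : x = x' + s • l), False := by
    intro τ τ' h h' x x' hx hx' s hs he
    obtain ⟨f, hf, hfe⟩ := h.1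
    have h1 := ((face_mem_iff hfe).1 hx).2
    have h2 := hf x' (face_sub h'.1 hx')
    have h3 := hf l hl
    rw [he, map_add, map_smul, smul_eq_mul] at h1
    have h4 : f l = 0 := by
      rcases h3.eq_or_lt with h | h
      · exact h.symm
      · have := mul_pos hs h
        linarith
    exact hlrel τ h ((face_mem_iff hfe).2 ⟨hl, h4⟩)
  have h1 : x - x' ∈ Submodule.span ℝ {l} := by
    rw [← Submodule.Quotient.eq]
    exact he
  obtain ⟨s, hs⟩ := Submodule.mem_span_singleton.1 h1
  rcases lt_trichotomy s 0 with h0 | h0 | h0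
  · exfalso
    refine key h' h hx' hx (-s) (by linarith) ?_
    rw [neg_smul, hs]; abel
  · rw [h0, zero_smul] at hs
    exact (sub_eq_zero.1 hs.symm)
  · exfalso
    refine key h h' hx hx' s h0 ?_
    rw [hs]; abel

lemma img_cone {U : Type} [AddCommGroup U] [Module ℝ U] (g : V →ₗ[ℝ] U) (τ : Cone V)
    (hinj : ∀ x ∈ τ.carrier, ∀ y ∈ τ.carrier, g x = g y → x = y) : ∃ c : Cone U, c.carrier = g '' τ.carrier := by
  refine ⟨⟨g '' τ.carrier, ?_, ?_⟩, rfl⟩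
  · obtain ⟨s, hs⟩ := τ.isPoly
    refine ⟨s.image g, ?_⟩
    have hio : Set.InjOn g (s : Set V) := fun x hx y hy h => hinj x (gen_sub hs hx) y (gen_sub hs hy) h
    ext u
    constructor
    · rintro ⟨x, hx, rfl⟩
      rw [hs] at hx
      obtain ⟨c, hc, rfl⟩ := hx
      refine ⟨fun u => c (Function.invFunOn g (s : Set V) u), ?_, ?_⟩
      · intro u hu
        obtain ⟨v, hv, rfl⟩ := Finset.mem_image.1 hu
        beta_reduce
        rw [hio.leftInvOn_invFunOn hv]
        exact hc v hv
      · rw [Finset.sum_image (fun x hx y hy h => hio hx hy h), map_sum]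
        refine Finset.sum_congr rfl fun v hv => ?_
        beta_reduce
        rw [hio.leftInvOn_invFunOn hv, map_smul]
    · rintro ⟨c, hc, rfl⟩
      refine ⟨∑ v ∈ s, c (g v) • v, ?_, ?_⟩
      · rw [hs]
        exact ⟨fun v => c (g v), fun v hv => hc _ (Finset.mem_image_of_mem _ hv), rfl⟩
      · rw [Finset.sum_image (fun x hx y hy h => hio hx hy h), map_sum]
        simp only [map_smul]
  · rintro _ ⟨x, hx, rfl⟩ ⟨y, hy, hxy⟩
    have h1 : x + y = 0 := hinj _ (cone_add τ hx hy) _ (cone_zero τ) (by rw [map_add, hxy, map_zero]; abel)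
    have h2 : x = 0 := τ.pointed x hx (by rw [← eq_neg_of_add_eq_zero_right h1]; exact hy)
    rw [h2, map_zero]

lemma exists_BK {σ : Cone V} {Δσ : Fan V} (hΔσ : Δσ.cones = {τ : Cone V | τ.IsFaceOf σ})
    (l : V) (hl : l ∈ σ.carrier) (hlrel : ∀ τ : Cone V, τ.IsProperFaceOf σ → l ∉ τ.carrier)
    (Λ : Fan (V ⧸ Submodule.span ℝ {l}))
    (hΛ : Λ.cones = {c : Cone (V ⧸ Submodule.span ℝ {l}) |
      ∃ τ : Cone V, τ.IsProperFaceOf σ ∧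
        c.carrier = (Submodule.span ℝ {l}).mkQ '' τ.carrier}) :
    ∃ B : BK (Submodule.span ℝ {l}).mkQ Δσ Λ, ∀ τ : Δσ.cones, Cone.IsProperFaceOf τ.1 σ ↔ ∃ c, B.back c = τ := by
  have hsub : ∀ {τ τ' : Cone V} (_ : τ.IsProperFaceOf σ) (_ : τ'.IsProperFaceOf σ)
      (_ : (Submodule.span ℝ {l}).mkQ '' τ.carrier ⊆ (Submodule.span ℝ {l}).mkQ '' τ'.carrier), τ.carrier ⊆ τ'.carrier := by
    intro τ τ' h h' hs x hx
    obtain ⟨x', hx', he⟩ := hs ⟨x, hx, rfl⟩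
    rw [← flat_eq hl hlrel h' h hx' hx he]
    exact hx'
  have hex : ∀ c : Λ.cones, ∃ τ : Δσ.cones, Cone.IsProperFaceOf τ.1 σ ∧ c.1.carrier = (Submodule.span ℝ {l}).mkQ '' τ.1.carrier := by
    intro c
    have h : c.1 ∈ {c : Cone (V ⧸ Submodule.span ℝ {l}) | ∃ τ : Cone V, τ.IsProperFaceOf σ ∧
        c.carrier = (Submodule.span ℝ {l}).mkQ '' τ.carrier} := hΛ ▸ c.2
    obtain ⟨τ, h1, h2⟩ := h
    exact ⟨⟨τ, by rw [hΔσ]; exact h1.1⟩, h1, h2⟩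
  choose back hp hcar using hex
  have hall : ∀ τ : Δσ.cones, Cone.IsProperFaceOf τ.1 σ → ∃ c, back c = τ := by
    intro τ hτ
    obtain ⟨c, hc⟩ := img_cone (Submodule.span ℝ {l}).mkQ τ.1 (fun x hx y hy h => flat_eq hl hlrel hτ hτ hx hy h)
    have hcm : c ∈ Λ.cones := by rw [hΛ]; exact ⟨τ.1, hτ, hc⟩
    refine ⟨⟨c, hcm⟩, ?_⟩
    have h1 := hcar ⟨c, hcm⟩
    change c.carrier = _ at h1
    rw [hc] at h1
    apply Subtype.ext
    apply cone_ext
    exact Set.Subset.antisymm (hsub (hp _) hτ h1.symm.subset) (hsub hτ (hp _) h1.subset)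
  refine ⟨{ back := back, car := hcar, inj := ?_, face := ?_, down := ?_, injective := ?_ }, fun τ => ⟨hall τ, ?_⟩⟩
  · intro c x hx h0
    have h1 : x ∈ Submodule.span ℝ {l} := (Submodule.Quotient.mk_eq_zero _).1 h0
    obtain ⟨s, rfl⟩ := Submodule.mem_span_singleton.1 h1
    by_cases hs : s = 0
    · rw [hs, zero_smul]
    · exfalso
      have h2 : l ∈ (back c).1.spanC := by
        have := Submodule.smul_mem _ s⁻¹ hx
        rwa [smul_smul, inv_mul_cancel₀ hs, one_smul] at this
      exact hlrel _ (hp c) (face_inter_span (hp c).1 hl h2)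
  · intro c c'
    constructor
    · intro h
      refine face_of_sub (hp c).1 (hp c').1 (hsub (hp c) (hp c') ?_)
      rw [← hcar, ← hcar]
      exact face_sub h
    · intro h
      have h1 : c.1.carrier ⊆ c'.1.carrier := by
        rw [hcar, hcar]
        exact Set.image_mono (face_sub h)
      obtain ⟨ρ, _, -, h2, h3⟩ := Λ.inter_mem _ c.2 _ c'.2
      rw [Set.inter_eq_left.2 h1] at h3
      rw [← cone_ext h3]
      exact h2
  · intro c τ h
    refine hall τ ⟨face_trans h (hp c).1, fun he => ?_⟩
    rw [he] at h
    exact hlrel _ (hp c) (face_sub h hl)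
  · intro c c' h
    apply Subtype.ext
    apply cone_ext
    rw [hcar, hcar, h]
  · rintro ⟨c, rfl⟩
    exact hp c

/-! ### the restriction to the flattened boundary -/

variable {U : Type} [AddCommGroup U] [Module ℝ U] {g : V →ₗ[ℝ] U} {Δ : Fan V} {Λ : Fan U}

lemma res_real (F : FanSheaf Δ) {σ τ : Δ.cones} (h : Cone.IsFaceOf τ.1 σ.1) (r : ℝ) (x : (F.stalk σ).M) :
    (F.res σ τ h).toLin (r • x) = r • (F.res σ τ h).toLin x := by
  rw [real_smul (V := V) r x, map_smul, ← real_smul (V := V)]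

/-- restriction of a stalk to the sections of the push-forward -/
def Tm (B : BK g Δ Λ) (F : FanSheaf Δ) (σ : Δ.cones) (h : ∀ c, Cone.IsFaceOf (B.back c).1 σ.1) :
    (F.stalk σ).M →ₗ[ℝ] (pushF B F).globalSec where
  toFun x := ⟨fun c => up B F c ((F.res σ (B.back c) (h c)).toLin x), fun c hc => absurd c.2 hc, fun c c' _ _ hf => by
    rw [res_up, res_res F _ _ (h c')]⟩
  map_add' x y := Subtype.ext (funext fun c => map_add (F.res σ (B.back c) (h c)).toLin x y)
  map_smul' r x := Subtype.ext (funext fun c => res_real F (h c) r x)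

lemma Tm_ap (B : BK g Δ Λ) (F : FanSheaf Δ) (σ : Δ.cones) (h : ∀ c, Cone.IsFaceOf (B.back c).1 σ.1) (x : (F.stalk σ).M)
    (c : Λ.cones) : (Tm B F σ h x).1 c = up B F c ((F.res σ (B.back c) (h c)).toLin x) := rfl

lemma Tm_smul (B : BK g Δ Λ) (F : FanSheaf Δ) (σ : Δ.cones) (h : ∀ c, Cone.IsFaceOf (B.back c).1 σ.1) (x : (F.stalk σ).M)
    (b : PolyRing U) : Tm B F σ h (pull g b • x) = b • Tm B F σ h x := by
  apply Subtype.ext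
  funext c
  rw [Tm_ap, map_smul, up_smul]
  rfl

lemma Tm_deg (B : BK g Δ Λ) (F : FanSheaf Δ) (σ : Δ.cones) (h : ∀ c, Cone.IsFaceOf (B.back c).1 σ.1) (x : (F.stalk σ).M)
    (q : ℤ) (hx : x ∈ (F.stalk σ).deg q) : Tm B F σ h x ∈ (pushF B F).secDeg Λ.cones q := by
  intro c
  exact (F.res σ (B.back c) (h c)).deg_mem q x hx

variable [FiniteDimensional ℝ V]

lemma Tm_surj (B : BK g Δ Λ) {F : FanSheaf Δ} (hF : Nice F) (σ : Δ.cones) (h : ∀ c, Cone.IsFaceOf (B.back c).1 σ.1)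
    (q : ℤ) (y : (pushF B F).globalSec) (hy : y ∈ (pushF B F).secDeg Λ.cones q) :
    ∃ x ∈ (F.stalk σ).deg q, Tm B F σ h x = y := by
  obtain ⟨Y, hY⟩ := ext_dep (M := fun τ => (F.stalk τ).M) B.back B.injective (fun c' => dn B F c' (y.1 c'))
  have key := flabby hF σ (Set.range B.back) ?_ ?_ Y ?_
  · obtain ⟨x, hx⟩ := key
    refine ⟨pr _ q x, pr_mem _ _ _, ?_⟩
    apply Subtype.ext
    funext c
    rw [Tm_ap, ← pr_map _ (F.res σ (B.back c) (h c)).deg_mem, hx _ ⟨c, rfl⟩, hY, pr_self (F.stalk (B.back c)) (x := dn B F c (y.1 c)) (hy c)]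
    rfl
  · rintro _ ⟨c, rfl⟩
    exact h c
  · rintro _ ⟨c, rfl⟩ υ hυ
    obtain ⟨c'', rfl⟩ := B.down c υ hυ
    exact ⟨c'', rfl⟩
  · rintro _ ⟨c, rfl⟩ υ hυ
    obtain ⟨c'', rfl⟩ := B.down c υ hυ
    rw [hY, hY]
    exact y.2.2 c c'' c.2 c''.2 ((B.face _ _).2 hυ)

lemma Tm_zero (B : BK g Δ Λ) {F : FanSheaf Δ} (σ : Δ.cones) (h : ∀ c, Cone.IsFaceOf (B.back c).1 σ.1)
    (hall : ∀ τ : Δ.cones, Cone.IsProperFaceOf τ.1 σ.1 → ∃ c, B.back c = τ)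
    (x : (F.stalk σ).M) (hx : Tm B F σ h x = 0) : x ∈ KT F σ (facets σ.1) := by
  rw [← K_eq, ker_bdRes]
  intro τ hτ
  obtain ⟨c, rfl⟩ := hall τ (facet_proper hτ)
  have h1 : (Tm B F σ h x).1 c = 0 := by rw [hx]; rfl
  exact h1

end

section

variable {V : Type} [AddCommGroup V] [Module ℝ V] {U : Type} [AddCommGroup U] [Module ℝ U]

lemma finrank_map_eq {M A B : Type*} [AddCommGroup M] [Module ℝ M] [AddCommGroup A] [Module ℝ A]
    [AddCommGroup B] [Module ℝ B] (p : Submodule ℝ M) (f : M →ₗ[ℝ] A) (g : M →ₗ[ℝ] B)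
    (h : ∀ x ∈ p, f x = 0 ↔ g x = 0) : finrank ℝ (p.map f) = finrank ℝ (p.map g) := by
  have h1 : LinearMap.ker (f.domRestrict p) = LinearMap.ker (g.domRestrict p) := by
    ext x
    exact h x.1 x.2
  have e1 := (f.domRestrict p).quotKerEquivRange.finrank_eq
  have e2 := (g.domRestrict p).quotKerEquivRange.finrank_eq
  rw [LinearMap.range_domRestrict] at e1 e2
  rw [← e1, ← e2, h1]

def coordSub {ι : Type} (P : ι → Prop) : Submodule ℝ (ι → ℝ) where
  carrier := {v | ∀ i, ¬ P i → v i = 0}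
  add_mem' := by intro a b ha hb i hi; simp [ha i hi, hb i hi]
  zero_mem' := fun _ _ => rfl
  smul_mem' := by intro c a ha i hi; simp [ha i hi]

lemma finrank_coordSub {ι : Type} [Fintype ι] (P : ι → Prop) :
    finrank ℝ (coordSub P) = (Finset.univ.filter P).card := by
  let e : coordSub P ≃ₗ[ℝ] ({i // P i} → ℝ) :=
    { toFun := fun v i => v.1 i.1
      map_add' := fun _ _ => rfl
      map_smul' := fun _ _ => rfl
      invFun := fun v => ⟨fun i => if h : P i then v ⟨i, h⟩ else 0, fun i hi => by simp [hi]⟩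
      left_inv := fun v => by
        apply Subtype.ext
        funext i
        by_cases h : P i
        · simp [h]
        · simp [h, v.2 i h]
      right_inv := fun v => by
        funext i
        simp [i.2] }
  rw [e.finrank_eq, Module.finrank_fintype_fun_eq_card, Fintype.card_subtype]

variable [FiniteDimensional ℝ V]

/-- homogeneous coordinates of a homogeneous element -/
lemma HB.hom_coord {I : Ideal (PolyRing V)} {M : GAMod V} (H : HB I M) {q : ℤ} {x : M.M} (hx : x ∈ M.deg q) :
    ∃ b : H.ι → PolyRing V, x = (letI := H.fin; ∑ i, b i • H.e i) ∧
      (∀ i, ∀ k : ℕ, q - H.dg i = 2 * k → b i ∈ AdegN V k) ∧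
      (∀ i, (∀ k : ℕ, q - H.dg i ≠ 2 * k) → b i = 0) := by
  letI := H.fin
  obtain ⟨a, ha⟩ := H.exists_coord x
  obtain ⟨b, hb, h1, h2⟩ := mem_deg_span M H.e H.dg H.mem a q
  exact ⟨b, by rw [← hb, ← ha, pr_self M hx], h1, h2⟩

lemma HB.theta {σ : Cone V} {M : GAMod V} (H : HB (vanishingIdeal V σ.carrier) M) (w : V) (hw : w ∈ σ.spanC) :
    ∃ θ : M.M →ₗ[ℝ] (H.ι → ℝ), (∀ (b : H.ι → PolyRing V) i, θ (letI := H.fin; ∑ i, b i • H.e i) i = (b i).1 w) ∧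
      ∀ (a : PolyRing V) x, θ (a • x) = a.1 w • θ x := by
  obtain ⟨c, c1, c2⟩ := H.coordLF
  refine ⟨{ toFun := fun x i => c i x w, map_add' := ?_, map_smul' := ?_ }, ?_, ?_⟩
  · intro x y
    funext i
    exact (c1 i).add x y w hw
  · intro r x
    funext i
    change c i (r • x) w = r * c i x w
    rw [real_smul (V := V), (c1 i).smul _ _ w hw, alg_ap]
  · intro b i
    exact c2 b i w hw
  · intro a x
    funext i
    exact (c1 i).smul a x w hw

lemma HB.mem_mSub_iff {σ : Cone V} {M : GAMod V} (H : HB (vanishingIdeal V σ.carrier) M)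
    (θ : M.M →ₗ[ℝ] (H.ι → ℝ)) (h1 : ∀ (b : H.ι → PolyRing V) i, θ (letI := H.fin; ∑ i, b i • H.e i) i = (b i).1 0)
    (h2 : ∀ (a : PolyRing V) x, θ (a • x) = a.1 0 • θ x) (x : M.M) : x ∈ mSub V M.M ↔ θ x = 0 := by
  letI := H.fin
  constructor
  · intro hx
    rw [mSub] at hx
    refine Submodule.smul_induction_on hx (fun r hr n _ => ?_) (fun x y hx hy => ?_)
    · rw [h2, mem_mId.1 hr, zero_smul]
    · rw [map_add, hx, hy, add_zero]
  · intro hx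
    obtain ⟨a, rfl⟩ := H.exists_coord x
    refine sum_mem fun i _ => smul_mem_mSub ?_ _
    rw [mem_mId, ← h1 a i, hx]
    rfl

lemma HB.local_rank {σ : Cone V} {M : GAMod V} (H : HB (vanishingIdeal V σ.carrier) M) (q : ℤ) :
    finrank ℝ (mRedPiece V (M.deg q)) = (letI := H.fin; (Finset.univ.filter fun i => H.dg i = q).card) := by
  letI := H.fin
  obtain ⟨θ, h1, h2⟩ := H.theta 0 (Submodule.zero_mem _)
  have e1 : finrank ℝ (mRedPiece V (M.deg q)) = finrank ℝ ((M.deg q).map θ) := by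
    refine finrank_map_eq _ _ _ fun x _ => ?_
    rw [← H.mem_mSub_iff θ h1 h2]
    exact Submodule.Quotient.mk_eq_zero _
  have e2 : (M.deg q).map θ = coordSub fun i => H.dg i = q := by
    apply le_antisymm
    · rintro _ ⟨x, hx, rfl⟩
      obtain ⟨b, rfl, b1, b2⟩ := H.hom_coord hx
      intro i hi
      rw [h1]
      by_cases hk : ∃ k : ℕ, q - H.dg i = 2 * k
      · obtain ⟨k, hk⟩ := hk
        have := b1 i k hk 0 0
        rw [zero_smul, zero_pow (by rintro rfl; apply hi; push_cast at hk; linarith), zero_mul] at this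
        exact this
      · push Not at hk
        rw [b2 i hk, zero_ap]
    · intro v hv
      refine ⟨∑ i, algebraMap ℝ (PolyRing V) (v i) • H.e i, ?_, ?_⟩
      · refine sum_mem fun i _ => ?_
        by_cases hi : H.dg i = q
        · rw [← real_smul, ← hi]
          exact Submodule.smul_mem _ _ (H.mem i)
        · rw [hv i hi, map_zero, zero_smul]
          exact zero_mem _
      · funext i
        rw [h1, alg_ap]
  rw [e1, e2, finrank_coordSub]
  congr!

lemma ideal_line {l : V} {lam : V →ₗ[ℝ] ℝ} {k : ℕ} {a : PolyRing V} (ha : a ∈ AdegN V k)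
    (h0 : a.1 l = 0) : a ∈ Ideal.span (Set.range fun f : V →ₗ[ℝ] ℝ => lin (f - f ∘ₗ (LinearMap.smulRight lam l))) := by
  have h := sub_pull_mem (LinearMap.smulRight lam l) a
  have h1 : pull (LinearMap.smulRight lam l) a = 0 := by
    apply poly_ext
    intro x
    rw [pull_ap, zero_ap, LinearMap.smulRight_apply]
    have := ha (lam x) l
    rw [this, h0, mul_zero]
  rwa [h1, sub_zero] at h

lemma HB.global_rank {σ : Cone V} {M : GAMod V} (H : HB (vanishingIdeal V σ.carrier) M) {g : V →ₗ[ℝ] U}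
    {N : GAMod U} (T : M.M →ₗ[ℝ] N.M) {l : V} (hl : l ∈ σ.spanC) (hl0 : l ≠ 0) (hgl : g l = 0)
    (hfac : ∀ f : V →ₗ[ℝ] ℝ, f l = 0 → ∃ f' : U →ₗ[ℝ] ℝ, f = f' ∘ₗ g)
    (hs : ∀ (b : PolyRing U) x, T (pull g b • x) = b • T x)
    (hd : ∀ q, ∀ x ∈ M.deg q, T x ∈ N.deg q)
    (ho : ∀ q, ∀ y ∈ N.deg q, ∃ x ∈ M.deg q, T x = y) (q : ℤ)
    (hk : ∀ x ∈ M.deg q, T x = 0 → x = 0) :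
    finrank ℝ (mRedPiece U (N.deg q)) =
      (letI := H.fin; (Finset.univ.filter fun i => ∃ k : ℕ, q - H.dg i = 2 * k).card) := by
  letI := H.fin
  obtain ⟨θ, h1, h2⟩ := H.theta l hl
  obtain ⟨lam, hlam⟩ : ∃ lam : V →ₗ[ℝ] ℝ, lam l = 1 := by
    obtain ⟨f, -, hf⟩ := exists_form_of_notMem (U := (⊥ : Submodule ℝ V)) (y := l) (by simpa using hl0)
    exact ⟨(f l)⁻¹ • f, by simp [hf]⟩
  have hmap : N.deg q = (M.deg q).map T := by
    apply le_antisymm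
    · intro y hy
      obtain ⟨x, hx, rfl⟩ := ho q y hy
      exact ⟨x, hx, rfl⟩
    · rintro _ ⟨x, hx, rfl⟩
      exact hd q x hx
  -- `T x ∈ m N` iff the coordinates vanish at `l`
  have hT : ∀ a ∈ Ideal.span (Set.range fun f : V →ₗ[ℝ] ℝ => lin (f - f ∘ₗ (LinearMap.smulRight lam l))),
      ∀ z : M.M, T (a • z) ∈ mSub U N.M := by
    intro a ha
    induction ha using Submodule.span_induction with
    | mem a ha =>
      intro z
      obtain ⟨f, rfl⟩ := ha
      obtain ⟨f', hf'⟩ := hfac (f - f ∘ₗ (LinearMap.smulRight lam l)) (by simp [hlam])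
      beta_reduce
      have : lin (f - f ∘ₗ (LinearMap.smulRight lam l)) = pull g (lin f') := by
        rw [hf']
        rfl
      rw [this, hs]
      exact smul_mem_mSub (lin_mem_mId f') _
    | zero =>
      intro z
      rw [zero_smul, map_zero]
      exact zero_mem _
    | add a b _ _ ha hb =>
      intro z
      rw [add_smul, map_add]
      exact add_mem (ha z) (hb z)
    | smul b a _ ha =>
      intro z
      rw [smul_eq_mul, mul_comm, mul_smul]
      exact ha _
  have key : ∀ x ∈ M.deg q, T x ∈ mSub U N.M ↔ θ x = 0 := by
    intro x hx
    constructor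
    · intro hTx
      have h3 := pr_mSub N hTx q
      rw [pr_self N (hd q x hx)] at h3
      have h4 : ∀ y ∈ Submodule.span ℝ {w : N.M | ∃ f : U →ₗ[ℝ] ℝ, ∃ z ∈ N.deg (q - 2), w = lin f • z},
          ∃ x' ∈ M.deg q, T x' = y ∧ θ x' = 0 := by
        intro y hy
        induction hy using Submodule.span_induction with
        | mem y hy =>
          obtain ⟨f, z, hz, rfl⟩ := hy
          obtain ⟨z', hz', rfl⟩ := ho _ z hz
          refine ⟨pull g (lin f) • z', ?_, hs _ _, ?_⟩
          · have := smul_deg' M (pull_AdegN g (lin_AdegN f)) hz'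
            simpa using this
          · rw [h2, pull_ap, hgl, lin_apply, map_zero, zero_smul]
        | zero => exact ⟨0, zero_mem _, map_zero _, map_zero _⟩
        | add y y' _ _ hy hy' =>
          obtain ⟨x, x1, x2, x3⟩ := hy
          obtain ⟨x', x1', x2', x3'⟩ := hy'
          exact ⟨x + x', add_mem x1 x1', by rw [map_add, x2, x2'], by rw [map_add, x3, x3', add_zero]⟩
        | smul r y _ hy =>
          obtain ⟨x, x1, x2, x3⟩ := hy
          exact ⟨r • x, Submodule.smul_mem _ _ x1, by rw [map_smul, x2], by rw [map_smul, x3, smul_zero]⟩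
      obtain ⟨x', x1, x2, x3⟩ := h4 _ h3
      have h5 := hk (x - x') (sub_mem hx x1) (by rw [map_sub, x2, sub_self])
      rw [sub_eq_zero.1 h5]
      exact x3
    · intro hθ
      obtain ⟨b, rfl, b1, b2⟩ := H.hom_coord hx
      rw [map_sum]
      refine sum_mem fun i _ => ?_
      by_cases hk : ∃ k : ℕ, q - H.dg i = 2 * k
      · obtain ⟨k, hk⟩ := hk
        refine hT _ (ideal_line (b1 i k hk) ?_) _
        rw [← h1 b i, hθ]
        rfl
      · push Not at hk
        rw [b2 i hk, zero_smul, map_zero]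
        exact zero_mem _
  have e1 : finrank ℝ (mRedPiece U (N.deg q)) = finrank ℝ ((M.deg q).map θ) := by
    rw [mRedPiece, hmap, ← Submodule.map_comp]
    refine finrank_map_eq _ _ _ fun x hx => ?_
    rw [← key x hx]
    exact Submodule.Quotient.mk_eq_zero _
  have e2 : (M.deg q).map θ = coordSub fun i => ∃ k : ℕ, q - H.dg i = 2 * k := by
    apply le_antisymm
    · rintro _ ⟨x, hx, rfl⟩
      obtain ⟨b, rfl, b1, b2⟩ := H.hom_coord hx
      intro i hi
      rw [h1]
      push Not at hi
      rw [b2 i hi, zero_ap]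
    · intro v hv
      refine ⟨∑ i, (algebraMap ℝ (PolyRing V) (v i) * lin lam ^ ((q - H.dg i) / 2).toNat) • H.e i, ?_, ?_⟩
      · refine sum_mem fun i _ => ?_
        by_cases hi : ∃ k : ℕ, q - H.dg i = 2 * k
        · obtain ⟨k, hi⟩ := hi
          have hk2 : ((q - H.dg i) / 2).toNat = k := by omega
          rw [hk2, mul_smul, ← real_smul]
          refine Submodule.smul_mem _ _ ?_
          have h5 : lin lam ^ k ∈ AdegN V k := by
            have := AdegN_prod (Finset.range k) (fun _ => lin lam) (fun _ => 1) (fun _ _ => lin_AdegN lam)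
            simpa using this
          have h6 := smul_deg' M h5 (H.mem i)
          rwa [show H.dg i + 2 * (k : ℤ) = q by linarith] at h6
        · rw [hv i hi, map_zero, zero_mul, zero_smul]
          exact zero_mem _
      · funext i
        rw [h1, mul_ap, alg_ap]
        have : ∀ n : ℕ, (lin lam ^ n).1 l = 1 := by
          intro n
          induction n with
          | zero => rw [pow_zero, one_ap]
          | succ n ih => rw [pow_succ, mul_ap, ih, lin_apply, hlam, mul_one]
        rw [this, mul_one]
  rw [e1, e2, finrank_coordSub]

lemma supp_finite (N : GAMod U) [Module.Finite (PolyRing U) N.M] :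
    (Function.support fun q : ℕ => finrank ℝ (mRedPiece U (N.deg q))).Finite := by
  obtain ⟨s, hs⟩ := (Module.finite_def.1 (inferInstance : Module.Finite (PolyRing U) N.M))
  choose t ht using fun x : N.M => pr_finset N x
  let Q : Finset ℤ := s.biUnion t
  refine Set.Finite.subset (Set.Finite.preimage (f := fun q : ℕ => (q : ℤ)) (fun a _ b _ h => by simpa using h) Q.finite_toSet) ?_
  intro q hq
  by_contra hqQ
  apply hq
  have hb : mRedPiece U (N.deg q) = ⊥ := by
    rw [eq_bot_iff]
    rintro _ ⟨x, hx, rfl⟩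
    have hx' : x ∈ Submodule.span (PolyRing U) (s : Set N.M) := by rw [hs]; trivial
    obtain ⟨a, ha⟩ := Submodule.mem_span_finset'.1 hx'
    have h1 : x - ∑ j : s, (a j).1 0 • (j : N.M) ∈ mSub U N.M := by
      rw [← ha, ← Finset.sum_sub_distrib]
      refine sum_mem fun j _ => ?_
      rw [real_smul (V := U), ← sub_smul]
      exact smul_mem_mSub (sub_alg_mem _) _
    have h2 := pr_mSub_mem N h1 q
    rw [map_sub, pr_self N hx, map_sum, Finset.sum_eq_zero, sub_zero] at h2
    · exact (Submodule.Quotient.mk_eq_zero _).2 h2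
    · intro j _
      rw [map_smul, ht j.1 q, smul_zero]
      intro h
      exact hqQ (Finset.mem_biUnion.2 ⟨j.1, j.2, h⟩)
  change finrank ℝ (mRedPiece U (N.deg q)) = 0
  rw [hb]
  simp

lemma poincare_coeff (d : ℕ → ℕ) (h : (Function.support d).Finite) (n : ℕ) : (poincareOf d).coeff n = d n := by
  unfold poincareOf
  rw [dif_pos h, Polynomial.finsetSum_coeff]
  simp only [Polynomial.coeff_smul, Polynomial.coeff_X_pow, smul_eq_mul, mul_ite, mul_one, mul_zero]
  rw [Finset.sum_ite_eq]
  split_ifs with h1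
  · rfl
  · simp only [Set.Finite.mem_toFinset, Function.mem_support, not_not] at h1
    rw [h1, Nat.cast_zero]

lemma trunc_coeff (r : ℕ) (p : Polynomial ℝ) (n : ℕ) : (truncBelow r p).coeff n = if n < r then p.coeff n else 0 := by
  unfold truncBelow
  rw [Polynomial.finsetSum_coeff]
  simp only [Polynomial.coeff_C_mul, Polynomial.coeff_X_pow, mul_ite, mul_one, mul_zero]
  rw [Finset.sum_ite_eq]
  simp

end

section

lemma card_step {ι : Type} [Fintype ι] (dg : ι → ℤ) (h0 : ∀ i, 0 ≤ dg i) (n : ℕ) :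
    (Finset.univ.filter fun i => ∃ k : ℕ, (n : ℤ) - dg i = 2 * k).card =
      (Finset.univ.filter fun i => dg i = n).card +
      (if 2 ≤ n then (Finset.univ.filter fun i => ∃ k : ℕ, ((n - 2 : ℕ) : ℤ) - dg i = 2 * k).card else 0) := by
  split_ifs with hn
  · rw [← Finset.card_union_of_disjoint]
    · congr 1
      ext i
      simp only [Finset.mem_filter, Finset.mem_univ, true_and, Finset.mem_union]
      constructor
      · rintro ⟨k, hk⟩
        rcases Nat.eq_zero_or_pos k with rfl | hk0
        · left; push_cast at hk; linarith
        · right; exact ⟨k - 1, by omega⟩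
      · rintro (h | ⟨k, hk⟩)
        · exact ⟨0, by push_cast; linarith⟩
        · exact ⟨k + 1, by omega⟩
    · rw [Finset.disjoint_left]
      intro i hi hj
      simp only [Finset.mem_filter, Finset.mem_univ, true_and] at hi hj
      obtain ⟨k, hk⟩ := hj
      omega
  · rw [add_zero]
    congr 1
    ext i
    simp only [Finset.mem_filter, Finset.mem_univ, true_and]
    have := h0 i
    constructor
    · rintro ⟨k, hk⟩
      omega
    · intro h
      exact ⟨0, by push_cast; linarith⟩

open Polynomial in
theorem main
    {V : Type} [AddCommGroup V] [Module ℝ V] [FiniteDimensional ℝ V]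
    {σ : Cone V} (hσ0 : σ ≠ zeroCone V)
    {Δσ : Fan V} (hΔσ : Δσ.cones = {τ : Cone V | τ.IsFaceOf σ}) (hmem : σ ∈ Δσ.cones)
    (E : FanSheaf Δσ) (hE : E.IsMES)
    (hvan : ∀ q : ℤ, (σ.dim : ℤ) ≤ q → mRedPiece V ((E.stalk ⟨σ, hmem⟩).deg q) = ⊥)
    (l : V) (hl : l ∈ σ.carrier) (hlrel : ∀ τ : Cone V, τ.IsProperFaceOf σ → l ∉ τ.carrier)
    (Λ : Fan (V ⧸ Submodule.span ℝ {l}))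
    (hΛ : Λ.cones = {c : Cone (V ⧸ Submodule.span ℝ {l}) |
      ∃ τ : Cone V, τ.IsProperFaceOf σ ∧
        c.carrier = (Submodule.span ℝ {l}).mkQ '' τ.carrier})
    (G : FanSheaf Λ) (hG : G.IsMES) :
    E.localP ⟨σ, hmem⟩ = truncBelow σ.dim ((1 - X ^ 2) * G.globalP) := by
  have hN := mes_nice E hE
  have hNG := mes_nice G hG
  obtain ⟨B, hB⟩ := exists_BK hΔσ l hl hlrel Λ hΛ
  obtain ⟨Φ, Φb, Φd⟩ := global_iso (B.nice hN) hNG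
  have hface : ∀ c, Cone.IsFaceOf (B.back c).1 (⟨σ, hmem⟩ : Δσ.cones).1 := fun c => ((hB _).2 ⟨c, rfl⟩).1
  obtain ⟨H⟩ := hN.hb ⟨σ, hmem⟩
  letI := H.fin
  have hl0 : l ≠ 0 := by
    rintro rfl
    exact hlrel (zeroCone V) ⟨zero_face_fan Δσ hmem, Ne.symm hσ0⟩ rfl
  have hdg0 : ∀ i, 0 ≤ H.dg i := by
    intro i
    by_contra hi
    push Not at hi
    have h1 := H.mem i
    rw [nice_bdd hN _ ⟨σ, hmem⟩ rfl _ hi, Submodule.mem_bot] at h1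
    apply H.e_notMem i
    rw [h1]
    exact zero_mem _
  have hdgd : ∀ i, H.dg i < σ.dim := H.dg_lt _ hvan
  have hgr : ∀ q : ℕ, q < σ.dim → finrank ℝ (mRedPiece (V ⧸ Submodule.span ℝ {l}) (M := G.globalSec) (G.secDeg Λ.cones q)) =
      (Finset.univ.filter fun i => ∃ k : ℕ, (q : ℤ) - H.dg i = 2 * k).card := by
    intro q hq
    refine H.global_rank (N := secG G Λ.cones) (g := (Submodule.span ℝ {l}).mkQ)
      ((Φ.restrictScalars ℝ) ∘ₗ Tm B E ⟨σ, hmem⟩ hface) (l := l) (carrier_sub_span σ hl) hl0 ?_ ?_ ?_ ?_ ?_ q ?_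
    · simp
    · intro f hf
      refine ⟨(Submodule.span ℝ {l}).liftQ f ?_, ?_⟩
      · rw [Submodule.span_le]
        rintro _ rfl
        exact hf
      · rw [Submodule.liftQ_mkQ]
    · intro b x
      change Φ (Tm B E ⟨σ, hmem⟩ hface _) = b • Φ (Tm B E ⟨σ, hmem⟩ hface x)
      rw [Tm_smul, map_smul]
    · intro q x hx
      exact (Φd q _).1 (Tm_deg B E ⟨σ, hmem⟩ hface x q hx)
    · intro q y hy
      obtain ⟨z, rfl⟩ := Φb.2 y
      obtain ⟨x, hx, rfl⟩ := Tm_surj B hN ⟨σ, hmem⟩ hface q z ((Φd q z).2 hy)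
      exact ⟨x, hx, rfl⟩
    · intro x hx h
      have h1 : Tm B E ⟨σ, hmem⟩ hface x = 0 := Φb.1 (Eq.trans h (map_zero Φ).symm)
      exact K_low hN ⟨σ, hmem⟩ hvan q (by exact_mod_cast hq) x hx
        (Tm_zero B ⟨σ, hmem⟩ hface (fun τ hτ => (hB τ).1 hτ) x h1)
  have hLf : Module.Finite (PolyRing V) (E.stalk ⟨σ, hmem⟩).M := H.finite
  have hGf : Module.Finite (PolyRing (V ⧸ Submodule.span ℝ {l})) (secG G Λ.cones).M :=
    sec_finite G _ fun τ _ => (hNG.hb τ).some.finite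
  have hL : ∀ n : ℕ, (E.localP ⟨σ, hmem⟩).coeff n = ((Finset.univ.filter fun i => H.dg i = n).card : ℝ) := by
    intro n
    unfold FanSheaf.localP
    rw [poincare_coeff _ (supp_finite (E.stalk ⟨σ, hmem⟩)), H.local_rank]
  have hR : ∀ n : ℕ, n < σ.dim → G.globalP.coeff n =
      ((Finset.univ.filter fun i => ∃ k : ℕ, (n : ℤ) - H.dg i = 2 * k).card : ℝ) := by
    intro n hn
    unfold FanSheaf.globalP
    rw [← hgr n hn]
    exact poincare_coeff _ (@supp_finite _ _ _ (secG G Λ.cones) hGf) n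
  ext n
  rw [hL, trunc_coeff]
  split_ifs with hn
  · rw [sub_mul, one_mul, Polynomial.coeff_sub, Polynomial.coeff_X_pow_mul', hR n hn, card_step H.dg hdg0 n]
    split_ifs with h2
    · rw [hR (n - 2) (by omega)]
      push_cast
      ring
    · simp
  · rw [Finset.filter_false_of_mem]
    · simp
    · intro i _ h
      have := hdgd i
      omega

end

end LRF

open Polynomial in
/-- Local recursion formula: if the non-zero cone `σ` satisfies the vanishing
condition `V(σ)` and `Λ_σ` is the flattened boundary fan of `σ` (the image of `∂σ`
in `V_σ/L` for a line `L` through the relative interior of `σ`), then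
`P_σ(t) = τ_{<dim σ}((1−t²)·P_{Λ_σ}(t))`. -/
theorem local_recursion_formula
    {V : Type} [AddCommGroup V] [Module ℝ V] [FiniteDimensional ℝ V]
    {σ : Cone V} (hσ0 : σ ≠ zeroCone V)
    {Δσ : Fan V} (hΔσ : Δσ.cones = {τ : Cone V | τ.IsFaceOf σ}) (hmem : σ ∈ Δσ.cones)
    (E : FanSheaf Δσ) (hE : E.IsMES)
    -- the vanishing condition V(σ): `Ē^q_σ = 0` for `q ≥ dim σ`
    (hvan : ∀ q : ℤ, (σ.dim : ℤ) ≤ q → mRedPiece V ((E.stalk ⟨σ, hmem⟩).deg q) = ⊥)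
    -- a line `L = ℝ·l` through the relative interior of `σ`
    (l : V) (hl : l ∈ σ.carrier) (hlrel : ∀ τ : Cone V, τ.IsProperFaceOf σ → l ∉ τ.carrier)
    -- the flattened boundary fan `Λ_σ = π(∂σ)` in `V_σ/L`
    (Λ : Fan (V ⧸ Submodule.span ℝ {l}))
    (hΛ : Λ.cones = {c : Cone (V ⧸ Submodule.span ℝ {l}) |
      ∃ τ : Cone V, τ.IsProperFaceOf σ ∧
        c.carrier = (Submodule.span ℝ {l}).mkQ '' τ.carrier})
    (G : FanSheaf Λ) (hG : G.IsMES) :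
    E.localP ⟨σ, hmem⟩ = truncBelow σ.dim ((1 - X ^ 2) * G.globalP) := by
  exact LRF.main hσ0 hΔσ hmem E hE hvan l hl hlrel Λ hΛ G hG

end
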